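/- Fix an even integer k > 1000 and a real ε > 0. There exists a constant C = C(k, ε) such that for every prime q, |∑_{n=1}^∞ n^{−1/2} V(n/q) ∑_{m=1}^∞ m^{−1/2} W(m/√q) ∑_{c=1}^∞ [S(m, n²; cq)/(cq)] · J_{k−1}(4πn√m/(cq))| ≤ C · q^{−1/8+ε}, the triple sum converging absolutely. -/

import Mathlib

/-- `e(x) = exp(2πix)`. -/
noncomputable def eF (x : ℝ) : ℂ := Complex.exp (2 * Real.pi * Complex.I * x)

/-- The Kloosterman sum `S(m,n;c) = ∑_{x mod c, (x,c)=1} e((m x + n x⁻¹)/c)`. -/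
noncomputable def kloos (m n : ℤ) (c : ℕ) : ℂ :=
  ∑ x ∈ (Finset.range c).filter (fun x => Nat.Coprime x c),
    eF (((m * x + n * (((x : ZMod c)⁻¹).val : ℤ) : ℤ) : ℝ) / c)

/-- Bessel function of the first kind of integer order:
`J_ν(x) = (1/π) ∫₀^π cos(νθ − x sin θ) dθ`. -/
noncomputable def besselJ (ν : ℕ) (x : ℝ) : ℝ :=
  (1 / Real.pi) * ∫ θ in (0 : ℝ)..Real.pi, Real.cos (ν * θ - x * Real.sin θ)

/-- `γ_□(s) = π^{−3s/2} Γ((s+1)/2) Γ((s+k−1)/2) Γ((s+k)/2)`. -/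
noncomputable def gammaBox (k : ℕ) (s : ℂ) : ℂ :=
  (Real.pi : ℂ) ^ (-3 * s / 2) * Complex.Gamma ((s + 1) / 2) *
    Complex.Gamma ((s + k - 1) / 2) * Complex.Gamma ((s + k) / 2)

/-- `V(y)`, the contour integral over `Re(s) = 2` of
`γ_□(1/2+s)/γ_□(1/2) (1 − q^{−1−2s}) ζ(1+2s) y^{−s} ds/(2πis)`. -/
noncomputable def Vfun (k q : ℕ) (y : ℝ) : ℂ :=
  (1 / (2 * Real.pi)) *
    ∫ t : ℝ,
      (gammaBox k (5 / 2 + t * Complex.I) / gammaBox k (1 / 2)) *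
        (1 - (q : ℂ) ^ (-(5 + 2 * t * Complex.I))) *
        riemannZeta (5 + 2 * t * Complex.I) *
        (y : ℂ) ^ (-(2 + t * Complex.I)) / (2 + t * Complex.I)

/-- `γ(s) = (2π)^{−s} Γ(s + (k−1)/2)`. -/
noncomputable def gammaW (k : ℕ) (s : ℂ) : ℂ :=
  (2 * Real.pi : ℂ) ^ (-s) * Complex.Gamma (s + ((k : ℂ) - 1) / 2)

/-- `W(y)`, the contour integral over `Re(s) = 2` of `γ(1/2+s)/γ(1/2) y^{−s} ds/(2πis)`. -/
noncomputable def Wfun (k : ℕ) (y : ℝ) : ℂ :=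
  (1 / (2 * Real.pi)) *
    ∫ t : ℝ,
      (gammaW k (5 / 2 + t * Complex.I) / gammaW k (1 / 2)) *
        (y : ℂ) ^ (-(2 + t * Complex.I)) / (2 + t * Complex.I)

section PartA

open Real MeasureTheory intervalIntegral

lemma besselJ_abs_le_one (n : ℕ) (x : ℝ) : |besselJ n x| ≤ 1 := by
  unfold besselJ
  have h : ‖∫ θ in (0 : ℝ)..π, cos (n * θ - x * sin θ)‖ ≤ 1 * |π - 0| := by
    apply intervalIntegral.norm_integral_le_of_norm_le_const
    intro θ _
    exact abs_cos_le_one _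
  rw [Real.norm_eq_abs, sub_zero, abs_of_pos pi_pos, one_mul] at h
  rw [abs_mul, abs_of_pos (by positivity : (0:ℝ) < 1 / π)]
  calc 1 / π * _ ≤ 1 / π * π := by gcongr
    _ = 1 := by field_simp

lemma besselJ_hasDerivAt_raw (n : ℕ) (x : ℝ) :
    HasDerivAt (besselJ n)
      ((1 / π) * ∫ θ in (0 : ℝ)..π, sin θ * sin (n * θ - x * sin θ)) x := by
  unfold besselJ
  apply HasDerivAt.const_mul
  have := intervalIntegral.hasDerivAt_integral_of_dominated_loc_of_deriv_le (μ := volume)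
    (F := fun (x θ : ℝ) => cos (n * θ - x * sin θ))
    (F' := fun (x θ : ℝ) => sin θ * sin (n * θ - x * sin θ)) (x₀ := x) (s := Set.univ)
    (a := 0) (b := π) (bound := fun _ => 1) Filter.univ_mem
    (Filter.Eventually.of_forall fun y => by
      apply Continuous.aestronglyMeasurable; fun_prop)
    (by apply Continuous.intervalIntegrable; fun_prop)
    (by apply Continuous.aestronglyMeasurable; fun_prop)
    (Filter.Eventually.of_forall fun θ _ y _ => by
      rw [norm_mul]
      exact mul_le_one₀ (abs_sin_le_one _) (norm_nonneg _) (abs_sin_le_one _))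
    (by simp)
    (Filter.Eventually.of_forall fun θ _ y _ => by
      have h1 : HasDerivAt (fun y : ℝ => (n:ℝ) * θ - y * sin θ) (-(1 * sin θ)) y := by
        simpa using ((hasDerivAt_id y).mul_const (sin θ)).const_sub ((n:ℝ) * θ)
      have h2 := h1.cos
      have e : sin θ * sin (n * θ - y * sin θ) = -sin (n * θ - y * sin θ) * -(1 * sin θ) := by ring
      rw [e]
      exact h2)
  exact this.2

lemma besselJ_hasDerivAt (n : ℕ) (x : ℝ) :
    HasDerivAt (besselJ (n + 1)) ((besselJ n x - besselJ (n + 2) x) / 2) x := by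
  convert besselJ_hasDerivAt_raw (n + 1) x using 1
  unfold besselJ
  rw [← mul_sub, ← intervalIntegral.integral_sub
    (by apply Continuous.intervalIntegrable; fun_prop)
    (by apply Continuous.intervalIntegrable; fun_prop), mul_div_assoc]
  congr 1
  rw [div_eq_iff two_ne_zero, ← intervalIntegral.integral_mul_const]
  congr 1
  ext θ
  have h1 : (n:ℝ) * θ - x * sin θ = (((n+1 : ℕ) : ℝ) * θ - x * sin θ) - θ := by push_cast; ring
  have h2 : ((n+2 : ℕ):ℝ) * θ - x * sin θ = (((n+1 : ℕ) : ℝ) * θ - x * sin θ) + θ := by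
    push_cast; ring
  rw [h1, h2, cos_sub, cos_add]
  ring

lemma besselJ_rec (n : ℕ) (x : ℝ) :
    2 * ((n : ℝ) + 1) * besselJ (n + 1) x = x * (besselJ n x + besselJ (n + 2) x) := by
  have key : ∫ θ in (0 : ℝ)..π,
      cos (((n+1 : ℕ) : ℝ) * θ - x * sin θ) * (((n+1 : ℕ) : ℝ) - x * cos θ) = 0 := by
    have : ∀ θ ∈ Set.uIcc 0 π, HasDerivAt (fun θ => sin (((n+1 : ℕ) : ℝ) * θ - x * sin θ))
        (cos (((n+1 : ℕ) : ℝ) * θ - x * sin θ) * (((n+1 : ℕ) : ℝ) - x * cos θ)) θ := by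
      intro θ _
      have h1 : HasDerivAt (fun θ : ℝ => ((n+1 : ℕ):ℝ) * θ - x * sin θ)
          (((n+1 : ℕ) : ℝ) - x * cos θ) θ := by
        simpa using ((hasDerivAt_id' θ).const_mul ((n+1 : ℕ):ℝ)).fun_sub
          ((hasDerivAt_sin θ).const_mul x)
      exact h1.sin
    rw [intervalIntegral.integral_eq_sub_of_hasDerivAt this
      (by apply Continuous.intervalIntegrable; fun_prop)]
    have h3 := Real.sin_nat_mul_pi (n + 1)
    simp only [Real.sin_pi, mul_zero, sub_zero, Real.sin_zero, h3]
  unfold besselJ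
  have e1 : ∀ θ : ℝ, cos (((n+1 : ℕ) : ℝ) * θ - x * sin θ) * (((n+1 : ℕ) : ℝ) - x * cos θ)
      = ((n:ℝ)+1) * cos (((n+1 : ℕ) : ℝ) * θ - x * sin θ)
        - (x / 2) * (cos ((n : ℝ) * θ - x * sin θ) + cos (((n+2 : ℕ) : ℝ) * θ - x * sin θ)) := by
    intro θ
    have h1 : (n:ℝ) * θ - x * sin θ = (((n+1 : ℕ) : ℝ) * θ - x * sin θ) - θ := by
      push_cast; ring
    have h2 : ((n+2 : ℕ):ℝ) * θ - x * sin θ = (((n+1 : ℕ) : ℝ) * θ - x * sin θ) + θ := by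
      push_cast; ring
    rw [h1, h2, cos_sub _ θ, cos_add _ θ]
    have h4 : ((n+1 : ℕ) : ℝ) = (n:ℝ) + 1 := by push_cast; ring
    rw [h4]
    ring
  simp_rw [e1] at key
  rw [intervalIntegral.integral_sub
    (by apply Continuous.intervalIntegrable; fun_prop)
    (by apply Continuous.intervalIntegrable; fun_prop), intervalIntegral.integral_const_mul,
    intervalIntegral.integral_const_mul, intervalIntegral.integral_add
    (by apply Continuous.intervalIntegrable; fun_prop)
    (by apply Continuous.intervalIntegrable; fun_prop)] at key
  linear_combination (2 / π) * key

lemma besselJ_abs_le_pow (j : ℕ) : ∀ (n : ℕ) (x : ℝ), j ≤ n → |besselJ n x| ≤ |x| ^ j := by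
  induction j with
  | zero => intro n x _; simpa using besselJ_abs_le_one n x
  | succ j ih =>
    intro n x hn
    obtain ⟨n, rfl⟩ : ∃ n', n = n' + 1 := ⟨n - 1, by omega⟩
    have h1 := ih n x (by omega)
    have h2 := ih (n + 2) x (by omega)
    have h3 : |2 * ((n : ℝ) + 1) * besselJ (n + 1) x| ≤ |x| * (|x| ^ j + |x| ^ j) := by
      rw [besselJ_rec, abs_mul]
      gcongr
      exact (abs_add_le _ _).trans (add_le_add h1 h2)
    rw [abs_mul, abs_of_pos (by positivity : (0:ℝ) < 2 * ((n:ℝ) + 1))] at h3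
    have h4 : |besselJ (n+1) x| ≤ ((n:ℝ) + 1) * |besselJ (n+1) x| := by
      have : (0:ℝ) ≤ n * |besselJ (n+1) x| := by positivity
      linarith
    rw [pow_succ]
    linarith

lemma besselJ_decay (n : ℕ) : ∃ K : ℝ, 0 ≤ K ∧ ∀ x : ℝ, 0 < x →
    |besselJ (n + 2) x| ≤ K * x ^ (-(1:ℝ)/2) := by
  set a := besselJ (n + 2) with ha
  set b := besselJ (n + 1) with hb
  set κ : ℝ := 2 * n + 3 with hκ
  have hκ0 : 0 < κ := by positivity
  have da : ∀ x : ℝ, 0 < x → HasDerivAt a (b x - (n + 2) / x * a x) x := by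
    intro x hx
    have h1 := besselJ_hasDerivAt (n + 1) x
    have h2 := besselJ_rec (n + 1) x
    convert h1 using 1
    rw [← hb]
    have h3 : besselJ (n + 1 + 2) x = 2 * (n + 2) / x * a x - b x := by
      field_simp
      push_cast at h2
      rw [ha, hb]
      linarith
    rw [h3]
    ring
  have db : ∀ x : ℝ, 0 < x → HasDerivAt b (-a x + (n + 1) / x * b x) x := by
    intro x hx
    have h1 := besselJ_hasDerivAt n x
    have h2 := besselJ_rec n x
    convert h1 using 1
    rw [← ha]
    have h3 : besselJ n x = 2 * (n + 1) / x * b x - a x := by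
      field_simp
      rw [ha, hb]
      linarith
    rw [h3]
    ring
  let P : ℝ → ℝ := fun x => x * (a x ^ 2 + b x ^ 2) - κ * (a x * b x)
  have dP : ∀ x : ℝ, 0 < x → HasDerivAt P (κ / x * (a x * b x)) x := by
    intro x hx
    have h1 := ((hasDerivAt_id' x).fun_mul (((da x hx).fun_pow 2).fun_add ((db x hx).fun_pow 2))).fun_sub
      (((da x hx).fun_mul (db x hx)).const_mul κ)
    refine h1.congr_deriv ?_
    rw [hκ]
    field_simp
    ring
  let E : ℝ → ℝ := fun x => P x * Real.exp (κ / x)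
  have dE : ∀ x : ℝ, 0 < x → HasDerivAt E
      (κ / x * (a x * b x) * Real.exp (κ / x) + P x * (Real.exp (κ / x) * (-κ / x ^ 2))) x := by
    intro x hx
    have h1 : HasDerivAt (fun x : ℝ => κ / x) (-κ / x ^ 2) x := by
      have := (hasDerivAt_inv hx.ne').const_mul κ
      refine this.congr_deriv ?_
      ring
    exact (dP x hx).fun_mul h1.exp
  have hab : ∀ x, |a x * b x| ≤ (a x ^ 2 + b x ^ 2) / 2 := by
    intro x
    rw [abs_le]
    constructor <;> nlinarith [sq_nonneg (a x + b x), sq_nonneg (a x - b x)]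
  have hP : ∀ x, κ ≤ x → x / 2 * (a x ^ 2 + b x ^ 2) ≤ P x := by
    intro x hx
    have h1 := (abs_le.1 (hab x)).2
    have h2 : 0 ≤ a x ^ 2 + b x ^ 2 := by positivity
    simp only [P]
    nlinarith
  have hanti : AntitoneOn E (Set.Ici κ) := by
    apply antitoneOn_of_deriv_nonpos (convex_Ici κ)
    · intro x hx
      exact (dE x (hκ0.trans_le hx)).continuousAt.continuousWithinAt
    · intro x hx
      rw [interior_Ici] at hx
      exact (dE x (hκ0.trans hx)).differentiableAt.differentiableWithinAt
    · intro x hx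
      rw [interior_Ici] at hx
      have hx0 : 0 < x := hκ0.trans hx
      rw [(dE x hx0).deriv]
      have h1 := (abs_le.1 (hab x)).2
      have h2 := hP x hx.le
      have h3 : κ / x * (a x * b x) - P x * (κ / x ^ 2) ≤ 0 := by
        have : κ / x * (a x * b x) - P x * (κ / x ^ 2) = κ / x ^ 2 * (x * (a x * b x) - P x) := by
          field_simp
        rw [this]
        apply mul_nonpos_of_nonneg_of_nonpos (by positivity)
        nlinarith
      have h4 : κ / x * (a x * b x) * Real.exp (κ / x) + P x * (Real.exp (κ / x) * (-κ / x ^ 2))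
        = Real.exp (κ / x) * (κ / x * (a x * b x) - P x * (κ / x ^ 2)) := by ring
      rw [h4]
      exact mul_nonpos_of_nonneg_of_nonpos (Real.exp_pos _).le h3
  have hE0 : 0 ≤ E κ := by
    apply mul_nonneg _ (Real.exp_pos _).le
    exact le_trans (by positivity) (hP κ le_rfl)
  refine ⟨Real.sqrt (2 * E κ) + Real.sqrt κ, by positivity, fun x hx => ?_⟩
  have hrp : x ^ (-(1:ℝ)/2) = 1 / Real.sqrt x := by
    rw [Real.sqrt_eq_rpow, neg_div, Real.rpow_neg hx.le, one_div, one_div]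
  have hsx : 0 < Real.sqrt x := Real.sqrt_pos.2 hx
  rw [hrp, mul_one_div, le_div_iff₀ hsx]
  by_cases hxk : κ ≤ x
  · have h1 : E x ≤ E κ := hanti (Set.mem_Ici.2 le_rfl) hxk hxk
    have h2 : P x ≤ E x := by
      have hp : 0 ≤ P x := le_trans (by positivity) (hP x hxk)
      have : 1 ≤ Real.exp (κ / x) := Real.one_le_exp (by positivity)
      simp only [E]
      nlinarith
    have h3 : x * a x ^ 2 ≤ 2 * E κ := by
      have := hP x hxk
      nlinarith [mul_nonneg hx.le (sq_nonneg (b x))]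
    have h4 : |a x| * Real.sqrt x ≤ Real.sqrt (2 * E κ) := by
      apply Real.le_sqrt_of_sq_le
      rw [mul_pow, sq_abs, Real.sq_sqrt hx.le]
      linarith
    linarith [Real.sqrt_nonneg κ]
  · have h1 := besselJ_abs_le_one (n + 2) x
    have h2 : Real.sqrt x ≤ Real.sqrt κ := Real.sqrt_le_sqrt (not_le.1 hxk).le
    have h3 := Real.sqrt_nonneg (2 * E κ)
    have : |a x| * Real.sqrt x ≤ 1 * Real.sqrt x := by gcongr
    linarith

end PartA

section PartB

open Complex MeasureTheory Filter Topology

/-- Inverse Mellin transform along `Re s = σ`. -/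
noncomputable def Mel (F : ℂ → ℂ) (σ y : ℝ) : ℂ :=
  (1 / (2 * Real.pi)) * ∫ t : ℝ, F (σ + t * I) * (y : ℂ) ^ (-((σ : ℂ) + t * I))

/-- Holomorphic on the right half plane, with decay of order `N` in vertical strips. -/
structure Cls (N : ℕ) (K : ℝ → ℝ → ℝ) (F : ℂ → ℂ) : Prop where
  diff : ∀ s : ℂ, 0 < s.re → DifferentiableAt ℂ F s
  bd : ∀ (a b : ℝ) (s : ℂ), 0 < a → a ≤ s.re → s.re ≤ b → ‖F s‖ ≤ K a b / (1 + |s.im|) ^ N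

lemma Cls.K_nonneg {N : ℕ} {K : ℝ → ℝ → ℝ} {F : ℂ → ℂ} (h : Cls N K F) {a b : ℝ} (ha : 0 < a)
    (hab : a ≤ b) : 0 ≤ K a b := by
  have := (norm_nonneg _).trans (h.bd a b (a : ℂ) ha (by simp) (by simpa using hab))
  simpa using this

lemma Cls.mulSub {N : ℕ} {K : ℝ → ℝ → ℝ} {F : ℂ → ℂ} (h : Cls (N + 1) K F) (α : ℝ) :
    Cls N (fun a b => (|α| + |b| + 1) * K a b) (fun s => ((α : ℂ) - s) * F s) := by
  refine ⟨fun s hs => ((differentiableAt_const _).sub differentiableAt_id).mul (h.diff s hs), ?_⟩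
  intro a b s ha has hsb
  have h1 := h.bd a b s ha has hsb
  have hK := h.K_nonneg ha (has.trans hsb)
  rw [norm_mul]
  have h2 : ‖(α : ℂ) - s‖ ≤ (|α| + |b| + 1) * (1 + |s.im|) := by
    have h3 : ‖(α : ℂ) - s‖ ≤ |α| + ‖s‖ := by
      refine (norm_sub_le _ _).trans ?_
      simp
    have h4 := Complex.norm_le_abs_re_add_abs_im s
    have h5 : |s.re| ≤ |b| := by
      rw [abs_of_pos (ha.trans_le has)]
      exact hsb.trans (le_abs_self b)
    nlinarith [abs_nonneg α, abs_nonneg b, abs_nonneg s.im]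
  calc ‖(α : ℂ) - s‖ * ‖F s‖ ≤ ((|α| + |b| + 1) * (1 + |s.im|)) * (K a b / (1 + |s.im|) ^ (N + 1)) := by
        gcongr
    _ = _ := by
        have : (1 + |s.im|) ≠ 0 := by positivity
        field_simp
        ring

lemma Cls.weaken {N N' : ℕ} {K : ℝ → ℝ → ℝ} {F : ℂ → ℂ} (h : Cls N K F) (hN : N' ≤ N) :
    Cls N' K F := by
  refine ⟨h.diff, ?_⟩
  intro a b s ha has hsb
  refine (h.bd a b s ha has hsb).trans ?_
  have hK := h.K_nonneg ha (has.trans hsb)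
  gcongr
  linarith [abs_nonneg s.im]

lemma re_line (σ t : ℝ) : ((σ : ℂ) + t * I).re = σ := by simp

lemma im_line (σ t : ℝ) : ((σ : ℂ) + t * I).im = t := by simp

lemma norm_cpow_line {y : ℝ} (hy : 0 < y) (σ t : ℝ) :
    ‖(y : ℂ) ^ (-((σ : ℂ) + t * I))‖ = y ^ (-σ) := by
  rw [Complex.norm_cpow_eq_rpow_re_of_pos hy]
  simp

lemma inv_sq_bound (t : ℝ) {N : ℕ} (hN : 2 ≤ N) : 1 / (1 + |t|) ^ N ≤ (1 + t ^ 2)⁻¹ := by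
  rw [← one_div]
  apply one_div_le_one_div_of_le (by positivity)
  have h1 : (1 + |t|) ^ 2 ≤ (1 + |t|) ^ N := pow_le_pow_right₀ (by linarith [abs_nonneg t]) hN
  nlinarith [abs_nonneg t, sq_abs t]

lemma Cls.line_bound {N : ℕ} {K : ℝ → ℝ → ℝ} {F : ℂ → ℂ} (h : Cls N K F) (hN : 2 ≤ N)
    {σ y : ℝ} (hσ : 0 < σ) (hy : 0 < y) (t : ℝ) :
    ‖F (σ + t * I) * (y : ℂ) ^ (-((σ : ℂ) + t * I))‖ ≤ K σ σ * y ^ (-σ) * (1 + t ^ 2)⁻¹ := by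
  rw [norm_mul, norm_cpow_line hy]
  have h1 := h.bd σ σ (σ + t * I) hσ (by simp) (by simp)
  rw [im_line] at h1
  have hK := h.K_nonneg hσ le_rfl
  have h2 := inv_sq_bound t hN
  calc _ ≤ (K σ σ * (1 / (1 + |t|) ^ N)) * y ^ (-σ) := by
        rw [mul_one_div]; gcongr
    _ ≤ (K σ σ * (1 + t ^ 2)⁻¹) * y ^ (-σ) := by gcongr
    _ = _ := by ring

lemma Cls.cont {N : ℕ} {K : ℝ → ℝ → ℝ} {F : ℂ → ℂ} (h : Cls N K F)
    {σ y : ℝ} (hσ : 0 < σ) (hy : 0 < y) :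
    Continuous (fun t : ℝ => F (σ + t * I) * (y : ℂ) ^ (-((σ : ℂ) + t * I))) := by
  rw [continuous_iff_continuousAt]
  intro t
  apply ContinuousAt.mul
  · have h1 : ContinuousAt F (σ + t * I) := (h.diff _ (by simpa using hσ)).continuousAt
    exact ContinuousAt.comp (f := fun t : ℝ => (σ : ℂ) + t * I) (g := F) h1
      (by fun_prop)
  · have hy' : (y : ℂ) ≠ 0 := by exact_mod_cast hy.ne'
    apply Continuous.continuousAt
    exact Continuous.const_cpow (by fun_prop) (Or.inl hy')

lemma Cls.integrable {N : ℕ} {K : ℝ → ℝ → ℝ} {F : ℂ → ℂ} (h : Cls N K F) (hN : 2 ≤ N)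
    {σ y : ℝ} (hσ : 0 < σ) (hy : 0 < y) :
    Integrable (fun t : ℝ => F (σ + t * I) * (y : ℂ) ^ (-((σ : ℂ) + t * I))) := by
  refine Integrable.mono' (integrable_inv_one_add_sq.const_mul (K σ σ * y ^ (-σ)))
    (h.cont hσ hy).aestronglyMeasurable (Eventually.of_forall fun t => ?_)
  exact h.line_bound hN hσ hy t

lemma Cls.Mel_bound {N : ℕ} {K : ℝ → ℝ → ℝ} {F : ℂ → ℂ} (h : Cls N K F) (hN : 2 ≤ N)
    {σ y : ℝ} (hσ : 0 < σ) (hy : 0 < y) : ‖Mel F σ y‖ ≤ K σ σ * y ^ (-σ) := by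
  have hK := h.K_nonneg hσ le_rfl
  have h1 : ‖∫ t : ℝ, F (σ + t * I) * (y : ℂ) ^ (-((σ : ℂ) + t * I))‖
      ≤ ∫ t : ℝ, K σ σ * y ^ (-σ) * (1 + t ^ 2)⁻¹ :=
    norm_integral_le_of_norm_le (integrable_inv_one_add_sq.const_mul _)
      (Eventually.of_forall fun t => h.line_bound hN hσ hy t)
  rw [integral_const_mul, integral_univ_inv_one_add_sq] at h1
  unfold Mel
  rw [norm_mul]
  have h2 : ‖(1 / (2 * Real.pi) : ℂ)‖ = 1 / (2 * Real.pi) := by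
    rw [norm_div, norm_mul, Complex.norm_real, Real.norm_eq_abs, abs_of_pos Real.pi_pos]
    simp
  rw [h2]
  have h3 : 0 ≤ K σ σ * y ^ (-σ) := by positivity
  calc _ ≤ 1 / (2 * Real.pi) * (K σ σ * y ^ (-σ) * Real.pi) := by gcongr
    _ = K σ σ * y ^ (-σ) / 2 := by field_simp
    _ ≤ _ := by linarith

lemma Cls.Mel_shift {N : ℕ} {K : ℝ → ℝ → ℝ} {F : ℂ → ℂ} (h : Cls N K F) (hN : 2 ≤ N)
    {a b y : ℝ} (ha : 0 < a) (hab : a ≤ b) (hy : 0 < y) : Mel F a y = Mel F b y := by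
  have hb : 0 < b := ha.trans_le hab
  have hK := h.K_nonneg ha hab
  unfold Mel
  congr 1
  set g : ℂ → ℂ := fun s => F s * (y : ℂ) ^ (-s) with hg
  have hy' : (y : ℂ) ≠ 0 := by exact_mod_cast hy.ne'
  have hgd : ∀ s : ℂ, 0 < s.re → DifferentiableAt ℂ g s := by
    intro s hs
    refine (h.diff s hs).mul ?_
    exact (differentiableAt_id.neg).const_cpow (Or.inl hy')
  have hrect : ∀ T : ℝ, (((∫ x : ℝ in a..b, g (x + (-T : ℝ) * I)) - ∫ x : ℝ in a..b, g (x + T * I)) +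
      I • ∫ t : ℝ in (-T)..T, g (b + t * I)) - I • (∫ t : ℝ in (-T)..T, g (a + t * I)) = 0 := by
    intro T
    have := Complex.integral_boundary_rect_eq_zero_of_differentiableOn g (a + (-T : ℝ) * I) (b + T * I)
      (by
        intro s hs
        apply (hgd s _).differentiableWithinAt
        rw [Complex.mem_reProdIm] at hs
        have h1 := hs.1
        simp only [re_line] at h1
        rw [Set.uIcc_of_le hab] at h1
        exact ha.trans_le h1.1)
    simpa only [re_line, im_line] using this
  have t1 : ∀ σ : ℝ, 0 < σ → Tendsto (fun T : ℝ => ∫ t : ℝ in (-T)..T, g (σ + t * I)) atTop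
      (𝓝 (∫ t : ℝ, g (σ + t * I))) := fun σ hσ =>
    intervalIntegral_tendsto_integral (h.integrable hN hσ hy) tendsto_neg_atTop_atBot tendsto_id
  have hhor : ∀ (T : ℝ) (x : ℝ), x ∈ Set.uIoc a b →
      ‖g (x + T * I)‖ ≤ K a b * (y ^ (-a) + y ^ (-b)) * (1 + T ^ 2)⁻¹ := by
    intro T x hx
    rw [Set.uIoc_of_le hab] at hx
    simp only [hg]
    rw [norm_mul, norm_cpow_line hy]
    have h1 := h.bd a b (x + T * I) ha (by simpa using hx.1.le) (by simpa using hx.2)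
    rw [im_line] at h1
    have h2 := inv_sq_bound T hN
    have h3 : y ^ (-x) ≤ y ^ (-a) + y ^ (-b) := by
      rcases le_total 1 y with h1y | h1y
      · have : y ^ (-x) ≤ y ^ (-a) := Real.rpow_le_rpow_of_exponent_le h1y (by linarith [hx.1])
        have : 0 ≤ y ^ (-b) := by positivity
        linarith
      · have : y ^ (-x) ≤ y ^ (-b) := Real.rpow_le_rpow_of_exponent_ge hy h1y (by linarith [hx.2])
        have : 0 ≤ y ^ (-a) := by positivity
        linarith
    calc _ ≤ (K a b * (1 / (1 + |T|) ^ N)) * y ^ (-x) := by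
          rw [mul_one_div]; gcongr
      _ ≤ (K a b * (1 + T ^ 2)⁻¹) * (y ^ (-a) + y ^ (-b)) := by gcongr
      _ = _ := by ring
  have hlim : Tendsto (fun T : ℝ => K a b * (y ^ (-a) + y ^ (-b)) * (1 + T ^ 2)⁻¹ * |b - a|) atTop
      (𝓝 0) := by
    have : Tendsto (fun T : ℝ => (1 + T ^ 2)⁻¹) atTop (𝓝 0) := by
      apply tendsto_inv_atTop_zero.comp
      exact tendsto_atTop_add_const_left _ _ (tendsto_pow_atTop two_ne_zero)
    simpa using (this.const_mul (K a b * (y ^ (-a) + y ^ (-b)))).mul_const |b - a|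
  have hT1 : Tendsto (fun T : ℝ => ∫ x : ℝ in a..b, g (x + T * I)) atTop (𝓝 0) :=
    squeeze_zero_norm (fun T => intervalIntegral.norm_integral_le_of_norm_le_const (hhor T)) hlim
  have hT2 : Tendsto (fun T : ℝ => ∫ x : ℝ in a..b, g (x + (-T : ℝ) * I)) atTop (𝓝 0) := by
    refine squeeze_zero_norm (fun T => intervalIntegral.norm_integral_le_of_norm_le_const ?_) hlim
    intro x hx
    have := hhor (-T) x hx
    rwa [neg_sq] at this
  have hfin := ((hT2.sub hT1).add ((t1 b hb).const_smul I)).sub ((t1 a ha).const_smul I)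
  have h0 : Tendsto (fun _ : ℝ => (0 : ℂ)) atTop (𝓝 0) := tendsto_const_nhds
  have hu := tendsto_nhds_unique (hfin.congr hrect) h0
  have : I * ((∫ t : ℝ, g (b + t * I)) - ∫ t : ℝ, g (a + t * I)) = 0 := by
    rw [mul_sub]; simpa using hu
  rcases mul_eq_zero.1 this with h1 | h1
  · exact absurd h1 I_ne_zero
  · exact (sub_eq_zero.1 h1).symm

lemma Cls.Mel_eq {N : ℕ} {K : ℝ → ℝ → ℝ} {F : ℂ → ℂ} (h : Cls N K F) (hN : 2 ≤ N)
    {a b y : ℝ} (ha : 0 < a) (hb : 0 < b) (hy : 0 < y) : Mel F a y = Mel F b y := by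
  rcases le_total a b with hab | hab
  · exact h.Mel_shift hN ha hab hy
  · exact (h.Mel_shift hN hb hab hy).symm

/-- bound by any power -/
lemma Cls.Mel_bound' {N : ℕ} {K : ℝ → ℝ → ℝ} {F : ℂ → ℂ} (h : Cls N K F) (hN : 2 ≤ N)
    {σ σ' y : ℝ} (hσ : 0 < σ) (hσ' : 0 < σ') (hy : 0 < y) :
    ‖Mel F σ y‖ ≤ K σ' σ' * y ^ (-σ') := by
  rw [h.Mel_eq hN hσ hσ' hy]
  exact h.Mel_bound hN hσ' hy

lemma Cls.Mel_deriv {N : ℕ} {K : ℝ → ℝ → ℝ} {F : ℂ → ℂ} (h : Cls (N + 1) K F) (hN : 2 ≤ N)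
    {σ y : ℝ} (hσ : 0 < σ) (hy : 0 < y) :
    HasDerivAt (fun y : ℝ => Mel F σ y) (Mel (fun s => (((0 : ℝ) : ℂ) - s) * F s) σ y / y) y := by
  have hG := h.mulSub 0
  set G : ℂ → ℂ := fun s => (((0 : ℝ) : ℂ) - s) * F s with hGdef
  set K' : ℝ → ℝ → ℝ := fun a b => (|0| + |b| + 1) * K a b with hK'
  have hKK : 0 ≤ K' σ σ := hG.K_nonneg hσ le_rfl
  have key := hasDerivAt_integral_of_dominated_loc_of_deriv_le (μ := volume)
    (F := fun (y : ℝ) (t : ℝ) => F (σ + t * I) * (y : ℂ) ^ (-((σ : ℂ) + t * I)))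
    (F' := fun (y : ℝ) (t : ℝ) => G (σ + t * I) * (y : ℂ) ^ (-((σ : ℂ) + t * I)) / y)
    (x₀ := y) (s := Set.Ioi (y / 2))
    (bound := fun t => K' σ σ * (y / 2) ^ (-σ) * (1 + t ^ 2)⁻¹ / (y / 2))
    (Ioi_mem_nhds (by linarith))
    (by
      filter_upwards [Ioi_mem_nhds hy] with z hz
      exact (h.cont hσ hz).aestronglyMeasurable)
    (h.integrable (by omega) hσ hy)
    ((hG.cont hσ hy).div_const _).aestronglyMeasurable
    (Eventually.of_forall fun t z hz => by
      have hz0 : 0 < z := lt_trans (by linarith) hz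
      rw [norm_div]
      have h1 := hG.line_bound hN hσ hz0 t
      have h2 : ‖(z : ℂ)‖ = z := by rw [Complex.norm_real, Real.norm_eq_abs, abs_of_pos hz0]
      rw [h2]
      have h3 : z ^ (-σ) ≤ (y / 2) ^ (-σ) :=
        Real.rpow_le_rpow_of_nonpos (by linarith) (le_of_lt hz) (by linarith)
      have h4 : K' σ σ * z ^ (-σ) * (1 + t ^ 2)⁻¹ ≤ K' σ σ * (y / 2) ^ (-σ) * (1 + t ^ 2)⁻¹ := by
        gcongr
      exact div_le_div₀ (by positivity) (h1.trans h4) (by linarith) (le_of_lt hz))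
    ((integrable_inv_one_add_sq.const_mul _).div_const _)
    (Eventually.of_forall fun t z hz => by
      have hz0 : 0 < z := lt_trans (by linarith) hz
      have hz' : (z : ℂ) ≠ 0 := by exact_mod_cast hz0.ne'
      have hne : (-((σ : ℂ) + t * I)) ≠ 0 := by
        intro h0
        have := congrArg Complex.re h0
        simp at this
        linarith
      have h1 : HasDerivAt (fun z : ℝ => (z : ℂ) ^ (-((σ : ℂ) + t * I)))
          ((-((σ : ℂ) + t * I)) * (z : ℂ) ^ (-((σ : ℂ) + t * I) - 1)) z :=
        hasDerivAt_ofReal_cpow_const hz0.ne' hne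
      refine (h1.const_mul (F (σ + t * I))).congr_deriv ?_
      rw [Complex.cpow_sub _ _ hz', Complex.cpow_one, hGdef]
      simp only [Complex.ofReal_zero]
      ring)
  unfold Mel
  have h2 := key.2.const_mul ((1 / (2 * Real.pi)) : ℂ)
  refine h2.congr_deriv ?_
  rw [integral_div, mul_div_assoc]

end PartB

section PartB2

open Complex MeasureTheory Filter Topology

lemma norm_Gamma_strip {a b : ℝ} (ha : 0 < a) {z : ℂ} (h1 : a ≤ z.re) (h2 : z.re ≤ b) :
    ‖Complex.Gamma z‖ ≤ Real.Gamma a + Real.Gamma b := by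
  have hz : 0 < z.re := ha.trans_le h1
  have hb : 0 < b := hz.trans_le h2
  rw [Complex.Gamma_eq_integral hz, Complex.GammaIntegral, Real.Gamma_eq_integral ha,
    Real.Gamma_eq_integral hb, ← integral_add (Real.GammaIntegral_convergent ha)
      (Real.GammaIntegral_convergent hb)]
  refine norm_integral_le_of_norm_le
    ((Real.GammaIntegral_convergent ha).add (Real.GammaIntegral_convergent hb)) ?_
  refine (ae_restrict_iff' measurableSet_Ioi).mpr (Eventually.of_forall fun x hx => ?_)
  have hx0 : (0:ℝ) < x := hx
  rw [norm_mul, Complex.norm_of_nonneg (Real.exp_pos (-x)).le,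
    Complex.norm_cpow_eq_rpow_re_of_pos hx0, ← mul_add]
  apply mul_le_mul_of_nonneg_left _ (Real.exp_pos (-x)).le
  have hre : (z - 1).re = z.re - 1 := by simp
  rw [hre]
  rcases le_total 1 x with h | h
  · have : x ^ (z.re - 1) ≤ x ^ (b - 1) := Real.rpow_le_rpow_of_exponent_le h (by linarith)
    have : 0 ≤ x ^ (a - 1) := by positivity
    linarith
  · have : x ^ (z.re - 1) ≤ x ^ (a - 1) := Real.rpow_le_rpow_of_exponent_ge hx0 h (by linarith)
    have : 0 ≤ x ^ (b - 1) := by positivity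
    linarith

lemma norm_ge_half {z : ℂ} (h : 1 ≤ z.re) : (1 + |z.im|) / 2 ≤ ‖z‖ := by
  have h1 := (le_abs_self z.re).trans (Complex.abs_re_le_norm z)
  have h2 := Complex.abs_im_le_norm z
  linarith

lemma norm_Gamma_decay {a b : ℝ} (ha : 1 ≤ a) {z : ℂ} (h1 : a ≤ z.re) (h2 : z.re ≤ b) :
    ‖Complex.Gamma z‖ ≤ 16 * (Real.Gamma (a + 4) + Real.Gamma (b + 4)) / (1 + |z.im|) ^ 4 := by
  have hz : 1 ≤ z.re := ha.trans h1
  have hne : ∀ j : ℝ, 0 ≤ j → z + j ≠ 0 := by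
    intro j hj h0
    have := congrArg Complex.re h0
    simp at this
    linarith
  have e4 : Complex.Gamma (z + 4) = (z + 3) * ((z + 2) * ((z + 1) * (z * Complex.Gamma z))) := by
    have n0 : z ≠ 0 := by simpa using hne 0 le_rfl
    have n1 : z + 1 ≠ 0 := by simpa using hne 1 (by norm_num)
    have n2 : z + 2 ≠ 0 := by simpa using hne 2 (by norm_num)
    have n3 : z + 3 ≠ 0 := by simpa using hne 3 (by norm_num)
    rw [← Complex.Gamma_add_one z n0, ← Complex.Gamma_add_one (z + 1) n1,
      show z + 1 + 1 = z + 2 by ring, ← Complex.Gamma_add_one (z + 2) n2,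
      show z + 2 + 1 = z + 3 by ring, ← Complex.Gamma_add_one (z + 3) n3]
    congr 1
    ring
  have hb4 : ‖Complex.Gamma (z + 4)‖ ≤ Real.Gamma (a + 4) + Real.Gamma (b + 4) := by
    apply norm_Gamma_strip (by linarith)
    · simpa using h1
    · simpa using h2
  rw [e4, norm_mul, norm_mul, norm_mul, norm_mul] at hb4
  have g0 := norm_ge_half hz
  have g1 : (1 + |z.im|) / 2 ≤ ‖z + 1‖ := by
    have := norm_ge_half (z := z + 1) (by simp; linarith)
    simpa using this
  have g2 : (1 + |z.im|) / 2 ≤ ‖z + 2‖ := by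
    have := norm_ge_half (z := z + 2) (by simp; linarith)
    simpa using this
  have g3 : (1 + |z.im|) / 2 ≤ ‖z + 3‖ := by
    have := norm_ge_half (z := z + 3) (by simp; linarith)
    simpa using this
  have hp : 0 < 1 + |z.im| := by positivity
  rw [le_div_iff₀ (by positivity)]
  have : ((1 + |z.im|) / 2) * (((1 + |z.im|) / 2) * (((1 + |z.im|) / 2) * (((1 + |z.im|) / 2) *
      ‖Complex.Gamma z‖))) ≤ Real.Gamma (a + 4) + Real.Gamma (b + 4) := by
    refine le_trans ?_ hb4
    gcongr
  linarith

lemma norm_zeta_bound {a : ℝ} (ha : 0 < a) {s : ℂ} (h : a ≤ s.re) :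
    ‖riemannZeta (1 + 2 * s)‖ ≤ ∑' n : ℕ, 1 / (n : ℝ) ^ (1 + 2 * a) := by
  have hre : (1 + 2 * s).re = 1 + 2 * s.re := by simp
  rw [zeta_eq_tsum_one_div_nat_cpow (by rw [hre]; linarith)]
  have hs : Summable (fun n : ℕ => 1 / (n : ℝ) ^ (1 + 2 * a)) :=
    Real.summable_one_div_nat_rpow.2 (by linarith)
  refine tsum_of_norm_bounded hs.hasSum ?_
  intro n
  rcases Nat.eq_zero_or_pos n with h0 | h0
  · subst h0
    have : (1 + 2 * s) ≠ 0 := by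
      intro hh
      have := congrArg Complex.re hh
      rw [hre] at this
      simp at this
      linarith
    simp [Complex.zero_cpow this]
    positivity
  · rw [norm_div, norm_one, Complex.norm_natCast_cpow_of_pos h0, hre]
    have h1n : (1:ℝ) ≤ n := by exact_mod_cast h0
    have : (n:ℝ) ^ (1 + 2 * a) ≤ (n:ℝ) ^ (1 + 2 * s.re) :=
      Real.rpow_le_rpow_of_exponent_le h1n (by linarith)
    have h0' : 0 < (n:ℝ) ^ (1 + 2 * a) := by positivity
    exact one_div_le_one_div_of_le h0' this

noncomputable def FV (k q : ℕ) (s : ℂ) : ℂ :=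
  (gammaBox k (1 / 2 + s) / gammaBox k (1 / 2)) * (1 - (q : ℂ) ^ (-(1 + 2 * s))) *
    riemannZeta (1 + 2 * s) / s

noncomputable def FW (k : ℕ) (s : ℂ) : ℂ :=
  (gammaW k (1 / 2 + s) / gammaW k (1 / 2)) / s

lemma Vfun_eq (k q : ℕ) (y : ℝ) : Vfun k q y = Mel (FV k q) 2 y := by
  unfold Vfun Mel FV
  congr 1
  congr 1
  ext t
  push_cast
  rw [show (1 / 2 + (2 + (t:ℂ) * I)) = 5 / 2 + t * I by ring,
    show (1 + 2 * (2 + (t:ℂ) * I)) = 5 + 2 * t * I by ring]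
  ring

lemma Wfun_eq (k : ℕ) (y : ℝ) : Wfun k y = Mel (FW k) 2 y := by
  unfold Wfun Mel FW
  congr 1
  congr 1
  ext t
  push_cast
  rw [show (1 / 2 + (2 + (t:ℂ) * I)) = 5 / 2 + t * I by ring]
  ring

lemma diffAt_Gamma {f : ℂ → ℂ} {s : ℂ} (hf : DifferentiableAt ℂ f s) (h : 0 < (f s).re) :
    DifferentiableAt ℂ (fun s => Complex.Gamma (f s)) s := by
  have : DifferentiableAt ℂ Complex.Gamma (f s) := by
    apply Complex.differentiableAt_Gamma
    intro m hm
    rw [hm] at h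
    simp at h
    have : (0:ℝ) ≤ m := by positivity
    linarith
  exact this.comp s hf

lemma FW_cls (k : ℕ) (hk : 1000 < k) : ∃ K, Cls 4 K (FW k) := by
  have hk' : (1000:ℝ) < k := by exact_mod_cast hk
  refine ⟨fun a b => 16 * (Real.Gamma (k / 2 + 4) + Real.Gamma (b + k / 2 + 4)) / ‖gammaW k (1/2)‖ / a,
    ?_, ?_⟩
  · intro s hs
    have hs0 : s ≠ 0 := by
      intro h; rw [h] at hs; simp at hs
    unfold FW gammaW
    have h2pi : (2 * Real.pi : ℂ) ≠ 0 := by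
      norm_cast; positivity
    refine DifferentiableAt.div (DifferentiableAt.div_const (DifferentiableAt.mul ?_ ?_) _)
      differentiableAt_id hs0
    · exact DifferentiableAt.const_cpow (by fun_prop) (Or.inl h2pi)
    · apply diffAt_Gamma (by fun_prop)
      simp
      linarith
  · intro a b s ha has hsb
    have hs0 : 0 < s.re := ha.trans_le has
    unfold FW
    rw [norm_div, norm_div]
    have hn : ‖gammaW k (1 / 2 + s)‖ ≤
        16 * (Real.Gamma (k / 2 + 4) + Real.Gamma (b + k / 2 + 4)) / (1 + |s.im|) ^ 4 := by
      unfold gammaW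
      rw [norm_mul]
      have e1 : (1 / 2 + s + ((k:ℂ) - 1) / 2) = s + k / 2 := by ring
      rw [e1]
      have hre : (s + (k:ℂ) / 2).re = s.re + k / 2 := by simp
      have him : (s + (k:ℂ) / 2).im = s.im := by simp
      have h1 := norm_Gamma_decay (a := k / 2) (b := b + k / 2) (z := s + k / 2) (by linarith)
        (by rw [hre]; linarith) (by rw [hre]; linarith)
      rw [him] at h1
      have h2 : ‖(2 * Real.pi : ℂ) ^ (-(1 / 2 + s))‖ ≤ 1 := by
        have : (2 * Real.pi : ℂ) = ((2 * Real.pi : ℝ) : ℂ) := by push_cast; ring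
        rw [this, Complex.norm_cpow_eq_rpow_re_of_pos (by positivity)]
        apply Real.rpow_le_one_of_one_le_of_nonpos
        · linarith [Real.pi_gt_three]
        · simp
          linarith
      calc _ ≤ 1 * _ := mul_le_mul h2 h1 (norm_nonneg _) zero_le_one
        _ = _ := one_mul _
    have hsn : a ≤ ‖s‖ := has.trans ((le_abs_self _).trans (Complex.abs_re_le_norm s))
    have hG : 0 ≤ 16 * (Real.Gamma (k / 2 + 4) + Real.Gamma (b + k / 2 + 4)) := by
      have h1 := Real.Gamma_pos_of_pos (s := (k:ℝ) / 2 + 4) (by linarith)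
      have h2 := Real.Gamma_pos_of_pos (s := b + (k:ℝ) / 2 + 4) (by linarith)
      linarith
    calc _ ≤ (16 * (Real.Gamma (k / 2 + 4) + Real.Gamma (b + k / 2 + 4)) / (1 + |s.im|) ^ 4)
          / ‖gammaW k (1/2)‖ / a := by gcongr
      _ = _ := by ring

lemma FV_cls (k : ℕ) (hk : 1000 < k) : ∃ K, ∀ q : ℕ, 1 ≤ q → Cls 4 K (FV k q) := by
  have hk' : (1000:ℝ) < k := by exact_mod_cast hk
  refine ⟨fun a b => ((Real.Gamma (3/4) + Real.Gamma (b/2 + 3/4)) *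
    (16 * 16 * (Real.Gamma (((k:ℝ) - 1/2)/2 + 4) + Real.Gamma ((b + k - 1/2)/2 + 4))) *
    (Real.Gamma (((k:ℝ) + 1/2)/2) + Real.Gamma ((b + k + 1/2)/2))) / ‖gammaBox k (1/2)‖ * 2 *
    (∑' n : ℕ, 1 / (n : ℝ) ^ (1 + 2 * a)) / a, fun q hq => ⟨?_, ?_⟩⟩
  · intro s hs
    have hs0 : s ≠ 0 := by
      intro h; rw [h] at hs; simp at hs
    unfold FV gammaBox
    have hpi : (Real.pi : ℂ) ≠ 0 := by
      norm_cast; positivity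
    have hq0 : (q : ℂ) ≠ 0 := by
      norm_cast; omega
    refine DifferentiableAt.div (DifferentiableAt.mul (DifferentiableAt.mul
      (DifferentiableAt.div_const (DifferentiableAt.mul (DifferentiableAt.mul
      (DifferentiableAt.mul ?_ ?_) ?_) ?_) _) ?_) ?_) differentiableAt_id hs0
    · exact DifferentiableAt.const_cpow (by fun_prop) (Or.inl hpi)
    · apply diffAt_Gamma (by fun_prop)
      simp
      linarith
    · apply diffAt_Gamma (by fun_prop)
      simp
      linarith
    · apply diffAt_Gamma (by fun_prop)
      simp
      linarith
    · exact (differentiableAt_const _).sub (DifferentiableAt.const_cpow (by fun_prop) (Or.inl hq0))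
    · have h1 : DifferentiableAt ℂ riemannZeta (1 + 2 * s) := by
        apply differentiableAt_riemannZeta
        intro h
        apply hs0
        linear_combination h / 2
      exact DifferentiableAt.comp s h1 (by fun_prop)
  · intro a b s ha has hsb
    have hs0 : 0 < s.re := ha.trans_le has
    unfold FV
    rw [norm_div, norm_mul, norm_mul, norm_div]
    have hn : ‖gammaBox k (1 / 2 + s)‖ ≤ ((Real.Gamma (3/4) + Real.Gamma (b/2 + 3/4)) *
    (16 * 16 * (Real.Gamma (((k:ℝ) - 1/2)/2 + 4) + Real.Gamma ((b + k - 1/2)/2 + 4))) *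
    (Real.Gamma (((k:ℝ) + 1/2)/2) + Real.Gamma ((b + k + 1/2)/2))) / (1 + |s.im|) ^ 4 := by
      unfold gammaBox
      rw [norm_mul, norm_mul, norm_mul]
      have h0 : ‖(Real.pi : ℂ) ^ (-3 * (1 / 2 + s) / 2)‖ ≤ 1 := by
        rw [Complex.norm_cpow_eq_rpow_re_of_pos Real.pi_pos]
        apply Real.rpow_le_one_of_one_le_of_nonpos
        · linarith [Real.pi_gt_three]
        · simp
          linarith
      have h1 : ‖Complex.Gamma ((1 / 2 + s + 1) / 2)‖ ≤ Real.Gamma (3/4) + Real.Gamma (b/2 + 3/4) := by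
        apply norm_Gamma_strip (by norm_num)
        · simp
          linarith
        · simp
          linarith
      have h3 : ‖Complex.Gamma ((1 / 2 + s + k) / 2)‖ ≤
          Real.Gamma (((k:ℝ) + 1/2)/2) + Real.Gamma ((b + k + 1/2)/2) := by
        apply norm_Gamma_strip (by positivity)
        · simp
          linarith
        · simp
          linarith
      have h2 : ‖Complex.Gamma ((1 / 2 + s + k - 1) / 2)‖ ≤ (16 * 16 *
          (Real.Gamma (((k:ℝ) - 1/2)/2 + 4) + Real.Gamma ((b + k - 1/2)/2 + 4))) / (1 + |s.im|) ^ 4 := by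
        have h := norm_Gamma_decay (a := ((k:ℝ) - 1/2)/2) (b := (b + k - 1/2)/2)
          (z := (1 / 2 + s + k - 1) / 2) (by linarith) (by simp; linarith) (by simp; linarith)
        have him : ((1 / 2 + s + k - 1) / 2).im = s.im / 2 := by simp
        rw [him] at h
        refine h.trans ?_
        have g1 := Real.Gamma_pos_of_pos (s := ((k:ℝ) - 1/2)/2 + 4) (by linarith)
        have g2 := Real.Gamma_pos_of_pos (s := (b + (k:ℝ) - 1/2)/2 + 4) (by linarith)
        set X := Real.Gamma (((k:ℝ) - 1/2)/2 + 4) + Real.Gamma ((b + k - 1/2)/2 + 4) with hX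
        have hX0 : 0 < X := by linarith
        rw [div_le_div_iff₀ (by positivity) (by positivity)]
        have : (1 + |s.im|) ^ 4 ≤ 16 * (1 + |s.im / 2|) ^ 4 := by
          have e : (1 + |s.im|) ≤ 2 * (1 + |s.im / 2|) := by
            rw [abs_div, abs_of_pos (by norm_num : (0:ℝ) < 2)]
            linarith
          calc (1 + |s.im|) ^ 4 ≤ (2 * (1 + |s.im / 2|)) ^ 4 := by gcongr
            _ = _ := by ring
        calc 16 * X * (1 + |s.im|) ^ 4 ≤ 16 * X * (16 * (1 + |s.im / 2|) ^ 4) := by gcongr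
          _ = _ := by ring
      calc _ ≤ 1 * (Real.Gamma (3/4) + Real.Gamma (b/2 + 3/4)) * ((16 * 16 *
          (Real.Gamma (((k:ℝ) - 1/2)/2 + 4) + Real.Gamma ((b + k - 1/2)/2 + 4))) / (1 + |s.im|) ^ 4) *
          (Real.Gamma (((k:ℝ) + 1/2)/2) + Real.Gamma ((b + k + 1/2)/2)) := by
            have p1 := (norm_nonneg _).trans h1
            have p2 := (norm_nonneg _).trans h2
            have p3 := (norm_nonneg _).trans h3
            gcongr
        _ = _ := by ring
    have hsn : a ≤ ‖s‖ := has.trans ((le_abs_self _).trans (Complex.abs_re_le_norm s))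
    have hz := norm_zeta_bound ha has
    have hqn : ‖1 - (q : ℂ) ^ (-(1 + 2 * s))‖ ≤ 2 := by
      refine (norm_sub_le _ _).trans ?_
      rw [norm_one, Complex.norm_natCast_cpow_of_pos (by omega)]
      have : (q : ℝ) ^ (-(1 + 2 * s)).re ≤ 1 := by
        apply Real.rpow_le_one_of_one_le_of_nonpos
        · exact_mod_cast hq
        · simp
          linarith
      linarith
    have p1 := (norm_nonneg _).trans hn
    have p2 := (norm_nonneg _).trans hz
    calc _ ≤ (((Real.Gamma (3/4) + Real.Gamma (b/2 + 3/4)) *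
    (16 * 16 * (Real.Gamma (((k:ℝ) - 1/2)/2 + 4) + Real.Gamma ((b + k - 1/2)/2 + 4))) *
    (Real.Gamma (((k:ℝ) + 1/2)/2) + Real.Gamma ((b + k + 1/2)/2))) / (1 + |s.im|) ^ 4) /
        ‖gammaBox k (1/2)‖ * 2 * (∑' n : ℕ, 1 / (n : ℝ) ^ (1 + 2 * a)) / a := by gcongr
      _ = _ := by ring

end PartB2

section PartC
open MeasureTheory Set intervalIntegral

/-- Exponential polynomial. -/
noncomputable def ePoly (I : Finset ℕ) (α : ℕ → ℂ) (t : ℝ) : ℂ := ∑ m ∈ I, α m * eF (m * t)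

lemma eF_norm (x : ℝ) : ‖eF x‖ = 1 := by
  unfold eF
  rw [show (2 * Real.pi * Complex.I * x : ℂ) = ((2 * Real.pi * x : ℝ) : ℂ) * Complex.I by
    push_cast; ring]
  exact Complex.norm_exp_ofReal_mul_I _

lemma eF_add (x y : ℝ) : eF (x + y) = eF x * eF y := by
  unfold eF; rw [← Complex.exp_add]; push_cast; ring_nf

lemma eF_zero : eF 0 = 1 := by simp [eF]

lemma eF_int (n : ℤ) : eF n = 1 := by
  unfold eF
  rw [Complex.exp_eq_one_iff]
  exact ⟨n, by push_cast; ring⟩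

lemma eF_conj (x : ℝ) : (starRingEnd ℂ) (eF x) = eF (-x) := by
  unfold eF
  rw [← Complex.exp_conj]
  congr 1
  have h2 : (starRingEnd ℂ) (2:ℂ) = 2 := Complex.conj_ofNat 2
  simp [h2]

lemma eF_hasDerivAt (a t : ℝ) :
    HasDerivAt (fun t : ℝ => eF (a * t)) (2 * Real.pi * Complex.I * a * eF (a * t)) t := by
  unfold eF
  have h1 : HasDerivAt (fun t : ℝ => (2 * Real.pi * Complex.I * ((a * t : ℝ) : ℂ)))
      (2 * Real.pi * Complex.I * ((a : ℝ) : ℂ)) t := by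
    have h2 : HasDerivAt (fun t : ℝ => a * t) a t := by
      simpa using (hasDerivAt_id t).const_mul a
    exact (h2.ofReal_comp).const_mul _
  exact (h1.cexp).congr_deriv (by ring)

lemma eF_continuous : Continuous eF := by
  unfold eF; fun_prop

lemma eF_integral (n : ℤ) : ∫ t in (0:ℝ)..1, eF (n * t) = if n = 0 then 1 else 0 := by
  split_ifs with h
  · subst h; simp [eF_zero]
  · have hn : (n : ℂ) ≠ 0 := by exact_mod_cast h
    have hc : (2 * Real.pi * Complex.I * ((n : ℝ) : ℂ)) ≠ 0 := by
      have := Complex.two_pi_I_ne_zero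
      simp only [Complex.ofReal_intCast]
      exact mul_ne_zero this hn
    have key : ∫ t in (0:ℝ)..1, (2 * Real.pi * Complex.I * ((n : ℝ) : ℂ)) * eF (n * t)
        = eF (n * 1) - eF (n * 0) := by
      refine integral_eq_sub_of_hasDerivAt (f := fun t : ℝ => eF (n * t)) ?_ ?_
      · intro t _; exact eF_hasDerivAt n t
      · apply Continuous.intervalIntegrable
        have := eF_continuous
        fun_prop
    rw [intervalIntegral.integral_const_mul] at key
    rw [mul_one, mul_zero, eF_int, eF_zero, sub_self] at key
    exact (mul_eq_zero.mp key).resolve_left hc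

lemma ePoly_continuous (I : Finset ℕ) (α : ℕ → ℂ) : Continuous (ePoly I α) := by
  unfold ePoly
  have := eF_continuous
  fun_prop

lemma ePoly_parseval (I : Finset ℕ) (α : ℕ → ℂ) :
    ∫ t in (0:ℝ)..1, ‖ePoly I α t‖ ^ 2 = ∑ m ∈ I, ‖α m‖ ^ 2 := by
  have hcont := eF_continuous
  have h1 : ∀ t, ((‖ePoly I α t‖ ^ 2 : ℝ) : ℂ)
      = ∑ m ∈ I, ∑ n ∈ I, α m * (starRingEnd ℂ) (α n) * eF (((m : ℤ) - (n : ℤ) : ℤ) * t) := by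
    intro t
    rw [← Complex.normSq_eq_norm_sq, Complex.normSq_eq_conj_mul_self, mul_comm]
    unfold ePoly
    rw [map_sum, Finset.sum_mul_sum]
    refine Finset.sum_congr rfl fun m _ => Finset.sum_congr rfl fun n _ => ?_
    rw [map_mul, eF_conj]
    have : eF (((m : ℤ) - (n : ℤ) : ℤ) * t) = eF (m * t) * eF (-(n * t)) := by
      rw [← eF_add]; congr 1; push_cast; ring
    rw [this]; ring
  have h2 : ((∫ t in (0:ℝ)..1, ‖ePoly I α t‖ ^ 2 : ℝ) : ℂ) = ((∑ m ∈ I, ‖α m‖ ^ 2 : ℝ) : ℂ) := by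
    rw [← intervalIntegral.integral_ofReal]
    simp_rw [h1]
    rw [intervalIntegral.integral_finsetSum]
    · rw [Complex.ofReal_sum]
      refine Finset.sum_congr rfl fun m hm => ?_
      rw [intervalIntegral.integral_finsetSum]
      · simp_rw [intervalIntegral.integral_const_mul, eF_integral]
        rw [Finset.sum_eq_single m]
        · simp only [sub_self, if_true, mul_one]
          rw [Complex.mul_conj, Complex.normSq_eq_norm_sq]
        · intro n _ hne
          rw [if_neg (by intro h; apply hne; omega), mul_zero]
        · intro h; exact absurd hm h
      · intro n _; apply Continuous.intervalIntegrable; fun_prop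
    · intro m _; apply Continuous.intervalIntegrable; fun_prop
  exact_mod_cast h2

lemma ePoly_hasDerivAt (I : Finset ℕ) (α : ℕ → ℂ) (t : ℝ) :
    HasDerivAt (ePoly I α) (ePoly I (fun m => 2 * Real.pi * Complex.I * m * α m) t) t := by
  unfold ePoly
  have := HasDerivAt.fun_sum (u := I) (fun m _ => (eF_hasDerivAt (m:ℝ) t).const_mul (α m))
  refine this.congr_deriv (Finset.sum_congr rfl fun m _ => ?_)
  push_cast; ring

/-- one point Gallagher inequality -/
lemma gallagher_point (I : Finset ℕ) (α : ℕ → ℂ) (ξ δ A : ℝ) (hδ : 0 < δ) (hA : 0 < A) :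
    ‖ePoly I α ξ‖ ^ 2 ≤ ∫ t in ξ..(ξ + δ), ((δ⁻¹ + A) * ‖ePoly I α t‖ ^ 2 +
      A⁻¹ * ‖ePoly I (fun m => 2 * Real.pi * Complex.I * m * α m) t‖ ^ 2) := by
  set S := ePoly I α
  set S' := ePoly I (fun m => 2 * Real.pi * Complex.I * m * α m)
  have hS : Continuous S := ePoly_continuous _ _
  have hS' : Continuous S' := ePoly_continuous _ _
  have hd : ∀ t, HasDerivAt (fun t => ‖S t‖ ^ 2) (2 * inner ℝ (S t) (S' t)) t := by
    intro t
    exact (ePoly_hasDerivAt I α t).norm_sq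
  have hdc : Continuous (fun t => 2 * inner ℝ (S t) (S' t)) := by fun_prop
  set G : ℝ → ℝ := fun t => A * ‖S t‖ ^ 2 + A⁻¹ * ‖S' t‖ ^ 2
  have hG : Continuous G := by fun_prop
  have hle : ∀ t, |2 * inner ℝ (S t) (S' t)| ≤ G t := by
    intro t
    have h1 := abs_real_inner_le_norm (S t) (S' t)
    rw [abs_mul, abs_two]
    have h2 : 2 * (‖S t‖ * ‖S' t‖) ≤ G t := by
      have h3 : 0 ≤ A⁻¹ * (A * ‖S t‖ - ‖S' t‖) ^ 2 := by positivity
      have h4 : A⁻¹ * (A * ‖S t‖ - ‖S' t‖) ^ 2 = A * ‖S t‖^2 + A⁻¹ * ‖S' t‖ ^ 2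
         - 2 * (‖S t‖ * ‖S' t‖) := by field_simp; ring
      simp only [G]; linarith
    linarith
  have hGnn : ∀ t, 0 ≤ G t := fun t => le_trans (abs_nonneg _) (hle t)
  have hpt : ∀ t ∈ Icc ξ (ξ + δ), ‖S ξ‖ ^ 2 ≤ ‖S t‖ ^ 2 + ∫ u in ξ..(ξ+δ), G u := by
    intro t ht
    have h1 : ∫ u in ξ..t, 2 * inner ℝ (S u) (S' u) = ‖S t‖ ^ 2 - ‖S ξ‖ ^ 2 :=
      integral_eq_sub_of_hasDerivAt (fun u _ => hd u) (hdc.intervalIntegrable _ _)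
    have h2 : |∫ u in ξ..t, 2 * inner ℝ (S u) (S' u)| ≤ ∫ u in ξ..t, G u := by
      refine (abs_integral_le_integral_abs ht.1).trans ?_
      exact integral_mono_on ht.1 (hdc.abs.intervalIntegrable _ _) (hG.intervalIntegrable _ _)
        (fun u _ => hle u)
    have h3 : ∫ u in ξ..t, G u ≤ ∫ u in ξ..(ξ+δ), G u := by
      rw [← integral_add_adjacent_intervals (hG.intervalIntegrable ξ t) (hG.intervalIntegrable t (ξ+δ))]
      have := integral_nonneg (μ := volume) ht.2 (fun u _ => hGnn u)
      linarith
    have := neg_le_abs (∫ u in ξ..t, 2 * inner ℝ (S u) (S' u))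
    linarith
  have hIntg : ∫ t in ξ..(ξ+δ), ‖S ξ‖ ^ 2 ≤ ∫ t in ξ..(ξ+δ), (‖S t‖ ^ 2 + ∫ u in ξ..(ξ+δ), G u) := by
    refine integral_mono_on (by linarith) (by simp) ?_ hpt
    apply Continuous.intervalIntegrable; fun_prop
  rw [intervalIntegral.integral_add (by apply Continuous.intervalIntegrable; fun_prop) (by simp)] at hIntg
  simp only [intervalIntegral.integral_const, add_sub_cancel_left, smul_eq_mul] at hIntg
  have e1 : ∫ t in ξ..(ξ + δ), ((δ⁻¹ + A) * ‖S t‖ ^ 2 + A⁻¹ * ‖S' t‖ ^ 2)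
     = δ⁻¹ * (∫ t in ξ..(ξ+δ), ‖S t‖^2) + ∫ t in ξ..(ξ+δ), G t := by
    rw [← intervalIntegral.integral_const_mul, ← intervalIntegral.integral_add]
    · congr 1; ext t; simp only [G]; ring
    · apply Continuous.intervalIntegrable; fun_prop
    · apply Continuous.intervalIntegrable; fun_prop
  rw [e1]
  have : ‖S ξ‖ ^ 2 = δ⁻¹ * (δ * ‖S ξ‖ ^ 2) := by field_simp
  rw [this]
  calc _ ≤ δ⁻¹ * ((∫ t in ξ..(ξ+δ), ‖S t‖^2) + δ * ∫ u in ξ..(ξ+δ), G u) := by gcongr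
    _ = _ := by field_simp

/-- multi-point Gallagher -/
lemma gallagher_multi {ι : Type*} (P : Finset ι) (ξ : ι → ℝ) (I : Finset ℕ) (α : ℕ → ℂ)
    (δ A B : ℝ) (hδ : 0 < δ) (hA : 0 < A) (hB : ∀ m ∈ I, (m : ℝ) ≤ B)
    (h0 : ∀ p ∈ P, 0 ≤ ξ p) (h1 : ∀ p ∈ P, ξ p + δ ≤ 1)
    (hsep : ∀ p ∈ P, ∀ p' ∈ P, p ≠ p' → δ ≤ |ξ p - ξ p'|) :
    ∑ p ∈ P, ‖ePoly I α (ξ p)‖ ^ 2 ≤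
      (δ⁻¹ + A + A⁻¹ * (2 * Real.pi * B) ^ 2) * ∑ m ∈ I, ‖α m‖ ^ 2 := by
  set S := ePoly I α
  set S' := ePoly I (fun m => 2 * Real.pi * Complex.I * m * α m) with hS'def
  have hS : Continuous S := ePoly_continuous _ _
  have hS' : Continuous S' := ePoly_continuous _ _
  set H : ℝ → ℝ := fun t => (δ⁻¹ + A) * ‖S t‖ ^ 2 + A⁻¹ * ‖S' t‖ ^ 2
  have hH : Continuous H := by fun_prop
  have hHnn : ∀ t, 0 ≤ H t := by intro t; simp only [H]; positivity
  have hio : IntegrableOn H (Ioc 0 1) := hH.integrableOn_Ioc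
  have step1 : ∑ p ∈ P, ‖S (ξ p)‖ ^ 2 ≤ ∑ p ∈ P, ∫ t in Ioc (ξ p) (ξ p + δ), H t := by
    refine Finset.sum_le_sum fun p _ => ?_
    rw [← integral_of_le (by linarith)]
    exact gallagher_point I α (ξ p) δ A hδ hA
  have step2 : ∑ p ∈ P, ∫ t in Ioc (ξ p) (ξ p + δ), H t
      = ∫ t in ⋃ p ∈ P, Ioc (ξ p) (ξ p + δ), H t := by
    rw [integral_biUnion_finset]
    · intro p _; exact measurableSet_Ioc
    · intro p hp p' hp' hne
      have := hsep p hp p' hp' hne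
      rw [Function.onFun, Set.disjoint_left]
      rintro t ⟨a1, a2⟩ ⟨b1, b2⟩
      rcases le_abs.mp this with h | h <;> linarith
    · intro p _; exact hH.integrableOn_Ioc
  have step3 : ∫ t in ⋃ p ∈ P, Ioc (ξ p) (ξ p + δ), H t ≤ ∫ t in Ioc 0 1, H t := by
    refine setIntegral_mono_set hio (Filter.Eventually.of_forall hHnn) ?_
    refine (LE.le.eventuallyLE ?_)
    intro t ht
    simp only [mem_iUnion] at ht
    obtain ⟨p, hp, ht⟩ := ht
    exact ⟨lt_of_le_of_lt (h0 p hp) ht.1, ht.2.trans (h1 p hp)⟩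
  have step4 : ∫ t in Ioc 0 1, H t = (δ⁻¹ + A) * ∑ m ∈ I, ‖α m‖ ^ 2 +
      A⁻¹ * ∑ m ∈ I, ‖2 * Real.pi * Complex.I * m * α m‖ ^ 2 := by
    rw [← integral_of_le zero_le_one, intervalIntegral.integral_add, intervalIntegral.integral_const_mul, intervalIntegral.integral_const_mul,
      ePoly_parseval, ePoly_parseval]
    · apply Continuous.intervalIntegrable; fun_prop
    · apply Continuous.intervalIntegrable; fun_prop
  have step5 : ∑ m ∈ I, ‖2 * Real.pi * Complex.I * m * α m‖ ^ 2 ≤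
      (2 * Real.pi * B) ^ 2 * ∑ m ∈ I, ‖α m‖ ^ 2 := by
    rw [Finset.mul_sum]
    refine Finset.sum_le_sum fun m hm => ?_
    have : ‖2 * Real.pi * Complex.I * m * α m‖ = 2 * Real.pi * m * ‖α m‖ := by
      simp [abs_of_pos Real.pi_pos]
    rw [this, mul_pow]
    have := hB m hm
    have := Real.pi_pos
    gcongr
  calc _ ≤ _ := step1
    _ = _ := step2
    _ ≤ _ := step3
    _ = _ := step4
    _ ≤ (δ⁻¹ + A) * ∑ m ∈ I, ‖α m‖ ^ 2 + A⁻¹ * ((2 * Real.pi * B) ^ 2 * ∑ m ∈ I, ‖α m‖ ^ 2) := by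
      gcongr
    _ = _ := by ring

/-- the large-sieve quantity for modulus `c`. -/
noncomputable def Tsum (I : Finset ℕ) (α : ℕ → ℂ) (c : ℕ) : ℝ :=
  ∑ x ∈ (Finset.range c).filter (fun x => Nat.Coprime x c), ‖ePoly I α ((x : ℝ) / c)‖ ^ 2

lemma Tsum_nonneg (I : Finset ℕ) (α : ℕ → ℂ) (c : ℕ) : 0 ≤ Tsum I α c := by
  unfold Tsum; positivity

lemma large_sieve (M C : ℕ) (hM : 1 ≤ M) (hC : 1 ≤ C) (α : ℕ → ℂ) :
    ∑ c ∈ Finset.Icc 1 C, Tsum (Finset.Ico M (2 * M)) α c ≤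
      ((C : ℝ) ^ 2 + 200 * M) * ∑ m ∈ Finset.Ico M (2 * M), ‖α m‖ ^ 2 := by
  have hC' : (1:ℝ) ≤ C := by exact_mod_cast hC
  have hM' : (1:ℝ) ≤ M := by exact_mod_cast hM
  set P := (Finset.Icc 1 C).sigma (fun c => (Finset.range c).filter (fun x => Nat.Coprime x c))
  have hmem : ∀ p ∈ P, 1 ≤ p.1 ∧ p.1 ≤ C ∧ p.2 < p.1 ∧ Nat.Coprime p.2 p.1 := by
    rintro ⟨c, x⟩ hp
    simp only [P, Finset.mem_sigma, Finset.mem_Icc, Finset.mem_filter, Finset.mem_range] at hp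
    tauto
  have key := gallagher_multi P (fun p => (p.2 : ℝ) / p.1) (Finset.Ico M (2 * M)) α
    (1 / (C:ℝ) ^ 2) M (2 * M) (by positivity) (by positivity)
    (by intro m hm; rw [Finset.mem_Ico] at hm; exact_mod_cast hm.2.le)
    (by intro p _; positivity)
    (by
      intro p hp
      obtain ⟨h1, h2, h3, _⟩ := hmem p hp
      have h1' : (1:ℝ) ≤ p.1 := by exact_mod_cast h1
      have h2' : (p.1:ℝ) ≤ C := by exact_mod_cast h2
      have h3' : (p.2:ℝ) + 1 ≤ p.1 := by exact_mod_cast h3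
      have a1 : (p.2 : ℝ) / p.1 ≤ 1 - 1 / p.1 := by
        rw [le_sub_iff_add_le, ← add_div, div_le_one (by linarith)]; exact h3'
      have a2 : 1 / (C:ℝ)^2 ≤ 1 / p.1 := by
        apply one_div_le_one_div_of_le (by linarith)
        nlinarith
      linarith)
    (by
      intro p hp p' hp' hne
      obtain ⟨h1, h2, h3, h4⟩ := hmem p hp
      obtain ⟨k1, k2, k3, k4⟩ := hmem p' hp'
      have h1' : (1:ℝ) ≤ p.1 := by exact_mod_cast h1
      have h2' : (p.1:ℝ) ≤ C := by exact_mod_cast h2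
      have k1' : (1:ℝ) ≤ p'.1 := by exact_mod_cast k1
      have k2' : (p'.1:ℝ) ≤ C := by exact_mod_cast k2
      have hz : (p.2 : ℤ) * p'.1 - p.1 * p'.2 ≠ 0 := by
        intro h0
        have h0' : p.2 * p'.1 = p.1 * p'.2 := by
          have : (p.2 : ℤ) * p'.1 = p.1 * p'.2 := by linarith
          exact_mod_cast this
        have d1 : p.1 ∣ p'.1 := h4.symm.dvd_of_dvd_mul_left ⟨p'.2, h0'⟩
        have d2 : p'.1 ∣ p.1 := k4.symm.dvd_of_dvd_mul_right ⟨p.2, by linarith⟩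
        have e1 : p.1 = p'.1 := Nat.dvd_antisymm d1 d2
        have e2 : p.2 = p'.2 := by
          rw [← e1, mul_comm] at h0'
          exact Nat.eq_of_mul_eq_mul_left (by omega) h0'
        apply hne
        cases p; cases p'; simp_all
      have hz' : (1:ℝ) ≤ |(p.2 : ℝ) * p'.1 - p.1 * p'.2| := by
        have := Int.one_le_abs hz
        exact_mod_cast this
      have e : (p.2 : ℝ) / p.1 - (p'.2:ℝ) / p'.1 =
          ((p.2 : ℝ) * p'.1 - p.1 * p'.2) / (p.1 * p'.1) := by
        rw [div_sub_div _ _ (by linarith) (by linarith)]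
      rw [e, abs_div, abs_of_pos (show (0:ℝ) < p.1 * p'.1 by nlinarith)]
      apply div_le_div₀ (by positivity) hz' (by nlinarith)
      rw [sq]; gcongr)
  have e : ∑ c ∈ Finset.Icc 1 C, Tsum (Finset.Ico M (2 * M)) α c =
      ∑ p ∈ P, ‖ePoly (Finset.Ico M (2 * M)) α ((p.2 : ℝ) / p.1)‖ ^ 2 := by
    unfold Tsum
    rw [Finset.sum_sigma]
  rw [e]
  refine key.trans ?_
  apply mul_le_mul_of_nonneg_right _ (by positivity)
  have hp : Real.pi ^ 2 ≤ 3.15 ^ 2 := by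
    have := Real.pi_lt_d2; have := Real.pi_pos; gcongr
  have e2 : (M:ℝ)⁻¹ * (2 * Real.pi * (2 * M)) ^ 2 = 16 * Real.pi ^ 2 * M := by
    field_simp; ring
  rw [e2]
  have e3 : (1 / (C:ℝ)^2)⁻¹ = (C:ℝ)^2 := by simp
  rw [e3]
  nlinarith

lemma large_sieve_weighted_dyadic (M : ℕ) (hM : 1 ≤ M) (α : ℕ → ℂ) (i : ℕ) :
    ∑ c ∈ Finset.Ico 1 (2 ^ i), Tsum (Finset.Ico M (2 * M)) α c / ((c:ℝ) ^ 2 + M) ≤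
      200 * i * ∑ m ∈ Finset.Ico M (2 * M), ‖α m‖ ^ 2 := by
  have hM' : (1:ℝ) ≤ M := by exact_mod_cast hM
  induction i with
  | zero => simp
  | succ i ih =>
    have hp : 1 ≤ 2 ^ i := Nat.one_le_two_pow
    rw [← Finset.sum_Ico_consecutive _ hp (show 2 ^ i ≤ 2 ^ (i+1) from
      Nat.pow_le_pow_right (by norm_num) (by omega))]
    have h2 : ∑ c ∈ Finset.Ico (2 ^ i) (2 ^ (i+1)),
        Tsum (Finset.Ico M (2 * M)) α c / ((c:ℝ) ^ 2 + M) ≤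
        200 * ∑ m ∈ Finset.Ico M (2 * M), ‖α m‖ ^ 2 := by
      have hls := large_sieve M (2^(i+1)) hM (by omega) α
      set X : ℝ := (2:ℝ)^i
      have hX : 1 ≤ X := one_le_pow₀ (by norm_num)
      calc _ ≤ ∑ c ∈ Finset.Ico (2 ^ i) (2 ^ (i+1)),
            Tsum (Finset.Ico M (2 * M)) α c / (X ^ 2 + M) := by
            refine Finset.sum_le_sum fun c hc => ?_
            rw [Finset.mem_Ico] at hc
            have hc' : X ≤ c := by simp only [X]; exact_mod_cast hc.1
            have := Tsum_nonneg (Finset.Ico M (2 * M)) α c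
            gcongr
        _ = (∑ c ∈ Finset.Ico (2 ^ i) (2 ^ (i+1)),
            Tsum (Finset.Ico M (2 * M)) α c) / (X ^ 2 + M) := by rw [Finset.sum_div]
        _ ≤ (∑ c ∈ Finset.Icc 1 (2 ^ (i+1)),
            Tsum (Finset.Ico M (2 * M)) α c) / (X ^ 2 + M) := by
            refine div_le_div_of_nonneg_right ?_ (by positivity)
            refine Finset.sum_le_sum_of_subset_of_nonneg ?_ (fun c _ _ => Tsum_nonneg _ _ _)
            intro c hc
            rw [Finset.mem_Ico] at hc
            rw [Finset.mem_Icc]; omega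
        _ ≤ ((((2^(i+1) : ℕ) : ℝ) ^ 2 + 200 * M) * ∑ m ∈ Finset.Ico M (2 * M), ‖α m‖ ^ 2) /
              (X ^ 2 + M) := by gcongr
        _ ≤ _ := by
            rw [div_le_iff₀ (by positivity)]
            have e : (((2^(i+1) : ℕ) : ℝ) ^ 2) = 4 * X ^ 2 := by
              simp only [X]; push_cast; ring
            rw [e]
            have : 0 ≤ ∑ m ∈ Finset.Ico M (2 * M), ‖α m‖ ^ 2 := by positivity
            nlinarith [mul_nonneg (sq_nonneg X) this]
    push_cast
    linarith

lemma large_sieve_weighted (M q : ℕ) (hM : 1 ≤ M) (hq : 1 ≤ q) (α : ℕ → ℂ) :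
    ∑ c ∈ Finset.Ico 1 q, Tsum (Finset.Ico M (2 * M)) α c / ((c:ℝ) ^ 2 + M) ≤
      400 * (1 + Real.log q) * ∑ m ∈ Finset.Ico M (2 * M), ‖α m‖ ^ 2 := by
  have hM' : (1:ℝ) ≤ M := by exact_mod_cast hM
  have hq' : (1:ℝ) ≤ q := by exact_mod_cast hq
  set i := Nat.log 2 q + 1
  have h1 : q < 2 ^ i := Nat.lt_pow_succ_log_self (by norm_num) q
  have h2 : 2 ^ (Nat.log 2 q) ≤ q := Nat.pow_log_le_self 2 (by omega)
  have h3 : (Nat.log 2 q : ℝ) * Real.log 2 ≤ Real.log q := by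
    rw [← Real.log_pow]
    apply Real.log_le_log (by positivity)
    exact_mod_cast h2
  have h4 : (i : ℝ) ≤ 2 * (1 + Real.log q) := by
    have := Real.log_two_gt_d9
    simp only [i]; push_cast
    have h5 : (0:ℝ) ≤ Nat.log 2 q := by positivity
    nlinarith
  calc _ ≤ ∑ c ∈ Finset.Ico 1 (2 ^ i), Tsum (Finset.Ico M (2 * M)) α c / ((c:ℝ) ^ 2 + M) := by
        refine Finset.sum_le_sum_of_subset_of_nonneg ?_ ?_
        · exact Finset.Ico_subset_Ico le_rfl h1.le
        · intro c _ _
          have := Tsum_nonneg (Finset.Ico M (2 * M)) α c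
          positivity
    _ ≤ _ := large_sieve_weighted_dyadic M hM α i
    _ ≤ _ := by
        have : 0 ≤ ∑ m ∈ Finset.Ico M (2 * M), ‖α m‖ ^ 2 := by positivity
        apply mul_le_mul_of_nonneg_right _ this
        linarith

end PartC

section PartD
open ZMod

/-- The arithmetic weight `λ_{m,h}(r)`. -/
noncomputable def lamS (m h : ℤ) (r : ℕ) : ℂ :=
  (1 / (r : ℂ)) * ∑ x ∈ (Finset.range r).filter (fun x => Nat.Coprime x r), ∑ a ∈ Finset.range r,
    eF ((((x : ℤ) * ((a : ℤ) ^ 2 + h * a + m) : ℤ) : ℝ) / r)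

lemma eF_eq_std (r : ℕ) [NeZero r] (j : ℤ) : eF ((j : ℝ) / r) = stdAddChar (j : ZMod r) := by
  rw [stdAddChar_coe]; unfold eF; congr 1; push_cast; ring

lemma sum_coprime_range (r : ℕ) [NeZero r] (F : ZMod r → ℂ) :
    ∑ x ∈ (Finset.range r).filter (fun x => Nat.Coprime x r), F (x : ZMod r) =
      ∑ u : (ZMod r)ˣ, F u := by
  refine Finset.sum_bij (fun x hx => ZMod.unitOfCoprime x (Finset.mem_filter.mp hx).2) ?_ ?_ ?_ ?_
  · intro x hx; exact Finset.mem_univ _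
  · intro x hx y hy hxy
    have h := congrArg (fun u : (ZMod r)ˣ => (u : ZMod r)) hxy
    simp only [ZMod.coe_unitOfCoprime] at h
    have hx' := Finset.mem_range.mp (Finset.mem_filter.mp hx).1
    have hy' := Finset.mem_range.mp (Finset.mem_filter.mp hy).1
    have := congrArg ZMod.val h
    rwa [ZMod.val_natCast_of_lt hx', ZMod.val_natCast_of_lt hy'] at this
  · intro u _
    refine ⟨(u : ZMod r).val, ?_, ?_⟩
    · rw [Finset.mem_filter, Finset.mem_range]
      exact ⟨ZMod.val_lt _, ZMod.val_coe_unit_coprime u⟩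
    · ext; simp
  · intro x hx; simp

lemma sum_range_zmod (r : ℕ) [NeZero r] (F : ZMod r → ℂ) :
    ∑ x ∈ Finset.range r, F (x : ZMod r) = ∑ u : ZMod r, F u := by
  refine Finset.sum_bij (fun x _ => (x : ZMod r)) ?_ ?_ ?_ ?_
  · intro x hx; exact Finset.mem_univ _
  · intro x hx y hy hxy
    have := congrArg ZMod.val hxy
    rwa [ZMod.val_natCast_of_lt (Finset.mem_range.mp hx),
      ZMod.val_natCast_of_lt (Finset.mem_range.mp hy)] at this
  · intro u _
    exact ⟨u.val, Finset.mem_range.mpr (ZMod.val_lt _), by simp⟩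
  · intro x hx; simp

lemma lamS_eq (m h : ℤ) (r : ℕ) [NeZero r] :
    lamS m h r = (1 / (r : ℂ)) * ∑ x : (ZMod r)ˣ, ∑ a : ZMod r,
      stdAddChar (N := r) ((x : ZMod r) * (a ^ 2 + h * a + m)) := by
  unfold lamS
  congr 1
  rw [← sum_coprime_range r (fun x => ∑ a : ZMod r,
      stdAddChar (N := r) ((x : ZMod r) * (a ^ 2 + h * a + m)))]
  refine Finset.sum_congr rfl fun x _ => ?_
  rw [← sum_range_zmod r (fun a => stdAddChar (N := r) ((x : ZMod r) * (a ^ 2 + h * a + m)))]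
  refine Finset.sum_congr rfl fun a _ => ?_
  rw [eF_eq_std]; push_cast; rfl

lemma kloos_eq (m n : ℤ) (r : ℕ) [NeZero r] :
    kloos m n r = ∑ x : (ZMod r)ˣ, stdAddChar (N := r) ((m : ZMod r) * x + n * (x⁻¹ : (ZMod r)ˣ)) := by
  unfold kloos
  have : ∀ x : (ZMod r)ˣ, stdAddChar (N := r) ((m : ZMod r) * x + n * (x⁻¹ : (ZMod r)ˣ))
     = (fun y : ZMod r => stdAddChar (N := r) ((m : ZMod r) * y + n * y⁻¹)) (x : ZMod r) := by
    intro x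
    simp only [ZMod.inv_coe_unit]
  rw [Finset.sum_congr rfl (fun x _ => this x),
    ← sum_coprime_range r (fun y : ZMod r => stdAddChar (N := r) ((m : ZMod r) * y + n * y⁻¹))]
  refine Finset.sum_congr rfl fun x _ => ?_
  rw [eF_eq_std]; push_cast
  simp

lemma sum_kloos_twist (m h : ℤ) (r : ℕ) [NeZero r] :
    ∑ a ∈ Finset.range r, kloos m ((a : ℤ) ^ 2) r * eF (((h * a : ℤ) : ℝ) / r) = r * lamS m h r := by
  have hr : (r : ℂ) ≠ 0 := by exact_mod_cast NeZero.ne r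
  rw [lamS_eq, ← mul_assoc, mul_one_div_cancel hr, one_mul]
  have : ∀ a : ℕ, kloos m ((a : ℤ) ^ 2) r * eF (((h * a : ℤ) : ℝ) / r)
      = (fun b : ZMod r => ∑ x : (ZMod r)ˣ,
        stdAddChar (N := r) ((m : ZMod r) * x + b ^ 2 * (x⁻¹ : (ZMod r)ˣ)) * stdAddChar (N := r) (h * b)) (a : ZMod r) := by
    intro a
    rw [kloos_eq, eF_eq_std, Finset.sum_mul]
    push_cast; rfl
  rw [Finset.sum_congr rfl (fun a _ => this a), sum_range_zmod r (fun b : ZMod r =>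
    ∑ x : (ZMod r)ˣ, stdAddChar (N := r) ((m : ZMod r) * x + b ^ 2 * (x⁻¹ : (ZMod r)ˣ)) *
      stdAddChar (N := r) (h * b)), Finset.sum_comm]
  refine Finset.sum_congr rfl fun x _ => ?_
  rw [← Equiv.sum_comp (Units.mulLeft x)]
  refine Finset.sum_congr rfl fun a _ => ?_
  rw [← AddChar.map_add_eq_mul]
  congr 1
  simp only [Units.mulLeft_apply]
  have hx : (x : ZMod r) * ((x⁻¹ : (ZMod r)ˣ) : ZMod r) = 1 := by simp
  linear_combination (x : ZMod r) * a ^ 2 * hx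

lemma std_mul (c q : ℕ) [NeZero c] [NeZero q] [NeZero (c * q)] (u v : ℤ)
    (huv : (q : ℤ) * u + c * v = 1) (t : ZMod (c * q)) :
    stdAddChar t = stdAddChar (N := c) (u * (ZMod.castHom (dvd_mul_right c q) (ZMod c) t)) *
      stdAddChar (N := q) (v * (ZMod.castHom (dvd_mul_left q c) (ZMod q) t)) := by
  obtain ⟨j, rfl⟩ := ZMod.intCast_surjective t
  rw [map_intCast (ZMod.castHom (dvd_mul_right c q) (ZMod c)),
    map_intCast (ZMod.castHom (dvd_mul_left q c) (ZMod q)), ← Int.cast_mul, ← Int.cast_mul, stdAddChar_coe, stdAddChar_coe,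
    stdAddChar_coe, ← Complex.exp_add]
  congr 1
  have hc : (c : ℂ) ≠ 0 := by exact_mod_cast NeZero.ne c
  have hq : (q : ℂ) ≠ 0 := by exact_mod_cast NeZero.ne q
  have huv' : (q : ℂ) * u + c * v = 1 := by exact_mod_cast huv
  push_cast
  field_simp
  linear_combination (-(j:ℂ)) * huv'

lemma sum_mul_prod {A B : Type*} [Fintype A] [Fintype B] (f : A → ℂ) (g : B → ℂ) :
    (∑ a, f a) * (∑ b, g b) = ∑ p : A × B, f p.1 * g p.2 := by
  rw [Finset.sum_mul_sum, Fintype.sum_prod_type]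

lemma lamS_mul (m h : ℤ) (c q : ℕ) [NeZero c] [NeZero q] (hcq : Nat.Coprime c q) :
    lamS m h (c * q) = lamS m h c * lamS m h q := by
  have : NeZero (c * q) := ⟨mul_ne_zero (NeZero.ne c) (NeZero.ne q)⟩
  have hbez : ∃ u v : ℤ, (q : ℤ) * u + c * v = 1 := by
    have := (Nat.isCoprime_iff_coprime.mpr hcq)
    obtain ⟨a, b, hab⟩ := this
    exact ⟨b, a, by linarith⟩
  obtain ⟨u, v, huv⟩ := hbez
  have huc : (q : ZMod c) * (u : ZMod c) = 1 := by
    have := congrArg (fun z : ℤ => (z : ZMod c)) huv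
    simpa using this
  have hvq : (c : ZMod q) * (v : ZMod q) = 1 := by
    have := congrArg (fun z : ℤ => (z : ZMod q)) huv
    simpa using this
  let U : (ZMod c)ˣ := ⟨u, q, by rw [mul_comm]; exact huc, huc⟩
  let Vv : (ZMod q)ˣ := ⟨v, c, by rw [mul_comm]; exact hvq, hvq⟩
  let e := ZMod.chineseRemainder hcq
  have he1 : ∀ t, (e t).1 = ZMod.castHom (dvd_mul_right c q) (ZMod c) t := fun t =>
    RingHom.congr_fun (RingHom.ext_zmod ((RingHom.fst _ _).comp e.toRingHom) _) t
  have he2 : ∀ t, (e t).2 = ZMod.castHom (dvd_mul_left q c) (ZMod q) t := fun t =>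
    RingHom.congr_fun (RingHom.ext_zmod ((RingHom.snd _ _).comp e.toRingHom) _) t
  let eu : (ZMod (c * q))ˣ ≃* (ZMod c)ˣ × (ZMod q)ˣ :=
    (Units.mapEquiv e.toMulEquiv).trans MulEquiv.prodUnits
  have heu1 : ∀ x : (ZMod (c*q))ˣ, (((eu x).1 : (ZMod c)ˣ) : ZMod c) = (e x).1 := fun x => rfl
  have heu2 : ∀ x : (ZMod (c*q))ˣ, (((eu x).2 : (ZMod q)ˣ) : ZMod q) = (e x).2 := fun x => rfl
  rw [lamS_eq, lamS_eq, lamS_eq]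
  have key : ∑ x : (ZMod (c*q))ˣ, ∑ a : ZMod (c*q),
      stdAddChar (N := c*q) ((x : ZMod (c*q)) * (a ^ 2 + h * a + m)) =
      (∑ x : (ZMod c)ˣ, ∑ a : ZMod c, stdAddChar (N := c) ((x : ZMod c) * (a ^ 2 + h * a + m))) *
      (∑ x : (ZMod q)ˣ, ∑ a : ZMod q, stdAddChar (N := q) ((x : ZMod q) * (a ^ 2 + h * a + m))) := by
    rw [← Equiv.sum_comp (Equiv.mulLeft U) (fun x : (ZMod c)ˣ => ∑ a : ZMod c,
      stdAddChar (N := c) ((x : ZMod c) * (a ^ 2 + h * a + m))),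
      ← Equiv.sum_comp (Equiv.mulLeft Vv) (fun x : (ZMod q)ˣ => ∑ a : ZMod q,
      stdAddChar (N := q) ((x : ZMod q) * (a ^ 2 + h * a + m)))]
    rw [sum_mul_prod, ← Equiv.sum_comp eu.toEquiv]
    refine Finset.sum_congr rfl fun x _ => ?_
    rw [sum_mul_prod, ← Equiv.sum_comp e.toEquiv]
    refine Finset.sum_congr rfl fun a _ => ?_
    rw [std_mul c q u v huv]
    congr 2
    · rw [← he1]
      simp only [MulEquiv.toEquiv_eq_coe, EquivLike.coe_coe, Equiv.coe_mulLeft, Units.val_mul,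
        RingEquiv.toEquiv_eq_coe, heu1]
      simp [U, mul_assoc]
    · rw [← he2]
      simp only [MulEquiv.toEquiv_eq_coe, EquivLike.coe_coe, Equiv.coe_mulLeft, Units.val_mul,
        RingEquiv.toEquiv_eq_coe, heu2]
      simp [Vv, mul_assoc]
  rw [key]; push_cast
  have hc : (c : ℂ) ≠ 0 := by exact_mod_cast NeZero.ne c
  have hq : (q : ℂ) ≠ 0 := by exact_mod_cast NeZero.ne q
  field_simp

lemma std_sum (r : ℕ) [NeZero r] (n : ZMod r) :
    ∑ x : ZMod r, stdAddChar (x * n) = if n = 0 then (r : ℂ) else 0 := by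
  have := AddChar.sum_mulShift n (ZMod.isPrimitive_stdAddChar r)
  simp only [ZMod.card] at this
  rw [this]; split_ifs <;> simp

lemma lamS_prime (m h : ℤ) (q : ℕ) (hq : q.Prime) : ‖lamS m h q‖ ≤ 3 := by
  have : Fact q.Prime := ⟨hq⟩
  have hq0 : (q : ℂ) ≠ 0 := by exact_mod_cast hq.ne_zero
  rw [lamS_eq, Finset.sum_comm]
  have h1 : ∀ n : ZMod q, ∑ x : (ZMod q)ˣ, stdAddChar (N := q) ((x : ZMod q) * n) =
      (if n = 0 then (q : ℂ) else 0) - 1 := by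
    intro n
    rw [← std_sum q n, ← sum_coprime_range q (fun x => stdAddChar (x * n)),
      ← sum_range_zmod q (fun x => stdAddChar (x * n))]
    have : (Finset.range q).filter (fun x => Nat.Coprime x q) = (Finset.range q).erase 0 := by
      ext x
      simp only [Finset.mem_filter, Finset.mem_range, Finset.mem_erase]
      constructor
      · rintro ⟨a, b⟩
        refine ⟨?_, a⟩
        rintro rfl
        rw [Nat.coprime_zero_left] at b
        exact hq.one_lt.ne' b
      · rintro ⟨a, b⟩
        exact ⟨b, (Nat.coprime_of_lt_prime a b hq).symm⟩
    rw [this]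
    rw [← Finset.sum_erase_add (Finset.range q) _ (Finset.mem_range.mpr hq.pos)]
    simp
  simp_rw [h1]
  rw [Finset.sum_sub_distrib]
  rw [← Finset.sum_filter, Finset.sum_const, Finset.sum_const]
  set R := Finset.univ.filter (fun a : ZMod q => a ^ 2 + h * a + m = 0)
  have hR : R.card ≤ 2 := by
    rcases R.eq_empty_or_nonempty with h0 | ⟨b, hb⟩
    · simp [h0]
    · have : R ⊆ {b, -h - b} := by
        intro a ha
        simp only [R, Finset.mem_filter, Finset.mem_univ, true_and] at ha hb
        have : (a - b) * (a - (-h - b)) = 0 := by linear_combination ha - hb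
        rcases mul_eq_zero.mp this with h | h
        · simp [sub_eq_zero.mp h]
        · simp [sub_eq_zero.mp h]
      exact (Finset.card_le_card this).trans Finset.card_le_two
  have e : (1 / (q : ℂ)) * (R.card • (q : ℂ) - (Finset.univ : Finset (ZMod q)).card • (1:ℂ))
     = (R.card : ℂ) - 1 := by
    simp only [Finset.card_univ, ZMod.card, nsmul_eq_mul]
    field_simp
  rw [e]
  refine (norm_sub_le _ _).trans ?_
  simp only [Complex.norm_natCast, norm_one]
  have : (R.card : ℝ) ≤ 2 := by exact_mod_cast hR
  linarith

lemma gauss_bound (r : ℕ) [NeZero r] (x : (ZMod r)ˣ) (hh : ZMod r) :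
    ‖∑ a : ZMod r, stdAddChar (N := r) ((x : ZMod r) * (a ^ 2 + hh * a))‖ ^ 2 ≤ 2 * r := by
  set G := ∑ a : ZMod r, stdAddChar (N := r) ((x : ZMod r) * (a ^ 2 + hh * a))
  have h1 : ((‖G‖ ^ 2 : ℝ) : ℂ) = ∑ d : ZMod r, stdAddChar (N := r) ((x : ZMod r) * (d ^ 2 + hh * d)) *
      (if 2 * (x : ZMod r) * d = 0 then (r : ℂ) else 0) := by
    rw [← Complex.normSq_eq_norm_sq, Complex.normSq_eq_conj_mul_self]
    simp only [G]
    rw [map_sum, Finset.sum_mul_sum]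
    have : ∀ b : ZMod r, ∑ a : ZMod r, (starRingEnd ℂ) (stdAddChar (N := r) ((x : ZMod r) * (b ^ 2 + hh * b))) *
        stdAddChar (N := r) ((x : ZMod r) * (a ^ 2 + hh * a)) =
        ∑ d : ZMod r, stdAddChar (N := r) ((x : ZMod r) * (d ^ 2 + hh * d)) *
          stdAddChar (b * (2 * (x : ZMod r) * d)) := by
      intro b
      rw [← Equiv.sum_comp (Equiv.addRight b)]
      refine Finset.sum_congr rfl fun d _ => ?_
      rw [← AddChar.map_neg_eq_conj, ← AddChar.map_add_eq_mul, ← AddChar.map_add_eq_mul]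
      congr 1
      simp only [Equiv.coe_addRight]
      ring
    simp_rw [this]
    rw [Finset.sum_comm]
    refine Finset.sum_congr rfl fun d _ => ?_
    rw [← Finset.mul_sum, std_sum]
  set D := Finset.univ.filter (fun d : ZMod r => 2 * (x : ZMod r) * d = 0)
  have hD : D.card ≤ 2 := by
    have : D ⊆ {0, ((r / 2 : ℕ) : ZMod r)} := by
      intro d hd
      simp only [D, Finset.mem_filter, Finset.mem_univ, true_and] at hd
      have h2 : (x : ZMod r) * (2 * d) = 0 := by rw [← hd]; ring
      have h3 : 2 * d = 0 := by
        have := congrArg (fun t => ((x⁻¹ : (ZMod r)ˣ) : ZMod r) * t) h2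
        simpa [← mul_assoc] using this
      have h4 : ((2 * d.val : ℕ) : ZMod r) = 0 := by push_cast; simpa using h3
      rw [ZMod.natCast_eq_zero_iff] at h4
      have h5 := ZMod.val_lt d
      obtain ⟨j, hj⟩ := h4
      have hj2 : j < 2 := by
        by_contra hcon
        push Not at hcon
        have := Nat.mul_le_mul_left r hcon
        omega
      interval_cases j
      · have : d.val = 0 := by omega
        rw [ZMod.val_eq_zero] at this
        simp [this]
      · have : d.val = r / 2 := by omega
        rw [← this]; simp
    exact (Finset.card_le_card this).trans Finset.card_le_two
  have h2 : ‖((‖G‖ ^ 2 : ℝ) : ℂ)‖ ≤ 2 * r := by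
    rw [h1]
    refine (norm_sum_le _ _).trans ?_
    have : ∀ d : ZMod r, ‖stdAddChar (N := r) ((x : ZMod r) * (d ^ 2 + hh * d)) *
      (if 2 * (x : ZMod r) * d = 0 then (r : ℂ) else 0)‖ =
        if 2 * (x : ZMod r) * d = 0 then (r : ℝ) else 0 := by
      intro d
      rw [norm_mul, AddChar.norm_apply, one_mul]
      split_ifs <;> simp
    simp_rw [this]
    rw [← Finset.sum_filter, Finset.sum_const, nsmul_eq_mul]
    have : (D.card : ℝ) ≤ 2 := by exact_mod_cast hD
    gcongr
  rwa [Complex.norm_real, Real.norm_of_nonneg (by positivity)] at h2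

lemma lamS_sum_bound (I : Finset ℕ) (α : ℕ → ℂ) (h : ℤ) (c : ℕ) (hc : 1 ≤ c) :
    ‖∑ m ∈ I, α m * lamS m h c‖ ^ 2 ≤ 2 * Tsum I α c := by
  have : NeZero c := ⟨by omega⟩
  have hc0 : (0:ℝ) < c := by exact_mod_cast hc
  set P := (Finset.range c).filter (fun x => Nat.Coprime x c)
  set g : ℕ → ℂ := fun x => (1 / (c : ℂ)) * ∑ a ∈ Finset.range c,
    eF ((((x : ℤ) * ((a : ℤ) ^ 2 + h * a) : ℤ) : ℝ) / c)
  have hg : ∀ x ∈ P, ‖g x‖ ^ 2 ≤ 2 / c := by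
    intro x hx
    have hb := gauss_bound c (ZMod.unitOfCoprime x (Finset.mem_filter.mp hx).2) (h : ZMod c)
    rw [← sum_range_zmod] at hb
    have : ∑ a ∈ Finset.range c,
        eF ((((x : ℤ) * ((a : ℤ) ^ 2 + h * a) : ℤ) : ℝ) / c) =
        ∑ a ∈ Finset.range c, stdAddChar (N := c) (((ZMod.unitOfCoprime x (Finset.mem_filter.mp hx).2 : (ZMod c)ˣ) : ZMod c) *
          ((a : ZMod c) ^ 2 + (h : ZMod c) * a)) := by
      refine Finset.sum_congr rfl fun a _ => ?_
      rw [eF_eq_std]; push_cast; simp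
    simp only [g]
    rw [this, norm_mul, mul_pow]
    calc _ ≤ ‖1 / (c:ℂ)‖ ^ 2 * (2 * c) := by gcongr
      _ = 2 / c := by simp; field_simp
  have e : ∑ m ∈ I, α m * lamS m h c = ∑ x ∈ P, g x * ePoly I α ((x:ℝ) / c) := by
    simp only [ePoly, g, lamS]
    simp_rw [Finset.mul_sum]
    rw [Finset.sum_comm]
    refine Finset.sum_congr rfl fun x _ => ?_
    refine Finset.sum_congr rfl fun m _ => ?_
    rw [Finset.sum_mul]
    refine Finset.sum_congr rfl fun a _ => ?_
    have : eF ((((x : ℤ) * ((a : ℤ) ^ 2 + h * a + m) : ℤ) : ℝ) / c) =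
      eF ((((x : ℤ) * ((a : ℤ) ^ 2 + h * a) : ℤ) : ℝ) / c) * eF (m * ((x:ℝ) / c)) := by
      rw [← eF_add]; congr 1; push_cast; ring
    rw [this]; ring
  rw [e]
  have h1 : ‖∑ x ∈ P, g x * ePoly I α ((x:ℝ) / c)‖ ≤ ∑ x ∈ P, ‖g x‖ * ‖ePoly I α ((x:ℝ) / c)‖ := by
    refine (norm_sum_le _ _).trans (le_of_eq ?_)
    simp_rw [norm_mul]
  calc _ ≤ (∑ x ∈ P, ‖g x‖ * ‖ePoly I α ((x:ℝ) / c)‖) ^ 2 := by gcongr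
    _ ≤ (∑ x ∈ P, ‖g x‖ ^ 2) * (∑ x ∈ P, ‖ePoly I α ((x:ℝ) / c)‖ ^ 2) :=
      Finset.sum_mul_sq_le_sq_mul_sq _ _ _
    _ ≤ (∑ x ∈ P, 2 / (c:ℝ)) * Tsum I α c := by
      unfold Tsum
      gcongr with x hx
      exact hg x hx
    _ ≤ _ := by
      apply mul_le_mul_of_nonneg_right _ (Tsum_nonneg _ _ _)
      rw [Finset.sum_const, nsmul_eq_mul]
      have : (P.card : ℝ) ≤ c := by
        have := (Finset.card_filter_le (Finset.range c) (fun x => Nat.Coprime x c))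
        rw [Finset.card_range] at this
        exact_mod_cast this
      calc _ ≤ (c:ℝ) * (2 / c) := by gcongr
        _ = 2 := by field_simp

lemma bilinear_bound (M q : ℕ) (hM : 1 ≤ M) (hq : 1 ≤ q) (α β : ℕ → ℂ) (h : ℤ) :
    ‖∑ c ∈ Finset.Ico 1 q, β c * ∑ m ∈ Finset.Ico M (2 * M), α m * lamS m h c‖ ^ 2 ≤
      800 * (1 + Real.log q) * (∑ c ∈ Finset.Ico 1 q, ‖β c‖ ^ 2 * ((c:ℝ) ^ 2 + M)) *
        ∑ m ∈ Finset.Ico M (2 * M), ‖α m‖ ^ 2 := by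
  have hM' : (1:ℝ) ≤ M := by exact_mod_cast hM
  set I := Finset.Ico M (2 * M)
  have h1 : ‖∑ c ∈ Finset.Ico 1 q, β c * ∑ m ∈ I, α m * lamS m h c‖ ≤
      ∑ c ∈ Finset.Ico 1 q, (‖β c‖ * Real.sqrt ((c:ℝ)^2 + M)) *
        (‖∑ m ∈ I, α m * lamS m h c‖ / Real.sqrt ((c:ℝ)^2 + M)) := by
    refine (norm_sum_le _ _).trans (le_of_eq ?_)
    refine Finset.sum_congr rfl fun c _ => ?_
    rw [norm_mul]
    have : Real.sqrt ((c:ℝ)^2 + M) ≠ 0 := by positivity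
    field_simp
  calc _ ≤ (∑ c ∈ Finset.Ico 1 q, (‖β c‖ * Real.sqrt ((c:ℝ)^2 + M)) *
        (‖∑ m ∈ I, α m * lamS m h c‖ / Real.sqrt ((c:ℝ)^2 + M))) ^ 2 := by gcongr
    _ ≤ _ := Finset.sum_mul_sq_le_sq_mul_sq _ _ _
    _ ≤ (∑ c ∈ Finset.Ico 1 q, ‖β c‖ ^ 2 * ((c:ℝ) ^ 2 + M)) *
        (∑ c ∈ Finset.Ico 1 q, 2 * (Tsum I α c / ((c:ℝ) ^ 2 + M))) := by
        gcongr with c hc c hc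
        · rw [mul_pow, Real.sq_sqrt (by positivity)]
        · rw [div_pow, Real.sq_sqrt (by positivity), ← mul_div_assoc]
          have := lamS_sum_bound I α h c (Finset.mem_Ico.mp hc).1
          gcongr
    _ ≤ (∑ c ∈ Finset.Ico 1 q, ‖β c‖ ^ 2 * ((c:ℝ) ^ 2 + M)) *
        (2 * (400 * (1 + Real.log q) * ∑ m ∈ I, ‖α m‖ ^ 2)) := by
        rw [← Finset.mul_sum]
        have := large_sieve_weighted M q hM hq α
        gcongr
    _ = _ := by ring

end PartD

section PartE
open MeasureTheory Filter Asymptotics FourierTransform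

/-- twice differentiable functions supported on the positive half-line with decay -/
structure Good (f f1 f2 : ℝ → ℂ) : Prop where
  d1 : ∀ u, HasDerivAt f (f1 u) u
  d2 : ∀ u, HasDerivAt f1 (f2 u) u
  z : ∀ u, u ≤ 0 → f u = 0
  bd : ∃ C : ℝ, 0 ≤ C ∧ ∀ u, ‖f u‖ ≤ C * (1 + u ^ 2)⁻¹ ∧ ‖f1 u‖ ≤ C * (1 + u ^ 2)⁻¹ ∧
    ‖f2 u‖ ≤ C * (1 + u ^ 2)⁻¹

variable {f f1 f2 : ℝ → ℂ}

lemma Good.deriv_eq (h : Good f f1 f2) : deriv f = f1 := funext fun u => (h.d1 u).deriv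
lemma Good.deriv_eq2 (h : Good f f1 f2) : deriv f1 = f2 := funext fun u => (h.d2 u).deriv

lemma Good.int0 (h : Good f f1 f2) : Integrable f := by
  obtain ⟨C, hC, hb⟩ := h.bd
  refine (integrable_inv_one_add_sq.const_mul C).mono' ?_ (Eventually.of_forall fun u => (hb u).1)
  exact (continuous_iff_continuousAt.mpr fun u => (h.d1 u).continuousAt).aestronglyMeasurable

lemma Good.int1 (h : Good f f1 f2) : Integrable f1 := by
  obtain ⟨C, hC, hb⟩ := h.bd
  refine (integrable_inv_one_add_sq.const_mul C).mono' ?_ (Eventually.of_forall fun u => (hb u).2.1)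
  exact (continuous_iff_continuousAt.mpr fun u => (h.d2 u).continuousAt).aestronglyMeasurable

lemma Good.int2 (h : Good f f1 f2) : Integrable f2 := by
  obtain ⟨C, hC, hb⟩ := h.bd
  refine (integrable_inv_one_add_sq.const_mul C).mono' ?_ (Eventually.of_forall fun u => (hb u).2.2)
  rw [← h.deriv_eq2]
  exact (measurable_deriv f1).aestronglyMeasurable

lemma fourier_eq_eF (g : ℝ → ℂ) (x : ℝ) : 𝓕 g x = ∫ v : ℝ, eF (-(x * v)) * g v := by
  rw [Real.fourier_eq']
  congr 1; ext v
  rw [smul_eq_mul]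
  unfold eF
  congr 2
  simp only [RCLike.inner_apply, conj_trivial]
  push_cast; ring

lemma norm_fourier_le' (g : ℝ → ℂ) (x : ℝ) : ‖𝓕 g x‖ ≤ ∫ v : ℝ, ‖g v‖ := by
  rw [fourier_eq_eF]
  refine (norm_integral_le_integral_norm _).trans (le_of_eq ?_)
  simp [eF_norm]

lemma Good.fourier2 (h : Good f f1 f2) (x : ℝ) : 𝓕 f2 x = -((2 * Real.pi * x) ^ 2 : ℝ) * 𝓕 f x := by
  have a1 := Real.fourier_deriv h.int0 (fun u => (h.d1 u).differentiableAt)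
    (by rw [h.deriv_eq]; exact h.int1)
  have a2 := Real.fourier_deriv h.int1 (fun u => (h.d2 u).differentiableAt)
    (by rw [h.deriv_eq2]; exact h.int2)
  rw [h.deriv_eq] at a1
  rw [h.deriv_eq2] at a2
  rw [a2, a1]
  simp only [smul_eq_mul]
  push_cast
  linear_combination ((2 * Real.pi * x) ^ 2 * 𝓕 f x : ℂ) * Complex.I_sq

lemma eF_mul_integrable (x : ℝ) {g : ℝ → ℂ} (hg : Integrable g) :
    Integrable (fun v => eF (-(x * v)) * g v) := by
  refine hg.bdd_mul (c := 1) ?_ (Eventually.of_forall fun v => (eF_norm _).le)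
  have := eF_continuous
  exact Continuous.aestronglyMeasurable (by fun_prop)

lemma Good.fourier_B (h : Good f f1 f2) (x B : ℝ) (hB : 0 < B) :
    𝓕 f x = ((1 + (2 * Real.pi * x) ^ 2 / B)⁻¹ : ℝ) *
      ∫ v : ℝ, eF (-(x * v)) * (f v - (B⁻¹ : ℝ) * f2 v) := by
  have e : ∫ v : ℝ, eF (-(x * v)) * (f v - (B⁻¹ : ℝ) * f2 v) = 𝓕 f x - (B⁻¹ : ℝ) * 𝓕 f2 x := by
    rw [fourier_eq_eF, fourier_eq_eF, ← integral_const_mul, ← integral_sub]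
    · congr 1; ext v; ring
    · exact eF_mul_integrable x h.int0
    · exact (eF_mul_integrable x h.int2).const_mul _
  rw [e, h.fourier2]
  have hp : (1 + (2 * Real.pi * x) ^ 2 / B) ≠ 0 := by positivity
  have e2 : 𝓕 f x - (B⁻¹ : ℝ) * (-((2 * Real.pi * x) ^ 2 : ℝ) * 𝓕 f x) =
      ((1 + (2 * Real.pi * x) ^ 2 / B : ℝ) : ℂ) * 𝓕 f x := by
    push_cast; ring
  rw [e2, ← mul_assoc, ← Complex.ofReal_mul, inv_mul_cancel₀ hp]; simp

lemma Good.fourier_decay (h : Good f f1 f2) :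
    ∃ C : ℝ, 0 ≤ C ∧ ∀ x, ‖𝓕 f x‖ ≤ C * (1 + x ^ 2)⁻¹ := by
  refine ⟨∫ v : ℝ, ‖f v - ((1:ℝ)⁻¹ : ℝ) * f2 v‖, by positivity, fun x => ?_⟩
  rw [h.fourier_B x 1 one_pos, norm_mul, mul_comm]
  have h1 : ‖∫ v : ℝ, eF (-(x * v)) * (f v - ((1:ℝ)⁻¹ : ℝ) * f2 v)‖ ≤
      ∫ v : ℝ, ‖f v - ((1:ℝ)⁻¹ : ℝ) * f2 v‖ := by
    refine (norm_integral_le_integral_norm _).trans (le_of_eq ?_)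
    simp [eF_norm]
  refine mul_le_mul h1 ?_ (norm_nonneg _) (by positivity)
  rw [Complex.norm_real, Real.norm_of_nonneg (by positivity)]
  apply inv_anti₀ (by positivity)
  have hp : 1 ≤ 2 * Real.pi := by have := Real.pi_gt_three; linarith
  have hp2 : 1 ≤ (2 * Real.pi) ^ 2 := one_le_pow₀ hp
  rw [div_one, mul_pow]
  nlinarith [sq_nonneg x]

lemma isBigO_of_inv {g : ℝ → ℂ} {C : ℝ} (hC : 0 ≤ C) (hg : ∀ x, ‖g x‖ ≤ C * (1 + x ^ 2)⁻¹) :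
    g =O[cocompact ℝ] fun x => |x| ^ (-(2:ℝ)) := by
  refine IsBigO.of_bound C ?_
  have : ∀ᶠ x : ℝ in cocompact ℝ, x ≠ 0 := by
    have := (isCompact_singleton (x := (0:ℝ))).compl_mem_cocompact
    filter_upwards [this] with x hx using hx
  filter_upwards [this] with x hx
  refine (hg x).trans ?_
  gcongr
  rw [Real.norm_of_nonneg (by positivity), Real.rpow_neg (abs_nonneg _), Real.rpow_two, sq_abs]
  apply inv_anti₀ (by positivity)
  linarith

lemma Good.poisson (h : Good f f1 f2) (x : ℝ) :
    ∑' n : ℤ, f (x + n) = ∑' n : ℤ, 𝓕 f n * eF (n * x) := by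
  obtain ⟨C, hC, hb⟩ := h.bd
  obtain ⟨C', hC', hb'⟩ := h.fourier_decay
  have := Real.tsum_eq_tsum_fourier_of_rpow_decay
    (continuous_iff_continuousAt.mpr fun u => (h.d1 u).continuousAt) one_lt_two
    (isBigO_of_inv hC fun u => (hb u).1) (isBigO_of_inv hC' hb') x
  rw [this]
  congr 1; ext n
  congr 1
  rw [fourier_coe_apply]
  unfold eF
  congr 1; push_cast; simp; ring

lemma summable_int_inv_one_add_sq : Summable (fun n : ℤ => (1 + (n:ℝ) ^ 2)⁻¹) := by
  have h1 : Summable (fun n : ℤ => |(n:ℝ)| ^ (-(2:ℝ))) := by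
    have := Real.summable_abs_int_rpow (b := 2) one_lt_two
    exact this
  have h2 : Summable (fun n : ℤ => |(n:ℝ)| ^ (-(2:ℝ)) + if n = 0 then 1 else 0) := by
    refine h1.add ?_
    exact (hasSum_ite_eq 0 (1:ℝ)).summable
  refine Summable.of_nonneg_of_le (fun n => by positivity) (fun n => ?_) h2
  by_cases hn : n = 0
  · subst hn; simp
  · simp only [hn, if_false, add_zero]
    have : (n:ℝ) ≠ 0 := by exact_mod_cast hn
    rw [Real.rpow_neg (abs_nonneg _), Real.rpow_two, sq_abs]
    apply inv_anti₀ (by positivity)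
    linarith

lemma Good.summable_fourier (h : Good f f1 f2) : Summable (fun n : ℤ => ‖𝓕 f n‖) := by
  obtain ⟨C', hC', hb'⟩ := h.fourier_decay
  exact Summable.of_nonneg_of_le (fun n => norm_nonneg _) (fun n => hb' n)
    (summable_int_inv_one_add_sq.mul_left C')

lemma Good.poisson_kloos (h : Good f f1 f2) (m : ℤ) (r : ℕ) [NeZero r] :
    ∑' n : ℕ, kloos m ((n:ℤ)^2) r * f ((n:ℝ) / r) = r * ∑' n : ℤ, 𝓕 f n * lamS m n r := by
  have hr : (0:ℝ) < r := by exact_mod_cast Nat.pos_of_ne_zero (NeZero.ne r)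
  obtain ⟨C, hC, hb⟩ := h.bd
  have hper : ∀ n n' : ℕ, (n : ZMod r) = n' → kloos m ((n:ℤ)^2) r = kloos m ((n':ℤ)^2) r := by
    intro n n' hnn
    rw [kloos_eq, kloos_eq]; push_cast; rw [hnn]
  have hkb : ∀ n : ℕ, ‖kloos m ((n:ℤ)^2) r‖ ≤ r := by
    intro n
    unfold kloos
    refine (norm_sum_le _ _).trans ?_
    simp only [eF_norm, Finset.sum_const, nsmul_eq_mul, mul_one]
    have := (Finset.card_filter_le (Finset.range r) (fun x => Nat.Coprime x r))
    rw [Finset.card_range] at this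
    exact_mod_cast this
  have hsum : Summable (fun n : ℕ => kloos m ((n:ℤ)^2) r * f ((n:ℝ) / r)) := by
    apply Summable.of_norm
    have hs : Summable (fun n : ℕ => (r:ℝ) * (C * ((r:ℝ)^2 * (1 + ((n:ℤ):ℝ) ^ 2)⁻¹))) :=
      ((((summable_int_inv_one_add_sq).comp_injective Nat.cast_injective).mul_left _).mul_left _).mul_left _
    refine Summable.of_nonneg_of_le (fun n => norm_nonneg _) (fun n => ?_) hs
    rw [norm_mul]
    refine mul_le_mul (hkb n) ?_ (norm_nonneg _) hr.le
    refine (hb _).1.trans ?_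
    gcongr
    rw [inv_eq_one_div, inv_eq_one_div, ← mul_div_assoc, mul_one, div_le_div_iff₀ (by positivity) (by positivity)]
    have h1 : (1:ℝ) ≤ r := by exact_mod_cast Nat.pos_of_ne_zero (NeZero.ne r)
    have e : (r:ℝ)^2 * (1 + ((n:ℝ)/r)^2) = r^2 + (n:ℝ)^2 := by field_simp
    rw [e]; push_cast
    nlinarith
  rw [Nat.sumByResidueClasses hsum r]
  have hj : ∀ j : ZMod r, ∑' l : ℕ, kloos m (((j.val + r * l : ℕ):ℤ)^2) r *
      f (((j.val + r * l : ℕ):ℝ) / r) =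
      kloos m ((j.val:ℤ)^2) r * ∑' n : ℤ, 𝓕 f n * eF (n * ((j.val:ℝ) / r)) := by
    intro j
    rw [← h.poisson]
    have e1 : ∀ l : ℕ, kloos m (((j.val + r * l : ℕ):ℤ)^2) r *
      f (((j.val + r * l : ℕ):ℝ) / r) = kloos m ((j.val:ℤ)^2) r *
        (fun n : ℤ => f ((j.val:ℝ)/r + n)) ((l:ℕ):ℤ) := by
      intro l
      rw [hper (j.val + r * l) j.val (by push_cast; simp)]
      congr 2
      push_cast
      field_simp
    rw [tsum_congr e1, tsum_mul_left]
    congr 1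
    refine Function.Injective.tsum_eq (f := fun n : ℤ => f ((j.val:ℝ)/r + n)) Nat.cast_injective ?_
    intro n hn
    rw [Function.mem_support] at hn
    by_contra hcon
    apply hn
    apply h.z
    have hneg : n < 0 := by
      by_contra h0
      push Not at h0
      exact hcon ⟨n.toNat, by simp [h0]⟩
    have hle : (n:ℝ) ≤ -1 := by exact_mod_cast (by omega : n ≤ -1)
    have : (j.val:ℝ)/r ≤ 1 := by
      rw [div_le_one hr]; exact_mod_cast (ZMod.val_lt j).le
    linarith
  rw [Finset.sum_congr rfl (fun j _ => hj j)]
  have hsF : ∀ j : ZMod r, Summable (fun n : ℤ => kloos m ((j.val:ℤ)^2) r *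
      (𝓕 f n * eF (n * ((j.val:ℝ) / r)))) := by
    intro j
    apply Summable.mul_left
    apply Summable.of_norm
    simpa [eF_norm] using h.summable_fourier
  simp_rw [← tsum_mul_left]
  rw [← Summable.tsum_finsetSum (fun j _ => hsF j)]
  congr 1; ext n
  rw [mul_left_comm, ← sum_kloos_twist, Finset.mul_sum]
  have := sum_range_zmod r (fun j => kloos m ((j.val:ℤ)^2) r *
      (𝓕 f n * eF (n * ((j.val:ℝ) / r))))
  rw [← this]
  refine Finset.sum_congr rfl fun a ha => ?_
  rw [ZMod.val_natCast_of_lt (Finset.mem_range.mp ha)]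
  have : eF (((n * a : ℤ) : ℝ) / r) = eF (n * ((a:ℝ) / r)) := by congr 1; push_cast; ring
  rw [this]; ring

end PartE

section PartF
open MeasureTheory Filter

/-- building block `u^a · Mel F (cu) · J_n(bu)` on `u > 0`. -/
noncomputable def atom (a : ℝ) (F : ℂ → ℂ) (n : ℕ) (c b u : ℝ) : ℂ :=
  if 0 < u then ((u ^ a : ℝ) : ℂ) * Mel F 2 (c * u) * (besselJ n (b * u) : ℂ) else 0

lemma atom_norm_pos (a : ℝ) (F : ℂ → ℂ) (n : ℕ) (c b u : ℝ) (hu : 0 < u) :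
    ‖atom a F n c b u‖ = u ^ a * ‖Mel F 2 (c * u)‖ * |besselJ n (b * u)| := by
  rw [atom, if_pos hu, norm_mul, norm_mul, Complex.norm_real, Complex.norm_real,
    Real.norm_of_nonneg (Real.rpow_nonneg hu.le _), Real.norm_eq_abs]

lemma atom_bound {N : ℕ} {K : ℝ → ℝ → ℝ} {F : ℂ → ℂ} (h : Cls N K F) (hN : 2 ≤ N)
    (a : ℝ) (ha : -5/2 ≤ a) (ha' : a ≤ 0) (n : ℕ) (hn : 5 ≤ n) (c b : ℝ) (hc : 0 < c) (hb : 0 < b) :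
    ∃ C : ℝ, 0 ≤ C ∧ ∀ u, ‖atom a F n c b u‖ ≤ C * u ^ 2 ∧
      ‖atom a F n c b u‖ ≤ C * (1 + u ^ 2)⁻¹ := by
  have hK1 : 0 ≤ K (1/2) (1/2) := h.K_nonneg (by norm_num) le_rfl
  have hK2 : 0 ≤ K 2 2 := h.K_nonneg (by norm_num) le_rfl
  set C1 := K (1/2) (1/2) * c ^ (-(1/2:ℝ)) * b ^ 5 with hC1
  set C2 := K 2 2 * c ^ (-(2:ℝ)) with hC2
  have hC1n : 0 ≤ C1 := by positivity
  have hC2n : 0 ≤ C2 := by positivity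
  refine ⟨2 * (C1 + C2), by positivity, fun u => ?_⟩
  rcases le_or_gt u 0 with hu | hu
  · have : atom a F n c b u = 0 := by rw [atom, if_neg (not_lt.mpr hu)]
    rw [this, norm_zero]
    constructor <;> positivity
  rcases le_or_gt u 1 with hu1 | hu1
  · have key : ‖atom a F n c b u‖ ≤ C1 * u ^ 2 := by
      rw [atom_norm_pos _ _ _ _ _ _ hu]
      have b1 := h.Mel_bound' hN (σ := 2) (σ' := 1/2) (by norm_num) (by norm_num) (mul_pos hc hu)
      have b2 := besselJ_abs_le_pow 5 n (b * u) hn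
      rw [abs_of_pos (mul_pos hb hu)] at b2
      calc _ ≤ u ^ a * (K (1/2) (1/2) * (c * u) ^ (-(1/2:ℝ))) * (b * u) ^ 5 := by gcongr
        _ = C1 * (u ^ a * u ^ (-(1/2:ℝ)) * u ^ (5:ℝ)) := by
          rw [Real.mul_rpow hc.le hu.le, hC1, mul_pow]
          rw [show u ^ (5:ℝ) = u ^ 5 by norm_cast]; ring
        _ = C1 * u ^ (a + -(1/2) + 5) := by rw [Real.rpow_add hu, Real.rpow_add hu]
        _ ≤ C1 * u ^ (2:ℝ) := by
          gcongr C1 * ?_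
          exact Real.rpow_le_rpow_of_exponent_ge hu hu1 (by linarith)
        _ = _ := by norm_cast
    constructor
    · nlinarith [sq_nonneg u, mul_nonneg hC1n (sq_nonneg u), mul_nonneg hC2n (sq_nonneg u)]
    · rw [← div_eq_mul_inv, le_div_iff₀ (by positivity)]
      have hu2 : u ^ 2 ≤ 1 := pow_le_one₀ hu.le hu1
      have : ‖atom a F n c b u‖ ≤ C1 := key.trans (by nlinarith)
      calc _ ≤ C1 * (1 + 1) := by gcongr
        _ ≤ _ := by linarith
  · have key : ‖atom a F n c b u‖ * u ^ 2 ≤ C2 := by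
      rw [atom_norm_pos _ _ _ _ _ _ hu]
      have b1 := h.Mel_bound' hN (σ := 2) (σ' := 2) (by norm_num) (by norm_num) (mul_pos hc hu)
      have b2 := besselJ_abs_le_one n (b * u)
      have b3 : u ^ a ≤ 1 := Real.rpow_le_one_of_one_le_of_nonpos hu1.le ha'
      calc _ ≤ 1 * (K 2 2 * (c * u) ^ (-(2:ℝ))) * 1 * u ^ 2 := by gcongr
        _ = C2 * (u ^ (-(2:ℝ)) * u ^ (2:ℝ)) := by
          rw [Real.mul_rpow hc.le hu.le, hC2]
          rw [show u ^ (2:ℝ) = u ^ 2 by norm_cast]; ring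
        _ = C2 := by rw [← Real.rpow_add hu]; simp
    have hu2 : 1 ≤ u ^ 2 := one_le_pow₀ hu1.le
    have hn0 := norm_nonneg (atom a F n c b u)
    constructor
    · nlinarith
    · rw [← div_eq_mul_inv, le_div_iff₀ (by positivity)]
      nlinarith

lemma Cls.Mel_lin {N : ℕ} {K : ℝ → ℝ → ℝ} {F : ℂ → ℂ} (h : Cls (N + 1) K F) (hN : 2 ≤ N)
    (a : ℝ) {y : ℝ} (hy : 0 < y) : Mel (fun s => ((a : ℂ) - s) * F s) 2 y =
        a * Mel F 2 y + Mel (fun s => (((0 : ℝ) : ℂ) - s) * F s) 2 y := by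
  unfold Mel
  rw [mul_left_comm, ← mul_add]
  congr 1
  rw [← integral_const_mul, ← integral_add]
  · congr 1
    ext t
    push_cast
    ring
  · exact (h.integrable (by omega) (by norm_num) hy).const_mul _
  · exact (h.mulSub 0).integrable hN (by norm_num) hy

lemma atom_deriv {N : ℕ} {K : ℝ → ℝ → ℝ} {F : ℂ → ℂ} (h : Cls (N + 1) K F) (hN : 2 ≤ N)
    (a : ℝ) (ha : -5/2 ≤ a) (ha' : a ≤ 0) (n : ℕ) (hn : 5 ≤ n) (c b : ℝ) (hc : 0 < c) (hb : 0 < b)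
    (u : ℝ) :
    HasDerivAt (atom a F (n + 1) c b)
      (atom (a - 1) (fun s => ((a : ℂ) - s) * F s) (n + 1) c b u +
        (b / 2 : ℝ) * (atom a F n c b u - atom a F (n + 2) c b u)) u := by
  rcases lt_trichotomy u 0 with hu | hu | hu
  · have hz : ∀ a' F' n', atom a' F' n' c b u = 0 := fun a' F' n' => by
      rw [atom, if_neg (not_lt.mpr hu.le)]
    simp only [hz, sub_self, mul_zero, add_zero]
    refine (hasDerivAt_const u (0:ℂ)).congr_of_eventuallyEq ?_
    filter_upwards [Iio_mem_nhds hu] with v hv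
    rw [atom, if_neg (not_lt.mpr (le_of_lt hv))]
  · subst hu
    have hz : ∀ a' F' n', atom a' F' n' c b 0 = 0 := fun a' F' n' => by
      rw [atom, if_neg (lt_irrefl _)]
    simp only [hz, sub_self, mul_zero, add_zero]
    obtain ⟨C, hC, hbd⟩ := atom_bound h (by omega) a ha ha' (n + 1) (by omega) c b hc hb
    rw [hasDerivAt_iff_isLittleO_nhds_zero]
    simp only [zero_add, hz, sub_zero, smul_zero]
    have h1 : (fun v : ℝ => atom a F (n + 1) c b v) =O[nhds 0] fun v : ℝ => v ^ 2 := by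
      refine Asymptotics.IsBigO.of_bound C (Eventually.of_forall fun v => ?_)
      rw [Real.norm_of_nonneg (sq_nonneg v)]
      exact (hbd v).1
    refine h1.trans_isLittleO ?_
    exact Asymptotics.isLittleO_pow_id one_lt_two
  · have e : ∀ᶠ v in nhds u, atom a F (n + 1) c b v =
        ((v ^ a : ℝ) : ℂ) * Mel F 2 (c * v) * (besselJ (n + 1) (b * v) : ℂ) := by
      filter_upwards [Ioi_mem_nhds hu] with v hv
      rw [atom, if_pos (Set.mem_Ioi.mp hv)]
    refine HasDerivAt.congr_of_eventuallyEq ?_ e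
    have hcu : 0 < c * u := mul_pos hc hu
    have d1 : HasDerivAt (fun v : ℝ => ((v ^ a : ℝ) : ℂ)) ((a * u ^ (a - 1) : ℝ) : ℂ) u :=
      (Real.hasDerivAt_rpow_const (Or.inl hu.ne')).ofReal_comp
    have dl : HasDerivAt (fun v : ℝ => c * v) c u := by
      simpa using (hasDerivAt_id' u).const_mul c
    have dl2 : HasDerivAt (fun v : ℝ => b * v) b u := by
      simpa using (hasDerivAt_id' u).const_mul b
    have d2 : HasDerivAt (fun v : ℝ => Mel F 2 (c * v))
        (c • (Mel (fun s => (((0 : ℝ) : ℂ) - s) * F s) 2 (c * u) / ((c * u : ℝ) : ℂ))) u :=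
      HasDerivAt.scomp u (h.Mel_deriv hN (σ := 2) (by norm_num) hcu) dl
    have d3 : HasDerivAt (fun v : ℝ => ((besselJ (n + 1) (b * v) : ℝ) : ℂ))
        ((((besselJ n (b * u) - besselJ (n + 2) (b * u)) / 2 * b : ℝ)) : ℂ) u :=
      ((besselJ_hasDerivAt n (b * u)).comp u dl2).ofReal_comp
    refine ((d1.fun_mul d2).fun_mul d3).congr_deriv ?_
    have hMel : Mel (fun s => ((a : ℂ) - s) * F s) 2 (c * u) =
        a * Mel F 2 (c * u) + Mel (fun s => (((0 : ℝ) : ℂ) - s) * F s) 2 (c * u) := by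
      exact h.Mel_lin hN a hcu
    rw [atom, atom, atom, if_pos hu, if_pos hu, if_pos hu, hMel]
    rw [Complex.real_smul]
    have hua : ((u ^ a : ℝ) : ℂ) = ((u ^ (a - 1) : ℝ) : ℂ) * u := by
      rw [← Complex.ofReal_mul]
      congr 1
      rw [Real.rpow_sub_one hu.ne']; field_simp
    rw [hua]
    have hu' : (u : ℂ) ≠ 0 := by exact_mod_cast hu.ne'
    have hc' : (c : ℂ) ≠ 0 := by exact_mod_cast hc.ne'
    push_cast
    field_simp

end PartF

section PartF2
open MeasureTheory Filter

lemma besselJ_block_bound (n : ℕ) (hn : 5 ≤ n) : ∃ K : ℝ, 0 ≤ K ∧ ∀ (M m : ℕ), 1 ≤ M →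
    M ≤ m → m < 2 * M → ∀ u : ℝ, 0 < u →
    |besselJ n (4 * Real.pi * Real.sqrt m * u)| ≤
      K * min ((u * Real.sqrt M) ^ 3) ((u * Real.sqrt M) ^ (-(1:ℝ)/2)) := by
  obtain ⟨Kd, hKd, hd⟩ := besselJ_decay (n - 2)
  rw [show n - 2 + 2 = n by omega] at hd
  refine ⟨(8 * Real.pi) ^ 3 + Kd, by have := Real.pi_pos; positivity, ?_⟩
  intro M m hM hMm hm u hu
  have hM' : (1:ℝ) ≤ M := by exact_mod_cast hM
  have hp := Real.pi_gt_three
  have hw : 0 < Real.sqrt M := by positivity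
  have s1 : Real.sqrt M ≤ Real.sqrt m := Real.sqrt_le_sqrt (by exact_mod_cast hMm)
  have s2 : Real.sqrt m ≤ 2 * Real.sqrt M := by
    rw [Real.sqrt_le_left (by positivity), mul_pow, Real.sq_sqrt (by positivity)]
    have : (m:ℝ) < 2 * M := by exact_mod_cast hm
    linarith
  set z := u * Real.sqrt M with hz
  have hz0 : 0 < z := by positivity
  set x := 4 * Real.pi * Real.sqrt m * u with hx
  have hx0 : 0 < x := by
    have : 0 < Real.sqrt m := lt_of_lt_of_le hw s1
    positivity
  have hxz : z ≤ x := by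
    have : Real.sqrt M * 1 ≤ Real.sqrt m * (4 * Real.pi) := by
      apply mul_le_mul s1 (by linarith) zero_le_one (Real.sqrt_nonneg _)
    calc z = (Real.sqrt M * 1) * u := by rw [hz]; ring
      _ ≤ (Real.sqrt m * (4 * Real.pi)) * u := by gcongr
      _ = x := by rw [hx]; ring
  have hxz2 : x ≤ 8 * Real.pi * z := by
    calc x ≤ 4 * Real.pi * (2 * Real.sqrt M) * u := by rw [hx]; gcongr
      _ = _ := by rw [hz]; ring
  rw [mul_min_of_nonneg _ _ (by positivity)]
  refine le_min ?_ ?_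
  · have := besselJ_abs_le_pow 3 n x (by omega)
    rw [abs_of_pos hx0] at this
    calc _ ≤ x ^ 3 := this
      _ ≤ (8 * Real.pi * z) ^ 3 := by gcongr
      _ = (8 * Real.pi) ^ 3 * z ^ 3 := by ring
      _ ≤ _ := by gcongr; linarith
  · calc _ ≤ Kd * x ^ (-(1:ℝ)/2) := hd x hx0
      _ ≤ Kd * z ^ (-(1:ℝ)/2) := by
        gcongr Kd * ?_
        exact Real.rpow_le_rpow_of_nonpos hz0 hxz (by norm_num)
      _ ≤ _ := by
        gcongr
        have : 0 ≤ (8 * Real.pi) ^ 3 := by positivity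
        linarith

lemma scalar_z (z : ℝ) (hz : 0 < z) (j : ℕ) (hj : j ≤ 2) :
    (z⁻¹ ^ j) ^ 2 * (z⁻¹ ^ 2 + 1) * (min (z ^ 3) (z ^ (-(1:ℝ)/2))) ^ 2 ≤
      2 * (min 1 (z ^ (-(1:ℝ)/2))) ^ 2 := by
  have hzi : 0 < z⁻¹ := by positivity
  have hr : 0 < z ^ (-(1:ℝ)/2) := by positivity
  rcases le_or_gt z 1 with h1 | h1
  · have e1 : min 1 (z ^ (-(1:ℝ)/2)) = 1 :=
      min_eq_left (Real.one_le_rpow_of_pos_of_le_one_of_nonpos hz h1 (by norm_num))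
    rw [e1]
    have hz1 : 1 ≤ z⁻¹ := (one_le_inv₀ hz).mpr h1
    have e2 : z⁻¹ ^ j ≤ z⁻¹ ^ 2 := pow_le_pow_right₀ hz1 hj
    have e3 : 1 ≤ z⁻¹ ^ 2 := one_le_pow₀ hz1
    have e4 : min (z ^ 3) (z ^ (-(1:ℝ)/2)) ≤ z ^ 3 := min_le_left _ _
    calc _ ≤ (z⁻¹ ^ 2) ^ 2 * (z⁻¹ ^ 2 + z⁻¹ ^ 2) * (z ^ 3) ^ 2 := by gcongr
      _ = 2 * 1 ^ 2 := by field_simp; norm_num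
  · have e1 : min 1 (z ^ (-(1:ℝ)/2)) = z ^ (-(1:ℝ)/2) :=
      min_eq_right (Real.rpow_le_one_of_one_le_of_nonpos h1.le (by norm_num))
    rw [e1]
    have hz1 : z⁻¹ ≤ 1 := inv_le_one_of_one_le₀ h1.le
    have e2 : z⁻¹ ^ j ≤ 1 := pow_le_one₀ hzi.le hz1
    have e3 : z⁻¹ ^ 2 ≤ 1 := pow_le_one₀ hzi.le hz1
    have e4 : min (z ^ 3) (z ^ (-(1:ℝ)/2)) ≤ z ^ (-(1:ℝ)/2) := min_le_right _ _
    calc _ ≤ (1:ℝ) ^ 2 * (1 + 1) * (z ^ (-(1:ℝ)/2)) ^ 2 := by gcongr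
      _ = _ := by ring

lemma sum_inv_le (q : ℕ) (hq : 1 ≤ q) :
    ∑ c ∈ Finset.Ico 1 q, ((c:ℝ))⁻¹ ≤ 1 + Real.log q := by
  have h := harmonic_le_one_add_log q
  refine le_trans ?_ h
  rw [harmonic_eq_sum_Icc]
  push_cast
  refine Finset.sum_le_sum_of_subset_of_nonneg ?_ (fun c _ _ => by positivity)
  intro c hc
  rw [Finset.mem_Ico] at hc; rw [Finset.mem_Icc]; omega

lemma mel_weight (K : ℝ → ℝ → ℝ) (σ : ℝ) (hσ : 0 < σ) (F : ℂ → ℂ) (hF : Cls 2 K F)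
    (M c : ℕ) (hc : 1 ≤ c) (u : ℝ) (hu : 0 < u) :
    ‖Mel F 2 (c * u)‖ ^ 2 * ((c:ℝ) ^ 2 + M) ≤
      (K σ σ + K (σ + 1) (σ + 1)) ^ 2 * (u ^ (-σ)) ^ 2 * (u⁻¹ ^ 2 + M) := by
  have hK1 : 0 ≤ K σ σ := hF.K_nonneg hσ le_rfl
  have hK2 : 0 ≤ K (σ + 1) (σ + 1) := hF.K_nonneg (by linarith) le_rfl
  have hc' : (1:ℝ) ≤ c := by exact_mod_cast hc
  have hc0 : (0:ℝ) < c := by linarith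
  have hcu : 0 < c * u := by positivity
  have b1 := hF.Mel_bound' le_rfl (σ := 2) (σ' := σ) (by norm_num) hσ hcu
  have b2 := hF.Mel_bound' le_rfl (σ := 2) (σ' := σ + 1) (by norm_num) (by linarith) hcu
  set K1 := K σ σ + K (σ + 1) (σ + 1)
  have hcs : (c:ℝ) ^ (-σ) ≤ 1 := Real.rpow_le_one_of_one_le_of_nonpos hc' (by linarith)
  have us : 0 < u ^ (-σ) := by positivity
  have c1 : ‖Mel F 2 (c * u)‖ ≤ K1 * u ^ (-σ) := by
    calc _ ≤ K σ σ * (c * u) ^ (-σ) := b1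
      _ = K σ σ * ((c:ℝ) ^ (-σ) * u ^ (-σ)) := by rw [Real.mul_rpow hc0.le hu.le]
      _ ≤ K1 * (1 * u ^ (-σ)) := by gcongr; simp only [K1]; linarith
      _ = _ := by ring
  have c2 : ‖Mel F 2 (c * u)‖ * c ≤ K1 * u ^ (-σ) * u⁻¹ := by
    calc _ ≤ K (σ+1) (σ+1) * (c * u) ^ (-(σ+1)) * c := by gcongr
      _ = K (σ+1) (σ+1) * ((c:ℝ) ^ (-σ) * u ^ (-σ) * u⁻¹) := by
        rw [Real.mul_rpow hc0.le hu.le, neg_add, Real.rpow_add hc0, Real.rpow_add hu,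
          Real.rpow_neg_one, Real.rpow_neg_one]
        field_simp
      _ ≤ K1 * (1 * u ^ (-σ) * u⁻¹) := by gcongr; simp only [K1]; linarith
      _ = _ := by ring
  calc _ = (‖Mel F 2 (c * u)‖ * c) ^ 2 + ‖Mel F 2 (c * u)‖ ^ 2 * M := by ring
    _ ≤ (K1 * u ^ (-σ) * u⁻¹) ^ 2 + (K1 * u ^ (-σ)) ^ 2 * M := by gcongr
    _ = _ := by ring

lemma atom_sum_bound (K : ℝ → ℝ → ℝ) (σ : ℝ) (hσ : 0 < σ) (n : ℕ) (hn : 5 ≤ n) :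
    ∃ K' : ℝ, 0 ≤ K' ∧ ∀ F, Cls 2 K F → ∀ (M q : ℕ), 1 ≤ M → 1 ≤ q → ∀ (j : ℕ), j ≤ 2 →
      ∀ (Y : ℕ → ℂ) (X : ℝ), 0 ≤ X →
      (∀ m ∈ Finset.Ico M (2 * M), ‖Y m‖ ≤ X * (Real.sqrt M)⁻¹ ^ j) → ∀ (h : ℤ) (u : ℝ), 0 < u →
      ‖∑ c ∈ Finset.Ico 1 q, ∑ m ∈ Finset.Ico M (2 * M),
        (((c:ℝ) ^ (-(1:ℝ)/2) : ℝ) : ℂ) * Y m * lamS m h c *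
          atom (-(1:ℝ)/2 - j) F n c (4 * Real.pi * Real.sqrt m) u‖ ≤
      K' * (1 + Real.log q) * X * M * (u ^ (-(1:ℝ)/2) * u ^ (-σ)) *
        min 1 ((u * Real.sqrt M) ^ (-(1:ℝ)/2)) := by
  obtain ⟨KJ, hKJ, hJ⟩ := besselJ_block_bound n hn
  set K1 := K σ σ + K (σ + 1) (σ + 1) with hK1def
  refine ⟨40 * |K1| * KJ, by positivity, ?_⟩
  intro F hF M q hM hq j hj Y X hX hY h u hu
  have hM' : (1:ℝ) ≤ M := by exact_mod_cast hM
  have hq' : (1:ℝ) ≤ q := by exact_mod_cast hq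
  have hL : 1 ≤ 1 + Real.log q := by have := Real.log_nonneg hq'; linarith
  set L := 1 + Real.log q
  set w := Real.sqrt M with hw
  have hw0 : 0 < w := by positivity
  have hw2 : w ^ 2 = M := Real.sq_sqrt (by positivity)
  set z := u * w with hz
  have hz0 : 0 < z := by positivity
  set ψ := min (z ^ 3) (z ^ (-(1:ℝ)/2)) with hψ
  have hψ0 : 0 ≤ ψ := by positivity
  set μ := min 1 (z ^ (-(1:ℝ)/2)) with hμ
  have hμ0 : 0 ≤ μ := by positivity
  set P := u ^ (-(1:ℝ)/2) with hP
  have hP0 : 0 < P := by positivity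
  set ρ := u ^ (-σ) with hρ
  have hρ0 : 0 < ρ := by positivity
  set I := Finset.Ico M (2 * M)
  set β : ℕ → ℂ := fun c => (((c:ℝ) ^ (-(1:ℝ)/2) : ℝ) : ℂ) * Mel F 2 (c * u) with hβ
  set α : ℕ → ℂ := fun m => Y m * (besselJ n (4 * Real.pi * Real.sqrt m * u) : ℂ) with hα
  have hexp : u ^ (-(1:ℝ)/2 - j) = P * u⁻¹ ^ j := by
    rw [Real.rpow_sub hu, Real.rpow_natCast, inv_pow, div_eq_mul_inv]
  have e : ∑ c ∈ Finset.Ico 1 q, ∑ m ∈ I, (((c:ℝ) ^ (-(1:ℝ)/2) : ℝ) : ℂ) * Y m * lamS m h c *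
          atom (-(1:ℝ)/2 - j) F n c (4 * Real.pi * Real.sqrt m) u =
      ((P * u⁻¹ ^ j : ℝ) : ℂ) * ∑ c ∈ Finset.Ico 1 q, β c * ∑ m ∈ I, α m * lamS m h c := by
    rw [Finset.mul_sum]
    refine Finset.sum_congr rfl fun c _ => ?_
    rw [Finset.mul_sum, Finset.mul_sum]
    refine Finset.sum_congr rfl fun m _ => ?_
    rw [atom, if_pos hu, hexp, hβ, hα]; ring
  rw [e, norm_mul, Complex.norm_real, Real.norm_of_nonneg (by positivity)]
  have hbil := bilinear_bound M q hM hq α β h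
  have hαs : ∑ m ∈ I, ‖α m‖ ^ 2 ≤ M * (X * w⁻¹ ^ j * (KJ * ψ)) ^ 2 := by
    calc _ ≤ ∑ m ∈ I, (X * w⁻¹ ^ j * (KJ * ψ)) ^ 2 := by
          refine Finset.sum_le_sum fun m hm => ?_
          have hm' := Finset.mem_Ico.mp hm
          have := hJ M m hM hm'.1 hm'.2 u hu
          simp only [hα]
          rw [norm_mul, Complex.norm_real, Real.norm_eq_abs]
          have h2 := hY m hm
          gcongr
      _ = _ := by
          rw [Finset.sum_const, nsmul_eq_mul, Nat.card_Ico]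
          congr 2
          omega
  have hβs : ∑ c ∈ Finset.Ico 1 q, ‖β c‖ ^ 2 * ((c:ℝ) ^ 2 + M) ≤ L * (K1 ^ 2 * ρ ^ 2 * (u⁻¹ ^ 2 + M)) := by
    calc _ ≤ ∑ c ∈ Finset.Ico 1 q, (c:ℝ)⁻¹ * (K1 ^ 2 * ρ ^ 2 * (u⁻¹ ^ 2 + M)) := by
          refine Finset.sum_le_sum fun c hc => ?_
          have hc' := (Finset.mem_Ico.mp hc).1
          have hc0 : (0:ℝ) < c := by exact_mod_cast hc'
          have := mel_weight K σ hσ F hF M c hc' u hu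
          simp only [hβ]
          rw [norm_mul, Complex.norm_real, Real.norm_of_nonneg (by positivity), mul_pow]
          have hci : ((c:ℝ) ^ (-(1:ℝ)/2)) ^ 2 = (c:ℝ)⁻¹ := by
            rw [← Real.rpow_natCast, ← Real.rpow_mul hc0.le, ← Real.rpow_neg_one]; norm_num
          rw [hci, mul_assoc]
          gcongr
      _ = (∑ c ∈ Finset.Ico 1 q, (c:ℝ)⁻¹) * (K1 ^ 2 * ρ ^ 2 * (u⁻¹ ^ 2 + M)) := by
          rw [Finset.sum_mul]
      _ ≤ _ := by
          have := sum_inv_le q hq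
          gcongr
  set S := ‖∑ c ∈ Finset.Ico 1 q, β c * ∑ m ∈ I, α m * lamS m h c‖
  have hS : S ^ 2 ≤ 800 * L * (L * (K1 ^ 2 * ρ ^ 2 * (u⁻¹ ^ 2 + M))) *
      (M * (X * w⁻¹ ^ j * (KJ * ψ)) ^ 2) := by
    refine hbil.trans ?_
    gcongr
  have hsc := scalar_z z hz0 j hj
  have hz1 : z⁻¹ = u⁻¹ * w⁻¹ := by rw [hz, mul_inv]
  refine (pow_le_pow_iff_left₀ (by positivity) (by positivity) (two_ne_zero)).mp ?_
  calc (P * u⁻¹ ^ j * S) ^ 2 = (P * u⁻¹ ^ j) ^ 2 * S ^ 2 := by ring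
    _ ≤ (P * u⁻¹ ^ j) ^ 2 * (800 * L * (L * (K1 ^ 2 * ρ ^ 2 * (u⁻¹ ^ 2 + M))) *
      (M * (X * w⁻¹ ^ j * (KJ * ψ)) ^ 2)) := by gcongr
    _ = 800 * L ^ 2 * K1 ^ 2 * KJ ^ 2 * X ^ 2 * M ^ 2 * P ^ 2 * ρ ^ 2 *
        ((z⁻¹ ^ j) ^ 2 * (z⁻¹ ^ 2 + 1) * ψ ^ 2) := by
        rw [hz1, ← hw2, mul_pow (u⁻¹) (w⁻¹) j]
        field_simp
    _ ≤ 800 * L ^ 2 * K1 ^ 2 * KJ ^ 2 * X ^ 2 * M ^ 2 * P ^ 2 * ρ ^ 2 * (2 * μ ^ 2) := by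
        gcongr
    _ = (40 * |K1| * KJ * L * X * M * (P * ρ) * μ) ^ 2 := by
        rw [← sq_abs K1]; ring

end PartF2

section PartF3
open MeasureTheory Filter FourierTransform

noncomputable def F1c (F : ℂ → ℂ) (s : ℂ) : ℂ := (((-(1:ℝ)/2 : ℝ) : ℂ) - s) * F s
noncomputable def F2c (F : ℂ → ℂ) (s : ℂ) : ℂ := (((-(1:ℝ)/2 - 1 : ℝ) : ℂ) - s) * F1c F s

noncomputable def fz (F : ℂ → ℂ) (n : ℕ) (c b u : ℝ) : ℂ := atom (-(1:ℝ)/2) F (n+2) c b u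
noncomputable def fo (F : ℂ → ℂ) (n : ℕ) (c b u : ℝ) : ℂ :=
  atom (-(1:ℝ)/2 - 1) (F1c F) (n+2) c b u +
    (b/2 : ℝ) * (atom (-(1:ℝ)/2) F (n+1) c b u - atom (-(1:ℝ)/2) F (n+3) c b u)
noncomputable def ft (F : ℂ → ℂ) (n : ℕ) (c b u : ℝ) : ℂ :=
  atom (-(1:ℝ)/2 - 2) (F2c F) (n+2) c b u +
    (b : ℝ) * (atom (-(1:ℝ)/2 - 1) (F1c F) (n+1) c b u - atom (-(1:ℝ)/2 - 1) (F1c F) (n+3) c b u)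
    + (b^2/4 : ℝ) * (atom (-(1:ℝ)/2) F n c b u - 2 * atom (-(1:ℝ)/2) F (n+2) c b u
      + atom (-(1:ℝ)/2) F (n+4) c b u)

lemma F1c_cls {K : ℝ → ℝ → ℝ} {F : ℂ → ℂ} (h : Cls 4 K F) :
    Cls 3 (fun a b => (|(-(1:ℝ)/2)| + |b| + 1) * K a b) (F1c F) := h.mulSub (-(1:ℝ)/2)

lemma F2c_cls {K : ℝ → ℝ → ℝ} {F : ℂ → ℂ} (h : Cls 4 K F) :
    Cls 2 (fun a b => (|(-(1:ℝ)/2 - 1)| + |b| + 1) * ((|(-(1:ℝ)/2)| + |b| + 1) * K a b)) (F2c F) :=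
  (F1c_cls h).mulSub (-(1:ℝ)/2 - 1)

lemma good_fz {K : ℝ → ℝ → ℝ} {F : ℂ → ℂ} (h : Cls 4 K F) (n : ℕ) (hn : 5 ≤ n) (c b : ℝ)
    (hc : 0 < c) (hb : 0 < b) : Good (fz F n c b) (fo F n c b) (ft F n c b) := by
  have h1 := F1c_cls h
  have h2 := F2c_cls h
  refine ⟨fun u => ?_, fun u => ?_, fun u hu => ?_, ?_⟩
  · exact atom_deriv (N := 3) h (by norm_num) (-(1:ℝ)/2) (by norm_num) (by norm_num) (n+1) (by omega)
      c b hc hb u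
  · have d0 := atom_deriv (N := 2) h1 (by norm_num) (-(1:ℝ)/2 - 1) (by norm_num) (by norm_num) (n+1)
      (by omega) c b hc hb u
    have d1 := atom_deriv (N := 3) h (by norm_num) (-(1:ℝ)/2) (by norm_num) (by norm_num) n
      (by omega) c b hc hb u
    have d2 := atom_deriv (N := 3) h (by norm_num) (-(1:ℝ)/2) (by norm_num) (by norm_num) (n+2)
      (by omega) c b hc hb u
    have := d0.fun_add ((d1.fun_sub d2).const_mul (((b/2 : ℝ)) : ℂ))
    refine HasDerivAt.congr_deriv (f := fo F n c b) this ?_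
    have e2 : (fun s => (((-(1:ℝ)/2 - 1 : ℝ) : ℂ) - s) * F1c F s) = F2c F := rfl
    have e1 : (fun s => (((-(1:ℝ)/2 : ℝ) : ℂ) - s) * F s) = F1c F := rfl
    have e3 : (-(1:ℝ)/2 - 1 - 1) = -(1:ℝ)/2 - 2 := by ring
    rw [e2, e1, e3, ft]
    push_cast
    ring
  · rw [fz, atom, if_neg (not_lt.mpr hu)]
  · obtain ⟨A0, p0, b0⟩ := atom_bound h (by norm_num) (-(1:ℝ)/2) (by norm_num) (by norm_num) n (by omega) c b hc hb
    obtain ⟨A1, p1, b1⟩ := atom_bound h (by norm_num) (-(1:ℝ)/2) (by norm_num) (by norm_num) (n+1) (by omega) c b hc hb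
    obtain ⟨A2, p2, b2⟩ := atom_bound h (by norm_num) (-(1:ℝ)/2) (by norm_num) (by norm_num) (n+2) (by omega) c b hc hb
    obtain ⟨A3, p3, b3⟩ := atom_bound h (by norm_num) (-(1:ℝ)/2) (by norm_num) (by norm_num) (n+3) (by omega) c b hc hb
    obtain ⟨A4, p4, b4⟩ := atom_bound h (by norm_num) (-(1:ℝ)/2) (by norm_num) (by norm_num) (n+4) (by omega) c b hc hb
    obtain ⟨B1, q1, c1⟩ := atom_bound h1 (by norm_num) (-(1:ℝ)/2-1) (by norm_num) (by norm_num) (n+1) (by omega) c b hc hb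
    obtain ⟨B2, q2, c2⟩ := atom_bound h1 (by norm_num) (-(1:ℝ)/2-1) (by norm_num) (by norm_num) (n+2) (by omega) c b hc hb
    obtain ⟨B3, q3, c3⟩ := atom_bound h1 (by norm_num) (-(1:ℝ)/2-1) (by norm_num) (by norm_num) (n+3) (by omega) c b hc hb
    obtain ⟨D, q4, c4⟩ := atom_bound h2 (by norm_num) (-(1:ℝ)/2-2) (by norm_num) (by norm_num) (n+2) (by omega) c b hc hb
    have bb : 0 ≤ b/2 := by positivity
    have bb2 : 0 ≤ b^2/4 := by positivity
    refine ⟨A2 + (B2 + b/2 * (A1 + A3)) + (D + b * (B1 + B3) + b^2/4 * (A0 + 2 * A2 + A4)), by positivity, fun u => ?_⟩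
    have hv : 0 ≤ (1+u^2)⁻¹ := by positivity
    have x0 : ‖fz F n c b u‖ ≤ A2 * (1+u^2)⁻¹ := (b2 u).2
    have x1 : ‖fo F n c b u‖ ≤ (B2 + b/2 * (A1 + A3)) * (1+u^2)⁻¹ := by
      rw [fo]
      refine (norm_add_le _ _).trans ?_
      rw [norm_mul, Complex.norm_real, Real.norm_of_nonneg bb]
      have := norm_sub_le (atom (-(1:ℝ)/2) F (n+1) c b u) (atom (-(1:ℝ)/2) F (n+3) c b u)
      have h1 := (b1 u).2
      have h3 := (b3 u).2
      have h4 := (c2 u).2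
      calc _ ≤ B2 * (1+u^2)⁻¹ + b/2 * (A1 * (1+u^2)⁻¹ + A3 * (1+u^2)⁻¹) := by gcongr; linarith
        _ = _ := by ring
    have x2 : ‖ft F n c b u‖ ≤ (D + b * (B1 + B3) + b^2/4 * (A0 + 2 * A2 + A4)) * (1+u^2)⁻¹ := by
      rw [ft]
      refine (norm_add₃_le).trans ?_
      rw [norm_mul, norm_mul, Complex.norm_real, Complex.norm_real, Real.norm_of_nonneg bb2, Real.norm_of_nonneg hb.le]
      have t1 := norm_sub_le (atom (-(1:ℝ)/2-1) (F1c F) (n+1) c b u) (atom (-(1:ℝ)/2-1) (F1c F) (n+3) c b u)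
      have t2 := norm_add_le (atom (-(1:ℝ)/2) F n c b u - 2 * atom (-(1:ℝ)/2) F (n+2) c b u) (atom (-(1:ℝ)/2) F (n+4) c b u)
      have t3 := norm_sub_le (atom (-(1:ℝ)/2) F n c b u) (2 * atom (-(1:ℝ)/2) F (n+2) c b u)
      rw [norm_mul] at t3
      have t4 : ‖(2:ℂ)‖ = 2 := by norm_num
      rw [t4] at t3
      have h0 := (b0 u).2
      have h2 := (b2 u).2
      have h4 := (b4 u).2
      have g1 := (c1 u).2
      have g3 := (c3 u).2
      have g4 := (c4 u).2
      calc _ ≤ D * (1+u^2)⁻¹ + b * (B1 * (1+u^2)⁻¹ + B3 * (1+u^2)⁻¹) +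
            b^2/4 * (A0 * (1+u^2)⁻¹ + 2 * (A2 * (1+u^2)⁻¹) + A4 * (1+u^2)⁻¹) := by gcongr <;> linarith
        _ = _ := by ring
    have y0 : 0 ≤ A2 * (1+u^2)⁻¹ := by positivity
    have y1 : 0 ≤ (B2 + b/2 * (A1 + A3)) * (1+u^2)⁻¹ := by positivity
    have y2 : 0 ≤ (D + b * (B1 + B3) + b^2/4 * (A0 + 2 * A2 + A4)) * (1+u^2)⁻¹ := by positivity
    refine ⟨?_, ?_, ?_⟩ <;> rw [add_mul, add_mul] <;> linarith

/-- pointwise block bound -/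
lemma pointwise_block (K : ℝ → ℝ → ℝ) (σ : ℝ) (hσ : 0 < σ) (n : ℕ) (hn : 5 ≤ n) :
    ∃ K' : ℝ, 0 ≤ K' ∧ ∀ F, Cls 4 K F → ∀ (M q : ℕ), 1 ≤ M → 1 ≤ q →
      ∀ (Y : ℕ → ℂ) (X : ℝ), 0 ≤ X → (∀ m ∈ Finset.Ico M (2*M), ‖Y m‖ ≤ X) →
      ∀ (h : ℤ) (u : ℝ), 0 < u →
      ‖∑ c ∈ Finset.Ico 1 q, ∑ m ∈ Finset.Ico M (2*M), (((c:ℝ)^(-(1:ℝ)/2):ℝ):ℂ) * Y m * lamS m h c *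
        (fz F n c (4*Real.pi*Real.sqrt m) u - ((M:ℝ)⁻¹:ℝ) * ft F n c (4*Real.pi*Real.sqrt m) u)‖ ≤
        K' * (1+Real.log q) * X * M * (u^(-(1:ℝ)/2)*u^(-σ)) * min 1 ((u*Real.sqrt M)^(-(1:ℝ)/2)) := by
  obtain ⟨A0, p0, b0⟩ := atom_sum_bound K σ hσ n hn
  obtain ⟨A2, p2, b2⟩ := atom_sum_bound K σ hσ (n+2) (by omega)
  obtain ⟨A4, p4, b4⟩ := atom_sum_bound K σ hσ (n+4) (by omega)
  obtain ⟨B1, q1, c1⟩ := atom_sum_bound (fun a b => (|(-(1:ℝ)/2)| + |b| + 1) * K a b) σ hσ (n+1) (by omega)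
  obtain ⟨B3, q3, c3⟩ := atom_sum_bound (fun a b => (|(-(1:ℝ)/2)| + |b| + 1) * K a b) σ hσ (n+3) (by omega)
  obtain ⟨D, q4, c4⟩ := atom_sum_bound (fun a b => (|(-(1:ℝ)/2 - 1)| + |b| + 1) * ((|(-(1:ℝ)/2)| + |b| + 1) * K a b)) σ hσ (n+2) (by omega)
  refine ⟨100 * (A2 + D + B1 + B3 + A0 + 2 * A2 + A4), by positivity, ?_⟩
  intro F hF M q hM hq Y X hX hY h u hu
  have hF0 := hF.weaken (show 2 ≤ 4 by norm_num)
  have hF1 := (F1c_cls hF).weaken (show 2 ≤ 3 by norm_num)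
  have hF2 := F2c_cls hF
  have hM' : (1:ℝ) ≤ M := by exact_mod_cast hM
  have hM0 : (0:ℝ) < M := by linarith
  have hsq : Real.sqrt M * Real.sqrt M = M := Real.mul_self_sqrt hM0.le
  have hs0 : 0 < Real.sqrt M := Real.sqrt_pos.mpr hM0
  have hp := Real.pi_pos
  have hp4 := Real.pi_lt_d2
  have hX' : 0 ≤ 100 * X := by positivity
  have hb : ∀ m ∈ Finset.Ico M (2*M), 4 * Real.pi * Real.sqrt m ≤ 8 * Real.pi * Real.sqrt M := by
    intro m hm
    have hm' := Finset.mem_Ico.mp hm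
    have : Real.sqrt m ≤ 2 * Real.sqrt M := by
      rw [Real.sqrt_le_left (by positivity), mul_pow, Real.sq_sqrt hM0.le]
      have : (m:ℝ) ≤ 2 * M := by exact_mod_cast hm'.2.le
      linarith
    nlinarith
  -- coefficient bounds
  have k0 : ∀ m ∈ Finset.Ico M (2*M), ‖Y m‖ ≤ (100 * X) * (Real.sqrt M)⁻¹ ^ 0 := by
    intro m hm; have := hY m hm; simp; linarith
  have k2 : ∀ m ∈ Finset.Ico M (2*M), ‖Y m * (((M:ℝ)⁻¹ : ℝ):ℂ)‖ ≤ (100 * X) * (Real.sqrt M)⁻¹ ^ 2 := by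
    intro m hm; have := hY m hm
    rw [norm_mul, Complex.norm_real, Real.norm_of_nonneg (by positivity), inv_pow, Real.sq_sqrt hM0.le]
    gcongr; linarith
  have k1 : ∀ m ∈ Finset.Ico M (2*M), ‖Y m * (((M:ℝ)⁻¹ * (4 * Real.pi * Real.sqrt m) : ℝ):ℂ)‖ ≤ (100 * X) * (Real.sqrt M)⁻¹ ^ 1 := by
    intro m hm; have := hY m hm
    have h1 := hb m hm
    rw [norm_mul, Complex.norm_real, Real.norm_of_nonneg (by positivity), pow_one]
    calc _ ≤ X * ((M:ℝ)⁻¹ * (8 * Real.pi * Real.sqrt M)) := by gcongr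
      _ = X * (8 * Real.pi) * (Real.sqrt M)⁻¹ := by
        have hi : (M:ℝ)⁻¹ * Real.sqrt M = (Real.sqrt M)⁻¹ :=
          eq_inv_of_mul_eq_one_left (by rw [mul_assoc, hsq, inv_mul_cancel₀ hM0.ne'])
        rw [← hi]; ring
      _ ≤ _ := by
        have : X * (8 * Real.pi) ≤ 100 * X := by nlinarith
        gcongr
  have k0' : ∀ m ∈ Finset.Ico M (2*M), ‖Y m * (((M:ℝ)⁻¹ * ((4 * Real.pi * Real.sqrt m)^2/4) : ℝ):ℂ)‖ ≤ (100 * X) * (Real.sqrt M)⁻¹ ^ 0 := by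
    intro m hm; have := hY m hm
    have hm' := Finset.mem_Ico.mp hm
    have hm2 : (m:ℝ) ≤ 2 * M := by exact_mod_cast hm'.2.le
    rw [norm_mul, Complex.norm_real, Real.norm_of_nonneg (by positivity), pow_zero, mul_one]
    have e : (M:ℝ)⁻¹ * ((4 * Real.pi * Real.sqrt m)^2/4) ≤ 100 := by
      rw [mul_pow, Real.sq_sqrt (by positivity)]
      rw [inv_mul_le_iff₀ hM0]
      have : Real.pi ^ 2 ≤ 10 := by nlinarith
      calc (4 * Real.pi)^2 * (m:ℝ) / 4 = 4 * (Real.pi^2 * m) := by ring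
        _ ≤ 4 * (10 * (2 * (M:ℝ))) := by gcongr
        _ ≤ _ := by linarith
    calc _ ≤ X * 100 := by gcongr
      _ = _ := by ring
  set b : ℕ → ℝ := fun m => 4 * Real.pi * Real.sqrt m with hbdef
  have r2 := b2 F hF0 M q hM hq 0 (by norm_num) _ _ hX' k0 h u hu
  have s0 := b0 F hF0 M q hM hq 0 (by norm_num) _ _ hX' k0' h u hu
  have s2 := b2 F hF0 M q hM hq 0 (by norm_num) _ _ hX' k0' h u hu
  have s4 := b4 F hF0 M q hM hq 0 (by norm_num) _ _ hX' k0' h u hu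
  have t1 := c1 (F1c F) hF1 M q hM hq 1 (by norm_num) _ _ hX' k1 h u hu
  have t3 := c3 (F1c F) hF1 M q hM hq 1 (by norm_num) _ _ hX' k1 h u hu
  have w2 := c4 (F2c F) hF2 M q hM hq 2 (by norm_num) _ _ hX' k2 h u hu
  have z0 : (-(1:ℝ)/2 - ((0:ℕ):ℝ)) = -(1:ℝ)/2 := by norm_num
  have z1 : (-(1:ℝ)/2 - ((1:ℕ):ℝ)) = -(1:ℝ)/2 - 1 := by norm_num
  have z2 : (-(1:ℝ)/2 - ((2:ℕ):ℝ)) = -(1:ℝ)/2 - 2 := by norm_num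
  rw [z0] at r2 s0 s2 s4
  rw [z1] at t1 t3
  rw [z2] at w2
  set R2 := ∑ c ∈ Finset.Ico 1 q, ∑ m ∈ Finset.Ico M (2*M), (((c:ℝ)^(-(1:ℝ)/2):ℝ):ℂ) * Y m * lamS m h c * atom (-(1:ℝ)/2) F (n+2) c (4*Real.pi*Real.sqrt m) u with hR2
  set S0 := ∑ c ∈ Finset.Ico 1 q, ∑ m ∈ Finset.Ico M (2*M), (((c:ℝ)^(-(1:ℝ)/2):ℝ):ℂ) * (Y m * (((M:ℝ)⁻¹ * ((4 * Real.pi * Real.sqrt m)^2/4) : ℝ):ℂ)) * lamS m h c * atom (-(1:ℝ)/2) F n c (4*Real.pi*Real.sqrt m) u with hS0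
  set S2 := ∑ c ∈ Finset.Ico 1 q, ∑ m ∈ Finset.Ico M (2*M), (((c:ℝ)^(-(1:ℝ)/2):ℝ):ℂ) * (Y m * (((M:ℝ)⁻¹ * ((4 * Real.pi * Real.sqrt m)^2/4) : ℝ):ℂ)) * lamS m h c * atom (-(1:ℝ)/2) F (n+2) c (4*Real.pi*Real.sqrt m) u with hS2
  set S4 := ∑ c ∈ Finset.Ico 1 q, ∑ m ∈ Finset.Ico M (2*M), (((c:ℝ)^(-(1:ℝ)/2):ℝ):ℂ) * (Y m * (((M:ℝ)⁻¹ * ((4 * Real.pi * Real.sqrt m)^2/4) : ℝ):ℂ)) * lamS m h c * atom (-(1:ℝ)/2) F (n+4) c (4*Real.pi*Real.sqrt m) u with hS4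
  set T1 := ∑ c ∈ Finset.Ico 1 q, ∑ m ∈ Finset.Ico M (2*M), (((c:ℝ)^(-(1:ℝ)/2):ℝ):ℂ) * (Y m * (((M:ℝ)⁻¹ * (4 * Real.pi * Real.sqrt m) : ℝ):ℂ)) * lamS m h c * atom (-(1:ℝ)/2-1) (F1c F) (n+1) c (4*Real.pi*Real.sqrt m) u with hT1
  set T3 := ∑ c ∈ Finset.Ico 1 q, ∑ m ∈ Finset.Ico M (2*M), (((c:ℝ)^(-(1:ℝ)/2):ℝ):ℂ) * (Y m * (((M:ℝ)⁻¹ * (4 * Real.pi * Real.sqrt m) : ℝ):ℂ)) * lamS m h c * atom (-(1:ℝ)/2-1) (F1c F) (n+3) c (4*Real.pi*Real.sqrt m) u with hT3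
  set W2 := ∑ c ∈ Finset.Ico 1 q, ∑ m ∈ Finset.Ico M (2*M), (((c:ℝ)^(-(1:ℝ)/2):ℝ):ℂ) * (Y m * (((M:ℝ)⁻¹ : ℝ):ℂ)) * lamS m h c * atom (-(1:ℝ)/2-2) (F2c F) (n+2) c (4*Real.pi*Real.sqrt m) u with hW2
  have e : ∑ c ∈ Finset.Ico 1 q, ∑ m ∈ Finset.Ico M (2*M), (((c:ℝ)^(-(1:ℝ)/2):ℝ):ℂ) * Y m * lamS m h c *
        (fz F n c (4*Real.pi*Real.sqrt m) u - ((M:ℝ)⁻¹:ℝ) * ft F n c (4*Real.pi*Real.sqrt m) u) =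
      R2 - W2 - T1 + T3 - S0 + 2 * S2 - S4 := by
    rw [hR2, hS0, hS2, hS4, hT1, hT3, hW2]
    simp only [Finset.mul_sum]
    simp only [← Finset.sum_sub_distrib, ← Finset.sum_add_distrib]
    refine Finset.sum_congr rfl fun c _ => Finset.sum_congr rfl fun m _ => ?_
    rw [fz, ft]
    push_cast
    ring
  rw [e]
  set Q := (1+Real.log q) * X * M * (u^(-(1:ℝ)/2)*u^(-σ)) * min 1 ((u*Real.sqrt M)^(-(1:ℝ)/2)) with hQ
  have n1 : ‖R2 - W2 - T1 + T3 - S0 + 2 * S2 - S4‖ ≤ ‖R2‖ + ‖W2‖ + ‖T1‖ + ‖T3‖ + ‖S0‖ + 2 * ‖S2‖ + ‖S4‖ := by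
    have a1 := norm_sub_le (R2 - W2 - T1 + T3 - S0 + 2 * S2) S4
    have a2 := norm_add_le (R2 - W2 - T1 + T3 - S0) (2 * S2)
    have a3 := norm_sub_le (R2 - W2 - T1 + T3) S0
    have a4 := norm_add_le (R2 - W2 - T1) T3
    have a5 := norm_sub_le (R2 - W2) T1
    have a6 := norm_sub_le R2 W2
    rw [norm_mul, show ‖(2:ℂ)‖ = 2 by norm_num] at a2
    linarith
  refine n1.trans ?_
  have v : ∀ A : ℝ, A * (1+Real.log q) * (100 * X) * M * (u^(-(1:ℝ)/2)*u^(-σ)) * min 1 ((u*Real.sqrt M)^(-(1:ℝ)/2)) = 100 * A * Q := by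
    intro A; rw [hQ]; ring
  rw [v] at r2 s0 s2 s4 t1 t3 w2
  calc _ ≤ 100 * A2 * Q + 100 * D * Q + 100 * B1 * Q + 100 * B3 * Q + 100 * A0 * Q + 2 * (100 * A2 * Q) + 100 * A4 * Q := by linarith
    _ = _ := by rw [hQ]; ring

end PartF3

section PartF4
open MeasureTheory Filter FourierTransform

lemma lamS_triv (m h : ℤ) (r : ℕ) : ‖lamS m h r‖ ≤ r := by
  rcases Nat.eq_zero_or_pos r with rfl | hr
  · simp [lamS]
  have hr' : (0:ℝ) < r := by exact_mod_cast hr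
  unfold lamS
  rw [norm_mul, norm_div, norm_one, Complex.norm_natCast, one_div, inv_mul_le_iff₀ hr']
  refine (norm_sum_le _ _).trans ?_
  have h1 : ∀ x ∈ (Finset.range r).filter (fun x => Nat.Coprime x r),
      ‖∑ a ∈ Finset.range r, eF ((((x : ℤ) * ((a : ℤ) ^ 2 + h * a + m) : ℤ) : ℝ) / r)‖ ≤ r := by
    intro x _
    refine (norm_sum_le _ _).trans ?_
    simp [eF_norm]
  refine (Finset.sum_le_sum h1).trans ?_
  rw [Finset.sum_const, nsmul_eq_mul]
  have := (Finset.card_filter_le (Finset.range r) (fun x => Nat.Coprime x r))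
  rw [Finset.card_range] at this
  gcongr

noncomputable def Phi (σ z : ℝ) : ℝ :=
  Set.indicator (Set.Ioi 0) (fun z => z ^ (-(1:ℝ)/2 - σ) * min 1 (z ^ (-(1:ℝ)/2))) z

lemma Phi_integrable (σ : ℝ) (h0 : 0 < σ) (h1 : σ < 1/2) : Integrable (Phi σ) := by
  unfold Phi
  change Integrable (Set.indicator (Set.Ioi 0) (fun z : ℝ => z ^ (-(1:ℝ)/2 - σ) * min 1 (z ^ (-(1:ℝ)/2))))
  rw [integrable_indicator_iff measurableSet_Ioi, ← Set.Ioc_union_Ioi_eq_Ioi (zero_le_one (α := ℝ))]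
  have hm : Measurable (fun z : ℝ => z ^ (-(1:ℝ)/2 - σ) * min 1 (z ^ (-(1:ℝ)/2))) := by fun_prop
  refine IntegrableOn.union ?_ ?_
  · have hi : IntegrableOn (fun z : ℝ => z ^ (-(1:ℝ)/2 - σ)) (Set.Ioc 0 1) := by
      have := intervalIntegral.intervalIntegrable_rpow' (a := 0) (b := 1) (r := -(1:ℝ)/2 - σ) (by linarith)
      rwa [intervalIntegrable_iff_integrableOn_Ioc_of_le zero_le_one] at this
    refine hi.mono' hm.aestronglyMeasurable ?_
    refine (ae_restrict_iff' measurableSet_Ioc).mpr (Eventually.of_forall fun z hz => ?_)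
    have hz0 := hz.1
    rw [Real.norm_of_nonneg (by positivity)]
    exact mul_le_of_le_one_right (by positivity) (min_le_left _ _)
  · have hi : IntegrableOn (fun z : ℝ => z ^ (-1 - σ)) (Set.Ioi 1) :=
      integrableOn_Ioi_rpow_of_lt (by linarith) one_pos
    refine hi.mono' hm.aestronglyMeasurable ?_
    refine (ae_restrict_iff' measurableSet_Ioi).mpr (Eventually.of_forall fun z hz => ?_)
    have hz0 : 0 < z := one_pos.trans hz
    rw [Real.norm_of_nonneg (by positivity)]
    calc _ ≤ z ^ (-(1:ℝ)/2 - σ) * z ^ (-(1:ℝ)/2) := by gcongr; exact min_le_right _ _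
      _ = _ := by rw [← Real.rpow_add hz0]; congr 1; ring

lemma Phi_nonneg (σ z : ℝ) : 0 ≤ Phi σ z := by
  unfold Phi
  refine Set.indicator_nonneg (fun z hz => ?_) z
  have : (0:ℝ) < z := hz
  positivity

lemma Phi_scale (σ : ℝ) (M : ℕ) (hM : 1 ≤ M) (u : ℝ) (hu : 0 < u) :
    (u^(-(1:ℝ)/2)*u^(-σ)) * min 1 ((u*Real.sqrt M)^(-(1:ℝ)/2)) =
      (M:ℝ)^(1/4 + σ/2) * Phi σ (u * Real.sqrt M) := by
  have hM0 : (0:ℝ) < M := by exact_mod_cast hM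
  have hs : 0 < Real.sqrt M := Real.sqrt_pos.mpr hM0
  rw [Phi, Set.indicator_of_mem (show u * Real.sqrt M ∈ Set.Ioi 0 from mul_pos hu hs), ← mul_assoc]
  congr 1
  rw [Real.mul_rpow hu.le hs.le, ← Real.rpow_add hu, Real.sqrt_eq_rpow, ← Real.rpow_mul hM0.le]
  rw [mul_left_comm, ← Real.rpow_add hM0]
  rw [show (1 / 4 + σ / 2 + 1 / 2 * (-1 / 2 - σ)) = 0 by ring, Real.rpow_zero, mul_one]
  congr 1

lemma sum_w (M : ℕ) (hM : 1 ≤ M) :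
    Summable (fun h : ℤ => (1 + (2 * Real.pi * h) ^ 2 / (M:ℝ))⁻¹) ∧
    ∑' h : ℤ, (1 + (2 * Real.pi * h) ^ 2 / (M:ℝ))⁻¹ ≤ 5 * Real.sqrt M := by
  have hM1 : (1:ℝ) ≤ M := by exact_mod_cast hM
  have hM0 : (0:ℝ) < M := by linarith
  have hs : 1 ≤ Real.sqrt M := by rw [Real.one_le_sqrt]; exact hM1
  have hp := Real.pi_gt_three
  have hp' := Real.pi_lt_d2
  set w := Real.sqrt M with hw
  have hwM : w ^ 2 = M := Real.sq_sqrt hM0.le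
  set g : ℝ → ℝ := fun x => (1 + (x / w) ^ 2)⁻¹ with hg
  have hanti : ∀ N : ℕ, AntitoneOn g (Set.Icc 0 (0 + (N:ℝ))) := by
    intro N x hx y hy hxy
    simp only [hg]
    have := hx.1
    gcongr
  have hpart : ∀ N : ℕ, ∑ i ∈ Finset.range N, g ((i + 1 : ℕ):ℝ) ≤ Real.pi / 2 * w := by
    intro N
    have h1 := (hanti N).sum_le_integral
    simp only [zero_add] at h1
    refine h1.trans ?_
    have h2 : ∫ x in (0:ℝ)..N, g x = w * Real.arctan (N / w) := by
      simp only [hg]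
      rw [intervalIntegral.integral_comp_div (fun x => (1 + x^2)⁻¹) (by linarith : w ≠ 0)]
      simp
    rw [h2, mul_comm]
    gcongr
    exact (Real.arctan_lt_pi_div_two _).le
  set f : ℤ → ℝ := fun h => (1 + (2 * Real.pi * h) ^ 2 / (M:ℝ))⁻¹ with hf
  have hf0 : ∀ h, 0 ≤ f h := fun h => by simp only [hf]; positivity
  have hfg : ∀ h : ℤ, f h ≤ g h := by
    intro h
    simp only [hf, hg]
    rw [div_pow, hwM]
    have h2 : (h:ℝ)^2 ≤ (2 * Real.pi * (h:ℝ))^2 := by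
      rw [mul_pow]
      have : 1 ≤ (2 * Real.pi)^2 := by nlinarith
      nlinarith [sq_nonneg (h:ℝ)]
    have h3 : (h:ℝ)^2 / M ≤ (2 * Real.pi * (h:ℝ))^2 / M := div_le_div_of_nonneg_right h2 hM0.le
    exact inv_anti₀ (by positivity) (by linarith)
  have hA : ∀ N : ℕ, ∑ i ∈ Finset.range N, f (-((i:ℤ)+1)) ≤ Real.pi / 2 * w := by
    intro N
    refine le_trans (Finset.sum_le_sum fun i _ => ?_) (hpart N)
    refine (hfg _).trans (le_of_eq ?_)
    simp only [hg]; push_cast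
    ring
  have hB : ∀ N : ℕ, ∑ i ∈ Finset.range N, f (i:ℤ) ≤ 1 + Real.pi / 2 * w := by
    intro N
    rcases N with _ | N
    · simp; positivity
    rw [Finset.sum_range_succ', add_comm]
    refine add_le_add ?_ ?_
    · simp [hf]
    · refine le_trans (Finset.sum_le_sum fun i _ => ?_) (hpart N)
      exact (hfg _).trans (le_of_eq (by simp))
  have sA : Summable (fun i : ℕ => f (-((i:ℤ)+1))) := summable_of_sum_range_le (fun i => hf0 _) hA
  have sB : Summable (fun i : ℕ => f (i:ℤ)) := summable_of_sum_range_le (fun i => hf0 _) hB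
  have hs2 := HasSum.of_nat_of_neg_add_one sB.hasSum sA.hasSum
  refine ⟨hs2.summable, ?_⟩
  rw [hs2.tsum_eq]
  have t1 := Real.tsum_le_of_sum_range_le (fun i => hf0 _) hA
  have t2 := Real.tsum_le_of_sum_range_le (fun i => hf0 _) hB
  nlinarith

/-- block bound for one frequency -/
lemma block_h (K : ℝ → ℝ → ℝ) (σ : ℝ) (hσ : 0 < σ) (hσ' : σ < 1/2) (n : ℕ) (hn : 5 ≤ n) :
    ∃ K' : ℝ, 0 ≤ K' ∧ ∀ F, Cls 4 K F → ∀ (M q : ℕ), 1 ≤ M → 1 ≤ q →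
      ∀ (Y : ℕ → ℂ) (X : ℝ), 0 ≤ X → (∀ m ∈ Finset.Ico M (2*M), ‖Y m‖ ≤ X) →
      ∀ (h : ℤ),
      ‖∑ c ∈ Finset.Ico 1 q, ∑ m ∈ Finset.Ico M (2*M), (((c:ℝ)^(-(1:ℝ)/2):ℝ):ℂ) * Y m * lamS m h c *
        𝓕 (fz F n c (4*Real.pi*Real.sqrt m)) (h:ℝ)‖ ≤
        K' * (1+Real.log q) * X * (M:ℝ) ^ (3/4 + σ/2) * (1 + (2 * Real.pi * h) ^ 2 / (M:ℝ))⁻¹ := by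
  obtain ⟨K0, hK0, hp⟩ := pointwise_block K σ hσ n hn
  have hPi := Phi_integrable σ hσ hσ'
  have hP0 : 0 ≤ ∫ z, Phi σ z := integral_nonneg (Phi_nonneg σ)
  refine ⟨K0 * ∫ z, Phi σ z, by positivity, ?_⟩
  intro F hF M q hM hq Y X hX hY h
  have hM0 : (0:ℝ) < M := by exact_mod_cast hM
  have hs : 0 < Real.sqrt M := Real.sqrt_pos.mpr hM0
  have hgood : ∀ c ∈ Finset.Ico 1 q, ∀ m ∈ Finset.Ico M (2*M),
      Good (fz F n c (4*Real.pi*Real.sqrt m)) (fo F n c (4*Real.pi*Real.sqrt m)) (ft F n c (4*Real.pi*Real.sqrt m)) := by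
    intro c hc m hm
    have hc0 : (0:ℝ) < c := by exact_mod_cast (Finset.mem_Ico.mp hc).1
    have hm0 : (0:ℝ) < m := by exact_mod_cast lt_of_lt_of_le hM (Finset.mem_Ico.mp hm).1
    have := Real.pi_pos
    have := Real.sqrt_pos.mpr hm0
    exact good_fz hF n hn c _ hc0 (by positivity)
  have e : ∑ c ∈ Finset.Ico 1 q, ∑ m ∈ Finset.Ico M (2*M), (((c:ℝ)^(-(1:ℝ)/2):ℝ):ℂ) * Y m * lamS m h c *
        𝓕 (fz F n c (4*Real.pi*Real.sqrt m)) (h:ℝ) =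
      ((1 + (2 * Real.pi * (h:ℝ)) ^ 2 / (M:ℝ))⁻¹ : ℝ) * ∫ u : ℝ, eF (-((h:ℝ)*u)) *
        ∑ c ∈ Finset.Ico 1 q, ∑ m ∈ Finset.Ico M (2*M), (((c:ℝ)^(-(1:ℝ)/2):ℝ):ℂ) * Y m * lamS m h c *
        (fz F n c (4*Real.pi*Real.sqrt m) u - ((M:ℝ)⁻¹:ℝ) * ft F n c (4*Real.pi*Real.sqrt m) u) := by
    have hIntg : ∀ c ∈ Finset.Ico 1 q, ∀ m ∈ Finset.Ico M (2*M),
        Integrable (fun u : ℝ => (((c:ℝ)^(-(1:ℝ)/2):ℝ):ℂ) * Y m * lamS m h c * (eF (-((h:ℝ)*u)) *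
        (fz F n c (4*Real.pi*Real.sqrt m) u - ((M:ℝ)⁻¹:ℝ) * ft F n c (4*Real.pi*Real.sqrt m) u))) := by
      intro c hc m hm
      apply Integrable.const_mul
      apply eF_mul_integrable
      exact (hgood c hc m hm).int0.sub ((hgood c hc m hm).int2.const_mul _)
    have e1 : ∀ u : ℝ, eF (-((h:ℝ)*u)) *
        ∑ c ∈ Finset.Ico 1 q, ∑ m ∈ Finset.Ico M (2*M), (((c:ℝ)^(-(1:ℝ)/2):ℝ):ℂ) * Y m * lamS m h c *
        (fz F n c (4*Real.pi*Real.sqrt m) u - ((M:ℝ)⁻¹:ℝ) * ft F n c (4*Real.pi*Real.sqrt m) u) =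
        ∑ c ∈ Finset.Ico 1 q, ∑ m ∈ Finset.Ico M (2*M), (((c:ℝ)^(-(1:ℝ)/2):ℝ):ℂ) * Y m * lamS m h c * (eF (-((h:ℝ)*u)) *
        (fz F n c (4*Real.pi*Real.sqrt m) u - ((M:ℝ)⁻¹:ℝ) * ft F n c (4*Real.pi*Real.sqrt m) u)) := by
      intro u
      simp only [Finset.mul_sum]
      refine Finset.sum_congr rfl fun c _ => Finset.sum_congr rfl fun m _ => ?_
      ring
    simp_rw [e1]
    rw [integral_finsetSum _ (fun c hc => integrable_finsetSum _ (fun m hm => hIntg c hc m hm)), Finset.mul_sum]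
    refine Finset.sum_congr rfl fun c hc => ?_
    rw [integral_finsetSum _ (fun m hm => hIntg c hc m hm), Finset.mul_sum]
    refine Finset.sum_congr rfl fun m hm => ?_
    rw [integral_const_mul, (hgood c hc m hm).fourier_B h M hM0]
    ring
  rw [e, norm_mul, Complex.norm_real, Real.norm_of_nonneg (by positivity), mul_comm]
  gcongr
  have hbi : Integrable (fun u : ℝ => K0 * (1+Real.log q) * X * M * ((M:ℝ)^(1/4 + σ/2) * Phi σ (u * Real.sqrt M))) := by
    apply Integrable.const_mul
    apply Integrable.const_mul
    exact hPi.comp_mul_right' hs.ne'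
  have hlog : 0 ≤ Real.log q := Real.log_natCast_nonneg q
  refine (norm_integral_le_of_norm_le hbi (Eventually.of_forall fun u => ?_)).trans (le_of_eq ?_)
  · rw [norm_mul, eF_norm, one_mul]
    rcases le_or_gt u 0 with hu | hu
    · have : ∑ c ∈ Finset.Ico 1 q, ∑ m ∈ Finset.Ico M (2*M), (((c:ℝ)^(-(1:ℝ)/2):ℝ):ℂ) * Y m * lamS m h c *
        (fz F n c (4*Real.pi*Real.sqrt m) u - ((M:ℝ)⁻¹:ℝ) * ft F n c (4*Real.pi*Real.sqrt m) u) = 0 := by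
        refine Finset.sum_eq_zero fun c _ => Finset.sum_eq_zero fun m _ => ?_
        simp [fz, ft, atom, not_lt.mpr hu]
      rw [this, norm_zero]
      have := Phi_nonneg σ (u * Real.sqrt M)
      positivity
    · refine (hp F hF M q hM hq Y X hX hY h u hu).trans (le_of_eq ?_)
      rw [← Phi_scale σ M hM u hu]
      ring
  · rw [integral_const_mul, integral_const_mul, Measure.integral_comp_mul_right (Phi σ), smul_eq_mul,
      abs_of_pos (inv_pos.mpr hs)]
    have : (M:ℝ) ^ (3/4 + σ/2) = M * (M:ℝ)^(1/4+σ/2) * (Real.sqrt M)⁻¹ := by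
      rw [Real.sqrt_eq_rpow, ← Real.rpow_neg hM0.le, ← Real.rpow_one_add' hM0.le (by positivity), ← Real.rpow_add hM0]
      congr 1; ring
    rw [this]; ring

/-- block bound -/
lemma block_bound (K : ℝ → ℝ → ℝ) (σ : ℝ) (hσ : 0 < σ) (hσ' : σ < 1/2) (n : ℕ) (hn : 5 ≤ n) :
    ∃ K' : ℝ, 0 ≤ K' ∧ ∀ F, Cls 4 K F → ∀ (M q : ℕ), 1 ≤ M → 1 ≤ q →
      ∀ (Y : ℕ → ℤ → ℂ) (X : ℝ), 0 ≤ X → (∀ m ∈ Finset.Ico M (2*M), ∀ h, ‖Y m h‖ ≤ X) →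
      ‖∑ c ∈ Finset.Ico 1 q, ∑ m ∈ Finset.Ico M (2*M), ∑' h : ℤ, (((c:ℝ)^(-(1:ℝ)/2):ℝ):ℂ) * Y m h * lamS m h c *
        𝓕 (fz F n c (4*Real.pi*Real.sqrt m)) (h:ℝ)‖ ≤
        K' * (1+Real.log q) * X * (M:ℝ) ^ (5/4 + σ/2) := by
  obtain ⟨K0, hK0, hp⟩ := block_h K σ hσ hσ' n hn
  refine ⟨K0 * 5, by positivity, ?_⟩
  intro F hF M q hM hq Y X hX hY
  have hM0 : (0:ℝ) < M := by exact_mod_cast hM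
  have hlog : 0 ≤ Real.log q := Real.log_natCast_nonneg q
  have hsum : ∀ c ∈ Finset.Ico 1 q, ∀ m ∈ Finset.Ico M (2*M), Summable (fun h : ℤ =>
      (((c:ℝ)^(-(1:ℝ)/2):ℝ):ℂ) * Y m h * lamS m h c * 𝓕 (fz F n c (4*Real.pi*Real.sqrt m)) (h:ℝ)) := by
    intro c hc m hm
    have hc0 : (0:ℝ) < c := by exact_mod_cast (Finset.mem_Ico.mp hc).1
    have hm0 : (0:ℝ) < m := by exact_mod_cast lt_of_lt_of_le hM (Finset.mem_Ico.mp hm).1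
    have := Real.pi_pos
    have := Real.sqrt_pos.mpr hm0
    have hg := good_fz hF n hn c (4*Real.pi*Real.sqrt m) hc0 (by positivity)
    refine Summable.of_norm_bounded (hg.summable_fourier.mul_left ((c:ℝ)^(-(1:ℝ)/2) * X * c)) fun h => ?_
    rw [norm_mul, norm_mul, norm_mul, Complex.norm_real, Real.norm_of_nonneg (by positivity)]
    have h1 := hY m hm h
    have h2 := lamS_triv m h c
    gcongr
  obtain ⟨sw, tw⟩ := sum_w M hM
  have e : ∑ c ∈ Finset.Ico 1 q, ∑ m ∈ Finset.Ico M (2*M), ∑' h : ℤ, (((c:ℝ)^(-(1:ℝ)/2):ℝ):ℂ) * Y m h * lamS m h c *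
        𝓕 (fz F n c (4*Real.pi*Real.sqrt m)) (h:ℝ) =
      ∑' h : ℤ, ∑ c ∈ Finset.Ico 1 q, ∑ m ∈ Finset.Ico M (2*M), (((c:ℝ)^(-(1:ℝ)/2):ℝ):ℂ) * Y m h * lamS m h c *
        𝓕 (fz F n c (4*Real.pi*Real.sqrt m)) (h:ℝ) := by
    rw [Summable.tsum_finsetSum (fun c hc => summable_sum (fun m hm => hsum c hc m hm))]
    refine Finset.sum_congr rfl fun c hc => ?_
    rw [Summable.tsum_finsetSum (fun m hm => hsum c hc m hm)]
  rw [e]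
  have hb := fun h : ℤ => hp F hF M q hM hq (fun m => Y m h) X hX (fun m hm => hY m hm h) h
  refine (tsum_of_norm_bounded (sw.mul_left (K0 * (1+Real.log q) * X * (M:ℝ) ^ (3/4 + σ/2))).hasSum hb).trans ?_
  rw [tsum_mul_left]
  have : (M:ℝ) ^ (5/4 + σ/2) = (M:ℝ)^(3/4+σ/2) * Real.sqrt M := by
    rw [Real.sqrt_eq_rpow, ← Real.rpow_add hM0]
    congr 1; ring
  rw [this]
  calc _ ≤ K0 * (1+Real.log q) * X * (M:ℝ) ^ (3/4 + σ/2) * (5 * Real.sqrt M) := by gcongr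
    _ = _ := by ring

end PartF4

section PartG
open MeasureTheory Filter FourierTransform

/-- the summand -/
noncomputable def tt (k q n m c : ℕ) : ℂ :=
  (((n : ℝ) ^ (-(1 : ℝ) / 2) : ℝ) : ℂ) * Vfun k q ((n : ℝ) / q) *
          (((m : ℝ) ^ (-(1 : ℝ) / 2) : ℝ) : ℂ) * Wfun k ((m : ℝ) / Real.sqrt q) *
          (kloos (m : ℤ) ((n : ℤ) ^ 2) (c * q) / ((c * q : ℕ) : ℂ)) *
          (besselJ (k - 1)
            (4 * Real.pi * (n : ℝ) * Real.sqrt (m : ℝ) /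
              ((c * q : ℕ) : ℝ)) : ℂ)

lemma tt_zero_n (k q m c : ℕ) : tt k q 0 m c = 0 := by
  have : ((0:ℕ):ℝ) ^ (-(1:ℝ)/2) = 0 := by rw [Nat.cast_zero, Real.zero_rpow (by norm_num)]
  simp only [tt, this]; simp
lemma tt_zero_m (k q n c : ℕ) : tt k q n 0 c = 0 := by
  have : ((0:ℕ):ℝ) ^ (-(1:ℝ)/2) = 0 := by rw [Nat.cast_zero, Real.zero_rpow (by norm_num)]
  simp only [tt, this]; simp
lemma tt_zero_c (k q n m : ℕ) : tt k q n m 0 = 0 := by simp [tt]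

lemma kloos_triv (m n : ℤ) (r : ℕ) : ‖kloos m n r‖ ≤ r := by
  unfold kloos
  refine (norm_sum_le _ _).trans ?_
  simp only [eF_norm, Finset.sum_const, nsmul_eq_mul, mul_one]
  have := (Finset.card_filter_le (Finset.range r) (fun x => Nat.Coprime x r))
  rw [Finset.card_range] at this
  exact_mod_cast this

lemma tt_bound (k : ℕ) (hk : 1000 < k) : ∃ C : ℝ, 0 ≤ C ∧ ∀ q : ℕ, 1 ≤ q → ∀ n m c : ℕ,
    ‖tt k q n m c‖ ≤ C * (q:ℝ)^(5/2:ℝ) * ((n:ℝ)^(-(3:ℝ)/2) * ((m:ℝ)^(-(3:ℝ)/2) * (c:ℝ)^(-4:ℝ))) := by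
  obtain ⟨KV, hV⟩ := FV_cls k hk
  obtain ⟨KW, hW⟩ := FW_cls k hk
  have hV0 := (hV 1 le_rfl).K_nonneg (a := 5) (b := 5) (by norm_num) le_rfl
  have hW0 := hW.K_nonneg (a := 3) (b := 3) (by norm_num) le_rfl
  refine ⟨KV 5 5 * KW 3 3 * (4 * Real.pi)^4, by positivity, ?_⟩
  intro q hq n m c
  rcases Nat.eq_zero_or_pos n with rfl | hn
  · rw [tt_zero_n, norm_zero]; positivity
  rcases Nat.eq_zero_or_pos m with rfl | hm
  · rw [tt_zero_m, norm_zero]; positivity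
  rcases Nat.eq_zero_or_pos c with rfl | hc
  · rw [tt_zero_c, norm_zero]; positivity
  have hq0 : (0:ℝ) < q := by exact_mod_cast hq
  have hn0 : (0:ℝ) < n := by exact_mod_cast hn
  have hm0 : (0:ℝ) < m := by exact_mod_cast hm
  have hc0 : (0:ℝ) < c := by exact_mod_cast hc
  have hsq : 0 < Real.sqrt q := Real.sqrt_pos.mpr hq0
  have hsm : 0 < Real.sqrt m := Real.sqrt_pos.mpr hm0
  have hp := Real.pi_pos
  have v := (hV q hq).Mel_bound' (by norm_num) (σ := 2) (σ' := 5) (y := (n:ℝ)/q) (by norm_num) (by norm_num) (by positivity)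
  rw [← Vfun_eq] at v
  have w := hW.Mel_bound' (by norm_num) (σ := 2) (σ' := 3) (y := (m:ℝ)/Real.sqrt q) (by norm_num) (by norm_num) (by positivity)
  rw [← Wfun_eq] at w
  have j := besselJ_abs_le_pow 4 (k-1) (4 * Real.pi * (n : ℝ) * Real.sqrt (m : ℝ) / ((c * q : ℕ) : ℝ)) (by omega)
  have hx : 0 ≤ 4 * Real.pi * (n : ℝ) * Real.sqrt (m : ℝ) / ((c * q : ℕ) : ℝ) := by positivity
  rw [abs_of_nonneg hx] at j
  have kl : ‖kloos (m : ℤ) ((n : ℤ) ^ 2) (c * q) / ((c * q : ℕ) : ℂ)‖ ≤ 1 := by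
    rw [norm_div, Complex.norm_natCast]
    exact div_le_one_of_le₀ (kloos_triv _ _ _) (by positivity)
  rw [tt, norm_mul, norm_mul, norm_mul, norm_mul, norm_mul, Complex.norm_real, Complex.norm_real, Complex.norm_real,
    Real.norm_of_nonneg (by positivity : 0 ≤ (n:ℝ)^(-(1:ℝ)/2)), Real.norm_of_nonneg (by positivity : 0 ≤ (m:ℝ)^(-(1:ℝ)/2)), Real.norm_eq_abs]
  calc _ ≤ (n:ℝ)^(-(1:ℝ)/2) * (KV 5 5 * ((n:ℝ)/q)^(-5:ℝ)) * (m:ℝ)^(-(1:ℝ)/2) * (KW 3 3 * ((m:ℝ)/Real.sqrt q)^(-3:ℝ)) * 1 *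
      (4 * Real.pi * (n : ℝ) * Real.sqrt (m : ℝ) / ((c * q : ℕ) : ℝ))^4 := by gcongr
    _ = _ := by
      rw [Real.div_rpow hn0.le hq0.le, Real.div_rpow hm0.le hsq.le, Real.sqrt_eq_rpow, Real.sqrt_eq_rpow,
        ← Real.rpow_mul hq0.le]
      push_cast
      have e1 : (4 * Real.pi * (n:ℝ) * (m:ℝ)^(1/2:ℝ) / (c * q))^4 =
          (4 * Real.pi)^4 * ((n:ℝ)^(4:ℝ) * (m:ℝ)^(2:ℝ) * (c:ℝ)^(-4:ℝ) * (q:ℝ)^(-4:ℝ)) := by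
        rw [Real.rpow_neg hc0.le, Real.rpow_neg hq0.le]
        have : (m:ℝ)^(2:ℝ) = ((m:ℝ)^(1/2:ℝ))^4 := by
          rw [← Real.rpow_natCast, ← Real.rpow_mul hm0.le]; norm_num
        rw [this]
        have h4 : ∀ x : ℝ, x^(4:ℝ) = x^4 := fun x => by exact_mod_cast Real.rpow_natCast x 4
        rw [h4, h4, h4]
        field_simp
      rw [e1]
      have en : (n:ℝ)^(-(3:ℝ)/2) = (n:ℝ)^(-(1:ℝ)/2) * (n:ℝ)^(-5:ℝ) * (n:ℝ)^(4:ℝ) := by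
        rw [← Real.rpow_add hn0, ← Real.rpow_add hn0]; norm_num
      have em : (m:ℝ)^(-(3:ℝ)/2) = (m:ℝ)^(-(1:ℝ)/2) * (m:ℝ)^(-3:ℝ) * (m:ℝ)^(2:ℝ) := by
        rw [← Real.rpow_add hm0, ← Real.rpow_add hm0]; norm_num
      have eq : (q:ℝ)^(5/2:ℝ) = ((q:ℝ)^(-5:ℝ))⁻¹ * ((q:ℝ)^(1/2*(-3):ℝ))⁻¹ * (q:ℝ)^(-4:ℝ) := by
        rw [← Real.rpow_neg hq0.le, ← Real.rpow_neg hq0.le, ← Real.rpow_add hq0, ← Real.rpow_add hq0]; norm_num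
      rw [en, em, eq]
      simp only [div_eq_mul_inv]
      ring

/-- evaluation of the inner sum by Poisson summation -/
lemma nsum_eval (k : ℕ) (hk : 1000 < k) (q : ℕ) (hq : q.Prime) (m c : ℕ) (hm : 1 ≤ m) (hc : 1 ≤ c)
    (hcq : c < q) :
    ∑' n : ℕ, tt k q n m c = ∑' h : ℤ, (((c:ℝ)^(-(1:ℝ)/2):ℝ):ℂ) *
      (((q:ℝ)^(-(1:ℝ)/2):ℝ) * ((m : ℝ) ^ (-(1 : ℝ) / 2) : ℝ) * Wfun k ((m : ℝ) / Real.sqrt q) * lamS m h q) * lamS m h c *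
        𝓕 (fz (FV k q) (k-3) c (4*Real.pi*Real.sqrt m)) (h:ℝ) := by
  obtain ⟨KV, hV⟩ := FV_cls k hk
  have hq1 : 1 ≤ q := hq.one_lt.le
  have hq0 : (0:ℝ) < q := by exact_mod_cast hq1
  have hm0 : (0:ℝ) < m := by exact_mod_cast hm
  have hc0 : (0:ℝ) < c := by exact_mod_cast hc
  have hsm : 0 < Real.sqrt m := Real.sqrt_pos.mpr hm0
  have hp := Real.pi_pos
  have hg := good_fz (hV q hq1) (k-3) (by omega) c (4*Real.pi*Real.sqrt m) hc0 (by positivity)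
  have : NeZero c := ⟨by omega⟩
  have : NeZero q := ⟨by omega⟩
  have : NeZero (c*q) := ⟨by positivity⟩
  have hpo := hg.poisson_kloos m (c*q)
  have hr0 : (0:ℝ) < ((c*q:ℕ):ℝ) := by push_cast; positivity
  have hcop : Nat.Coprime c q :=
    (Nat.Coprime.symm ((Nat.Prime.coprime_iff_not_dvd hq).mpr (fun hd => by have := Nat.le_of_dvd (by omega) hd; omega)))
  set A : ℂ := ((m : ℝ) ^ (-(1 : ℝ) / 2) : ℝ) * Wfun k ((m : ℝ) / Real.sqrt q) with hA
  have e1 : ∀ n : ℕ, tt k q n m c = (A * ((((c*q:ℕ):ℝ)^(-(1:ℝ)/2):ℝ):ℂ) * (((c*q:ℕ):ℂ))⁻¹) *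
      (kloos m ((n:ℤ)^2) (c*q) * fz (FV k q) (k-3) c (4*Real.pi*Real.sqrt m) ((n:ℝ) / (c*q:ℕ))) := by
    intro n
    rcases Nat.eq_zero_or_pos n with rfl | hn
    · rw [tt_zero_n, fz, atom, if_neg (by simp)]; simp
    have hn0 : (0:ℝ) < n := by exact_mod_cast hn
    rw [tt, fz, atom, if_pos (by positivity), show k - 3 + 2 = k - 1 by omega, ← Vfun_eq]
    have a1 : (c:ℝ) * ((n:ℝ) / (c*q:ℕ)) = (n:ℝ)/q := by push_cast; field_simp
    have a2 : 4*Real.pi*Real.sqrt m * ((n:ℝ) / (c*q:ℕ)) = 4 * Real.pi * (n : ℝ) * Real.sqrt (m : ℝ) / ((c * q : ℕ) : ℝ) := by ring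
    have a3 : (n:ℝ)^(-(1:ℝ)/2) = ((n:ℝ) / (c*q:ℕ))^(-(1:ℝ)/2) * ((c*q:ℕ):ℝ)^(-(1:ℝ)/2) := by
      rw [← Real.mul_rpow (by positivity) hr0.le, div_mul_cancel₀ _ hr0.ne']
    rw [a1, a2, a3, hA]
    rw [Complex.ofReal_mul]
    ring
  rw [tsum_congr e1, tsum_mul_left, hpo, ← mul_assoc, ← tsum_mul_left]
  refine tsum_congr fun h => ?_
  rw [lamS_mul m h c q hcop]
  have hne : ((c*q:ℕ):ℂ) ≠ 0 := by exact_mod_cast NeZero.ne (c*q)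
  have e2 : ((c*q:ℕ):ℝ)^(-(1:ℝ)/2) = (c:ℝ)^(-(1:ℝ)/2) * (q:ℝ)^(-(1:ℝ)/2) := by
    push_cast; rw [Real.mul_rpow hc0.le hq0.le]
  rw [e2, Complex.ofReal_mul, hA, inv_mul_cancel_right₀ hne]
  ring

/-- dyadic block of the main sum -/
lemma main_block (k : ℕ) (hk : 1000 < k) (σ : ℝ) (hσ : 0 < σ) (hσ' : σ < 1/2) :
    ∃ C : ℝ, 0 ≤ C ∧ ∀ q : ℕ, q.Prime → ∀ M : ℕ, 1 ≤ M →
      ‖∑ m ∈ Finset.Ico M (2*M), ∑ c ∈ Finset.Ico 1 q, ∑' n : ℕ, tt k q n m c‖ ≤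
        C * (1 + Real.log q) * (q:ℝ)^(-(1:ℝ)/8 + σ/2) * (M:ℝ)^(-σ/2) := by
  obtain ⟨KV, hV⟩ := FV_cls k hk
  obtain ⟨KW, hW⟩ := FW_cls k hk
  obtain ⟨K0, hK0, hb⟩ := block_bound KV σ hσ hσ' (k-3) (by omega)
  have hW0 := hW.K_nonneg (a := 3/4+σ) (b := 3/4+σ) (by positivity) le_rfl
  refine ⟨K0 * (3 * KW (3/4+σ) (3/4+σ)), by positivity, ?_⟩
  intro q hq M hM
  have hq1 : 1 ≤ q := hq.one_lt.le
  have hq0 : (0:ℝ) < q := by exact_mod_cast hq1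
  have hM0 : (0:ℝ) < M := by exact_mod_cast hM
  have hsq : 0 < Real.sqrt q := Real.sqrt_pos.mpr hq0
  rw [Finset.sum_comm]
  rw [Finset.sum_congr rfl (fun c hc => Finset.sum_congr rfl (fun m hm => nsum_eval k hk q hq m c
    (hM.trans (Finset.mem_Ico.mp hm).1) (Finset.mem_Ico.mp hc).1 (Finset.mem_Ico.mp hc).2))]
  refine (hb (FV k q) (hV q hq1) M q hM hq1
    (fun m h => ((q:ℝ)^(-(1:ℝ)/2):ℝ) * ((m : ℝ) ^ (-(1 : ℝ) / 2) : ℝ) * Wfun k ((m : ℝ) / Real.sqrt q) * lamS m h q)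
    ((q:ℝ)^(-(1:ℝ)/2) * (M:ℝ)^(-(1:ℝ)/2) * (KW (3/4+σ) (3/4+σ) * ((M:ℝ)/Real.sqrt q)^(-(3/4+σ))) * 3)
    (by positivity) ?_).trans (le_of_eq ?_)
  · intro m hm h
    have hMm : (M:ℝ) ≤ m := by exact_mod_cast (Finset.mem_Ico.mp hm).1
    have hm0 : (0:ℝ) < m := hM0.trans_le hMm
    have w := hW.Mel_bound' (by norm_num) (σ := 2) (σ' := 3/4+σ) (y := (m:ℝ)/Real.sqrt q) (by norm_num) (by positivity) (by positivity)
    rw [← Wfun_eq] at w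
    have l := lamS_prime m h q hq
    rw [norm_mul, norm_mul, norm_mul, Complex.norm_real, Complex.norm_real,
      Real.norm_of_nonneg (by positivity : 0 ≤ (q:ℝ)^(-(1:ℝ)/2)), Real.norm_of_nonneg (by positivity : 0 ≤ (m:ℝ)^(-(1:ℝ)/2))]
    have m1 : (m:ℝ)^(-(1:ℝ)/2) ≤ (M:ℝ)^(-(1:ℝ)/2) := Real.rpow_le_rpow_of_nonpos hM0 hMm (by norm_num)
    have m2 : ((m:ℝ)/Real.sqrt q)^(-(3/4+σ)) ≤ ((M:ℝ)/Real.sqrt q)^(-(3/4+σ)) :=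
      Real.rpow_le_rpow_of_nonpos (by positivity) (by gcongr) (by linarith)
    have w' := w.trans (mul_le_mul_of_nonneg_left m2 hW0)
    gcongr
  · rw [Real.div_rpow hM0.le hsq.le, Real.sqrt_eq_rpow, ← Real.rpow_mul hq0.le,
      div_eq_mul_inv ((M:ℝ)^(-(3/4+σ))), ← Real.rpow_neg hq0.le]
    have eM : (M:ℝ)^(-σ/2) = (M:ℝ)^(-(1:ℝ)/2) * (M:ℝ)^(-(3/4+σ)) * (M:ℝ)^(5/4+σ/2) := by
      rw [← Real.rpow_add hM0, ← Real.rpow_add hM0]; congr 1; ring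
    have eq : (q:ℝ)^(-(1:ℝ)/8+σ/2) = (q:ℝ)^(-(1:ℝ)/2) * (q:ℝ)^(-(1/2*(-(3/4+σ)))) := by
      rw [← Real.rpow_add hq0]; congr 1; ring
    rw [eM, eq]; ring

lemma dyadic_sum (A : ℕ → ℂ) (h0 : A 0 = 0) (N : ℕ) :
    ∑ m ∈ Finset.range (2^N), A m = ∑ i ∈ Finset.range N, ∑ m ∈ Finset.Ico (2^i) (2*2^i), A m := by
  induction N with
  | zero => simp [h0]
  | succ N ih =>
    rw [Finset.sum_range_succ, ← ih, Finset.range_eq_Ico, Finset.range_eq_Ico,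
      Finset.sum_Ico_consecutive _ (Nat.zero_le _) (by omega), pow_succ, mul_comm]

lemma main_sum (k : ℕ) (hk : 1000 < k) (ε : ℝ) (hε : 0 < ε) :
    ∃ C : ℝ, 0 ≤ C ∧ ∀ q : ℕ, q.Prime → ∀ S : ℂ,
      HasSum (fun m : ℕ => ∑ c ∈ Finset.Ico 1 q, ∑' n : ℕ, tt k q n m c) S →
      ‖S‖ ≤ C * (q:ℝ)^(-(1:ℝ)/8 + ε) := by
  set σ := min ε (1/4) with hσd
  have hσ : 0 < σ := lt_min hε (by norm_num)
  have hσ' : σ < 1/2 := (min_le_right _ _).trans_lt (by norm_num)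
  have hσε : σ ≤ ε := min_le_left _ _
  obtain ⟨C, hC, hb⟩ := main_block k hk σ hσ hσ'
  set ρ : ℝ := (2:ℝ)^(-σ/2) with hρ
  have hρ0 : 0 ≤ ρ := by positivity
  have hρ1 : ρ < 1 := Real.rpow_lt_one_of_one_lt_of_neg (by norm_num) (by linarith)
  have hinv : 0 ≤ (1-ρ)⁻¹ := inv_nonneg.mpr (by linarith)
  refine ⟨C * (1 + (ε/2)⁻¹) * (1-ρ)⁻¹, by positivity, ?_⟩
  intro q hq S hS
  have hq1 : (1:ℝ) ≤ q := by exact_mod_cast hq.one_lt.le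
  have hq0 : (0:ℝ) < q := by linarith
  have hlog : 0 ≤ Real.log q := Real.log_natCast_nonneg q
  have ht : Tendsto (fun N : ℕ => ∑ m ∈ Finset.range (2^N), ∑ c ∈ Finset.Ico 1 q, ∑' n : ℕ, tt k q n m c) atTop (nhds S) :=
    hS.tendsto_sum_nat.comp (tendsto_pow_atTop_atTop_of_one_lt (by norm_num))
  refine le_of_tendsto ht.norm (Eventually.of_forall fun N => ?_)
  rw [dyadic_sum _ (by simp [tt_zero_m])]
  refine (norm_sum_le _ _).trans ?_
  have h1 : ∀ i ∈ Finset.range N, ‖∑ m ∈ Finset.Ico (2^i) (2*2^i), ∑ c ∈ Finset.Ico 1 q, ∑' n : ℕ, tt k q n m c‖ ≤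
      C * (1 + Real.log q) * (q:ℝ)^(-(1:ℝ)/8 + σ/2) * ρ^i := by
    intro i _
    refine (hb q hq (2^i) Nat.one_le_two_pow).trans (le_of_eq ?_)
    congr 1
    push_cast
    rw [hρ, ← Real.rpow_natCast, ← Real.rpow_natCast, ← Real.rpow_mul (by norm_num), ← Real.rpow_mul (by norm_num), mul_comm]
  refine (Finset.sum_le_sum h1).trans ?_
  rw [← Finset.mul_sum]
  have h2 : ∑ i ∈ Finset.range N, ρ^i ≤ (1-ρ)⁻¹ := by
    rw [← tsum_geometric_of_lt_one hρ0 hρ1]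
    exact (summable_geometric_of_lt_one hρ0 hρ1).sum_le_tsum _ (fun i _ => by positivity)
  have h3 : 1 + Real.log q ≤ (1 + (ε/2)⁻¹) * (q:ℝ)^(ε/2) := by
    have := Real.log_le_rpow_div hq0.le (half_pos hε)
    have h4 : 1 ≤ (q:ℝ)^(ε/2) := Real.one_le_rpow hq1 (by positivity)
    rw [add_mul, one_mul, inv_mul_eq_div]
    linarith
  have h5 : (q:ℝ)^(ε/2) * (q:ℝ)^(-(1:ℝ)/8 + σ/2) ≤ (q:ℝ)^(-(1:ℝ)/8 + ε) := by
    rw [← Real.rpow_add hq0]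
    exact Real.rpow_le_rpow_of_exponent_le hq1 (by linarith)
  calc _ ≤ C * ((1 + (ε/2)⁻¹) * (q:ℝ)^(ε/2)) * (q:ℝ)^(-(1:ℝ)/8 + σ/2) * (1-ρ)⁻¹ := by gcongr
    _ = C * (1 + (ε/2)⁻¹) * (1-ρ)⁻¹ * ((q:ℝ)^(ε/2) * (q:ℝ)^(-(1:ℝ)/8 + σ/2)) := by ring
    _ ≤ _ := by gcongr

set_option maxHeartbeats 2000000 in
lemma triple_bound (k : ℕ) (hk : 1000 < k) (ε : ℝ) (hε : 0 < ε) :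
    ∃ C : ℝ, ∀ q : ℕ, q.Prime →
      Summable (fun p : ℕ × ℕ × ℕ => ‖tt k q p.1 p.2.1 p.2.2‖) ∧
      ‖∑' p : ℕ × ℕ × ℕ, tt k q p.1 p.2.1 p.2.2‖ ≤ C * (q:ℝ)^(-(1:ℝ)/8 + ε) := by
  obtain ⟨C0, hC0, hb⟩ := tt_bound k hk
  obtain ⟨C1, hC1, hm⟩ := main_sum k hk ε hε
  have s1 : Summable (fun n : ℕ => (n:ℝ)^(-(3:ℝ)/2)) := Real.summable_nat_rpow.mpr (by norm_num)
  have s4 : Summable (fun n : ℕ => (n:ℝ)^(-4:ℝ)) := Real.summable_nat_rpow.mpr (by norm_num)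
  have s5 : Summable (fun n : ℕ => (n:ℝ)^(-(11:ℝ)/8)) := Real.summable_nat_rpow.mpr (by norm_num)
  have P4 : Summable (fun p : ℕ × ℕ × ℕ => (p.1:ℝ)^(-(3:ℝ)/2) * ((p.2.1:ℝ)^(-(3:ℝ)/2) * (p.2.2:ℝ)^(-4:ℝ))) :=
    s1.mul_of_nonneg (s1.mul_of_nonneg s4 (fun n => by positivity) (fun n => by positivity))
      (fun n => by positivity) (fun p => by dsimp; positivity)
  have P5 : Summable (fun p : ℕ × ℕ × ℕ => (p.1:ℝ)^(-(3:ℝ)/2) * ((p.2.1:ℝ)^(-(3:ℝ)/2) * (p.2.2:ℝ)^(-(11:ℝ)/8))) :=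
    s1.mul_of_nonneg (s1.mul_of_nonneg s5 (fun n => by positivity) (fun n => by positivity))
      (fun n => by positivity) (fun p => by dsimp; positivity)
  set Z := ∑' p : ℕ × ℕ × ℕ, (p.1:ℝ)^(-(3:ℝ)/2) * ((p.2.1:ℝ)^(-(3:ℝ)/2) * (p.2.2:ℝ)^(-(11:ℝ)/8)) with hZ
  have hZ0 : 0 ≤ Z := tsum_nonneg fun p => by positivity
  refine ⟨C1 + C0 * Z, ?_⟩
  intro q hq
  have hq1' : 1 ≤ q := hq.one_lt.le
  have hq1 : (1:ℝ) ≤ q := by exact_mod_cast hq1'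
  have hq0 : (0:ℝ) < q := by linarith
  have hsn : Summable (fun p : ℕ × ℕ × ℕ => ‖tt k q p.1 p.2.1 p.2.2‖) :=
    Summable.of_nonneg_of_le (fun p => norm_nonneg _) (fun p => hb q hq1' p.1 p.2.1 p.2.2)
      (P4.mul_left _)
  refine ⟨hsn, ?_⟩
  set T1 : ℕ × ℕ × ℕ → ℂ := fun p => if p.2.2 < q then tt k q p.1 p.2.1 p.2.2 else 0 with hT1
  set T2 : ℕ × ℕ × ℕ → ℂ := fun p => if p.2.2 < q then 0 else tt k q p.1 p.2.1 p.2.2 with hT2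
  have sT1 : Summable T1 := by
    refine Summable.of_norm_bounded hsn fun p => ?_
    simp only [hT1]; split_ifs <;> simp
  have bT2 : ∀ p, ‖T2 p‖ ≤ C0 * (q:ℝ)^(-(1:ℝ)/8) * ((p.1:ℝ)^(-(3:ℝ)/2) * ((p.2.1:ℝ)^(-(3:ℝ)/2) * (p.2.2:ℝ)^(-(11:ℝ)/8))) := by
    intro p
    simp only [hT2]
    split_ifs with hlt
    · rw [norm_zero]; positivity
    · push Not at hlt
      have hle : (q:ℝ) ≤ p.2.2 := by exact_mod_cast hlt
      have hp0 : (0:ℝ) < p.2.2 := by linarith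
      refine (hb q hq1' p.1 p.2.1 p.2.2).trans ?_
      have e : (p.2.2:ℝ)^(-4:ℝ) ≤ (q:ℝ)^(-(21:ℝ)/8) * (p.2.2:ℝ)^(-(11:ℝ)/8) := by
        have : (p.2.2:ℝ)^(-4:ℝ) = (p.2.2:ℝ)^(-(21:ℝ)/8) * (p.2.2:ℝ)^(-(11:ℝ)/8) := by
          rw [← Real.rpow_add hp0]; norm_num
        rw [this]
        gcongr 1
        exact Real.rpow_le_rpow_of_nonpos hq0 hle (by norm_num)
      have eq : (q:ℝ)^(-(1:ℝ)/8) = (q:ℝ)^(5/2:ℝ) * (q:ℝ)^(-(21:ℝ)/8) := by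
        rw [← Real.rpow_add hq0]; norm_num
      calc _ ≤ C0 * (q:ℝ)^(5/2:ℝ) * ((p.1:ℝ)^(-(3:ℝ)/2) * ((p.2.1:ℝ)^(-(3:ℝ)/2) * ((q:ℝ)^(-(21:ℝ)/8) * (p.2.2:ℝ)^(-(11:ℝ)/8)))) := by gcongr
        _ = _ := by rw [eq]; ring
  have sT2 : Summable T2 := Summable.of_norm_bounded (P5.mul_left _) bT2
  have hsplit : ∑' p : ℕ × ℕ × ℕ, tt k q p.1 p.2.1 p.2.2 = ∑' p, T1 p + ∑' p, T2 p := by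
    rw [← sT1.tsum_add sT2]
    refine tsum_congr fun p => ?_
    simp only [hT1, hT2]; split_ifs <;> simp
  have hqe : (q:ℝ)^(-(1:ℝ)/8) ≤ (q:ℝ)^(-(1:ℝ)/8 + ε) := Real.rpow_le_rpow_of_exponent_le hq1 (by linarith)
  have hT2b : ‖∑' p, T2 p‖ ≤ C0 * Z * (q:ℝ)^(-(1:ℝ)/8 + ε) := by
    refine (tsum_of_norm_bounded (P5.mul_left _).hasSum bT2).trans ?_
    rw [tsum_mul_left, ← hZ]
    calc C0 * (q:ℝ)^(-(1:ℝ)/8) * Z = C0 * Z * (q:ℝ)^(-(1:ℝ)/8) := by ring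
      _ ≤ _ := by gcongr
  let e : ℕ × ℕ × ℕ ≃ ℕ × ℕ × ℕ :=
    { toFun := fun p => (p.2.2, p.1, p.2.1)
      invFun := fun p => (p.2.1, p.2.2, p.1)
      left_inv := fun p => rfl
      right_inv := fun p => rfl }
  have sT1e : Summable (fun p => T1 (e p)) := e.summable_iff.mpr sT1
  have hin : ∀ m : ℕ, ∑' x : ℕ × ℕ, T1 (e (m, x)) = ∑ c ∈ Finset.Ico 1 q, ∑' n : ℕ, tt k q n m c := by
    intro m
    have sm : Summable (fun x : ℕ × ℕ => T1 (e (m, x))) := sT1e.prod_factor m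
    rw [sm.tsum_prod, tsum_eq_sum (s := Finset.Ico 1 q)]
    · refine Finset.sum_congr rfl fun c hc => tsum_congr fun n => ?_
      exact if_pos (Finset.mem_Ico.mp hc).2
    · intro c hc
      have : ∀ n : ℕ, T1 (e (m, c, n)) = 0 := by
        intro n
        change (if c < q then tt k q n m c else 0) = 0
        split_ifs with h
        · have : c = 0 := by
            by_contra h0
            exact hc (Finset.mem_Ico.mpr ⟨by omega, h⟩)
          rw [this, tt_zero_c]
        · rfl
      simp [this]
  have hhs : HasSum (fun m : ℕ => ∑ c ∈ Finset.Ico 1 q, ∑' n : ℕ, tt k q n m c) (∑' p, T1 p) := by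
    have h1 : HasSum (fun p => T1 (e p)) (∑' p, T1 p) := e.hasSum_iff.mpr sT1.hasSum
    have h2 := h1.prod_fiberwise (fun m => (sT1e.prod_factor m).hasSum)
    simpa only [hin] using h2
  have := hm q hq _ hhs
  rw [hsplit, add_mul]
  exact (norm_add_le _ _).trans (add_le_add this hT2b)

end PartG

/-- transfer from `ℕ³` to `ℕ+³` -/
lemma pnat_transfer1 {A B : Type} (ι : A → B) (hι : Function.Injective ι) (G : B → ℂ) 
    (hs : Summable (fun p => ‖G p‖)) (h : Function.support G ⊆ Set.range ι) :
    Summable (fun p => ‖G (ι p)‖) ∧ ∑' p, G (ι p) = ∑' p, G p := 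
  ⟨hs.comp_injective hι, hι.tsum_eq h⟩

def iota3 (p : ℕ+ × ℕ+ × ℕ+) : ℕ × ℕ × ℕ := ((p.1 : ℕ), (p.2.1 : ℕ), (p.2.2 : ℕ))
lemma iota3_inj : Function.Injective iota3 := by
  intro a b h
  have h' : ((a.1 : ℕ), (a.2.1 : ℕ), (a.2.2 : ℕ)) = ((b.1 : ℕ), (b.2.1 : ℕ), (b.2.2 : ℕ)) := h
  rw [Prod.mk.injEq, Prod.mk.injEq] at h'
  exact Prod.ext (PNat.eq h'.1) (Prod.ext (PNat.eq h'.2.1) (PNat.eq h'.2.2))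

lemma iota3_range (n m c : ℕ) (hn : 0 < n) (hm : 0 < m) (hc : 0 < c) :
    (n, m, c) ∈ Set.range iota3 := ⟨(⟨n, hn⟩, ⟨m, hm⟩, ⟨c, hc⟩), rfl⟩

lemma pnat_transfer (g : ℕ → ℕ → ℕ → ℂ) (h1 : ∀ m c, g 0 m c = 0) (h2 : ∀ n c, g n 0 c = 0)
    (h3 : ∀ n m, g n m 0 = 0)
    (hs : Summable (fun p : ℕ × ℕ × ℕ => ‖g p.1 p.2.1 p.2.2‖)) :
    Summable (fun p : ℕ+ × ℕ+ × ℕ+ => ‖g p.1 p.2.1 p.2.2‖) ∧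
    ∑' p : ℕ+ × ℕ+ × ℕ+, g p.1 p.2.1 p.2.2 = ∑' p : ℕ × ℕ × ℕ, g p.1 p.2.1 p.2.2 := by
  refine pnat_transfer1 iota3 iota3_inj (fun p => g p.1 p.2.1 p.2.2) hs ?_
  rintro ⟨n, m, c⟩ hp
  rw [Function.mem_support] at hp
  refine iota3_range n m c ?_ ?_ ?_
  · rcases Nat.eq_zero_or_pos n with rfl | h
    · exact absurd (h1 m c) hp
    · exact h
  · rcases Nat.eq_zero_or_pos m with rfl | h
    · exact absurd (h2 n c) hp
    · exact h
  · rcases Nat.eq_zero_or_pos c with rfl | h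
    · exact absurd (h3 n m) hp
    · exact h

theorem statement13 (k : ℕ) (hk : Even k) (hk1000 : 1000 < k) (ε : ℝ) (hε : 0 < ε) :
    ∃ C : ℝ, ∀ q : ℕ, q.Prime →
      Summable (fun p : ℕ+ × ℕ+ × ℕ+ =>
        ‖(((p.1 : ℝ) ^ (-(1 : ℝ) / 2) : ℝ) : ℂ) * Vfun k q ((p.1 : ℝ) / q) *
          (((p.2.1 : ℝ) ^ (-(1 : ℝ) / 2) : ℝ) : ℂ) * Wfun k ((p.2.1 : ℝ) / Real.sqrt q) *
          (kloos (p.2.1 : ℤ) ((p.1 : ℤ) ^ 2) ((p.2.2 : ℕ) * q) / (((p.2.2 : ℕ) * q : ℕ) : ℂ)) *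
          (besselJ (k - 1)
            (4 * Real.pi * (p.1 : ℝ) * Real.sqrt (p.2.1 : ℝ) /
              (((p.2.2 : ℕ) * q : ℕ) : ℝ)) : ℂ)‖) ∧
      ‖∑' p : ℕ+ × ℕ+ × ℕ+,
          (((p.1 : ℝ) ^ (-(1 : ℝ) / 2) : ℝ) : ℂ) * Vfun k q ((p.1 : ℝ) / q) *
            (((p.2.1 : ℝ) ^ (-(1 : ℝ) / 2) : ℝ) : ℂ) * Wfun k ((p.2.1 : ℝ) / Real.sqrt q) *
            (kloos (p.2.1 : ℤ) ((p.1 : ℤ) ^ 2) ((p.2.2 : ℕ) * q) /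
              (((p.2.2 : ℕ) * q : ℕ) : ℂ)) *
            (besselJ (k - 1)
              (4 * Real.pi * (p.1 : ℝ) * Real.sqrt (p.2.1 : ℝ) /
                (((p.2.2 : ℕ) * q : ℕ) : ℝ)) : ℂ)‖
        ≤ C * (q : ℝ) ^ (-(1 : ℝ) / 8 + ε) := by
  obtain ⟨C, hC⟩ := triple_bound k hk1000 ε hε
  refine ⟨C, fun q hq => ?_⟩
  obtain ⟨h1, h2⟩ := hC q hq
  obtain ⟨h3, h4⟩ := pnat_transfer (tt k q) (tt_zero_n k q) (tt_zero_m k q) (tt_zero_c k q) h1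
  rw [← h4] at h2
  clear h4 h1 hC
  simp only [tt] at h2 h3
  exact And.intro h3 h2
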